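/- arXiv:1712.02176 — 4 statements merged into one kernel-verified Lean document; each statement's English description precedes it below -/
import Mathlib

section
/- There exist constants α, γ, κ > 0 such that for every integer n ≥ 2, every (α/n)-MILEF of the matching polytope P_match(n) of the complete graph K_n of size at most 2^{γ·n} has at least κ·n/log n integer variables. -/
open scoped ENNReal Pointwise

/-- The relative distance between two sets `A ⊆ B ⊆ ℝ^ι`:
`rdist(A,B) = sup_{π linear} d_H(π(A),π(B)) / diam(π(A))`, computed in `ℝ≥0∞`,
so that a fraction with `∞` in the denominator as well as `0/0` is `0`,
`rdist(∅,∅) = 0` and `rdist(∅,B) = ∞` for `B ≠ ∅`. -/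
noncomputable def relDist {ι : Type*} (A B : Set (ι → ℝ)) : ℝ≥0∞ :=
  ⨆ π : (ι → ℝ) →ₗ[ℝ] ℝ,
    (⨆ b ∈ B, ⨅ a ∈ A, ENNReal.ofReal |π b - π a|) /
      (⨆ a ∈ A, ⨆ a' ∈ A, ENNReal.ofReal |π a - π a'|)

/-- A point of `ℝ^k` all of whose coordinates are integers. -/
def IsLatticePoint {k : ℕ} (z : Fin k → ℝ) : Prop := ∀ i, ∃ n : ℤ, z i = (n : ℝ)

/-- `Q` is a polyhedron given as the intersection of an affine subspace with at most `m`
closed halfspaces (`m` serving as the number of facets). -/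
def IsPolyhedronOfSize {ι : Type*} (Q : Set (ι → ℝ)) (m : ℕ) : Prop :=
  ∃ (S : AffineSubspace ℝ (ι → ℝ)) (nh : ℕ), nh ≤ m ∧
    ∃ (f : Fin nh → ((ι → ℝ) →ₗ[ℝ] ℝ)) (b : Fin nh → ℝ),
      Q = (S : Set (ι → ℝ)) ∩ {x | ∀ i, f i x ≤ b i}

/-- `Q` is a polyhedron. -/
def IsPolyhedron {ι : Type*} (Q : Set (ι → ℝ)) : Prop := ∃ m, IsPolyhedronOfSize Q m

/-- `C` admits an `ε`-MILEF of complexity `(m, k)`: a polyhedron `Q ⊆ ℝ^ℓ` with at most `m`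
facets together with affine maps `σ : ℝ^ℓ → ℝ^k` and `π : ℝ^ℓ → ℝ^ι` such that
`C̄ := conv(π(Q ∩ σ⁻¹(ℤ^k)))` satisfies `C ⊆ C̄` and `rdist(C, C̄) ≤ ε`. -/
def IsMILEF {ι : Type*} (C : Set (ι → ℝ)) (ε : ℝ) (m k : ℕ) : Prop :=
  ∃ (l : ℕ) (Q : Set (Fin l → ℝ)) (σ : (Fin l → ℝ) →ᵃ[ℝ] (Fin k → ℝ))
    (π : (Fin l → ℝ) →ᵃ[ℝ] (ι → ℝ)),
    IsPolyhedronOfSize Q m ∧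
    C ⊆ convexHull ℝ (π '' (Q ∩ {x | IsLatticePoint (σ x)})) ∧
    relDist C (convexHull ℝ (π '' (Q ∩ {x | IsLatticePoint (σ x)}))) ≤ ENNReal.ofReal ε

/-- The edge set of the complete undirected graph `K_n` on vertex set `Fin n`:
the 2-element subsets of `Fin n`. -/
abbrev CompleteEdge (n : ℕ) := {e : Sym2 (Fin n) // ¬ e.IsDiag}

/-- `M` is a matching in `K_n`: a set of edges such that every vertex is contained in at
most one edge of `M`. -/
def IsMatchingIn (n : ℕ) (M : Set (Sym2 (Fin n))) : Prop :=
  (∀ e ∈ M, ¬ e.IsDiag) ∧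
  ∀ e ∈ M, ∀ f ∈ M, e ≠ f → ∀ v : Fin n, ¬ (v ∈ e ∧ v ∈ f)

/-- The matching polytope of `K_n`: the convex hull in `ℝ^E` of the characteristic vectors
of all matchings in `K_n`. -/
noncomputable def matchingPolytope (n : ℕ) : Set (CompleteEdge n → ℝ) :=
  convexHull ℝ { x | ∃ M : Set (Sym2 (Fin n)), IsMatchingIn n M ∧
    x = fun e : CompleteEdge n => Set.indicator M (fun _ => (1 : ℝ)) e.val }

/-- Homogeneous Farkas lemma for finitely many linear functionals. -/
theorem farkas_homogeneous {W : Type*} [AddCommGroup W] [Module ℝ W] (n : ℕ) :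
    ∀ (f : Fin n → (W →ₗ[ℝ] ℝ)) (g : W →ₗ[ℝ] ℝ),
      (∀ x, (∀ i, f i x ≤ 0) → g x ≤ 0) →
      ∃ u : Fin n → ℝ, (∀ i, 0 ≤ u i) ∧ ∀ x, g x = ∑ i, u i * f i x := by
  induction n with
  | zero =>
    intro f g h
    refine ⟨fun _ => 0, fun _ => le_rfl, fun x => ?_⟩
    have h1 := h x (fun i => i.elim0)
    have h2 := h (-x) (fun i => i.elim0)
    simp only [map_neg] at h2
    simp
    linarith
  | succ n ih =>
    intro f g h
    by_cases hc : ∀ x, (∀ i : Fin n, f i.castSucc x ≤ 0) → g x ≤ 0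
    · obtain ⟨u, hu, hg⟩ := ih (fun i => f i.castSucc) g hc
      refine ⟨Fin.snoc u 0, fun i => ?_, fun x => ?_⟩
      · refine Fin.lastCases ?_ (fun j => ?_) i
        · simp
        · simpa using hu j
      · rw [Fin.sum_univ_castSucc, hg x]
        simp
    · push Not at hc
      obtain ⟨x₁, hx₁, hgx₁⟩ := hc
      have hpos : 0 < f (Fin.last n) x₁ := by
        by_contra hcon
        push Not at hcon
        have := h x₁ (fun i => Fin.lastCases hcon hx₁ i)
        linarith
      set t := f (Fin.last n) x₁ with ht
      set x₀ := t⁻¹ • x₁ with hx₀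
      have hl : f (Fin.last n) x₀ = 1 := by
        simp [hx₀, ← ht, hpos.ne']
      have hx₀' : ∀ i : Fin n, f i.castSucc x₀ ≤ 0 := fun i => by
        simp only [hx₀, map_smul, smul_eq_mul]
        exact mul_nonpos_of_nonneg_of_nonpos (inv_nonneg.2 hpos.le) (hx₁ i)
      have hg₀ : 0 < g x₀ := by
        simp only [hx₀, map_smul, smul_eq_mul]
        positivity
      obtain ⟨u, hu, hg⟩ := ih
        (fun i => f i.castSucc - (f i.castSucc x₀) • f (Fin.last n))
        (g - (g x₀) • f (Fin.last n)) (by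
          intro x hx
          have := h (x - f (Fin.last n) x • x₀) (fun i => by
            refine Fin.lastCases ?_ (fun j => ?_) i
            · simp [hl]
            · have := hx j
              simp only [LinearMap.sub_apply, LinearMap.smul_apply, smul_eq_mul] at this
              simp only [map_sub, map_smul, smul_eq_mul]
              linarith)
          simp only [map_sub, map_smul, smul_eq_mul] at this
          simp only [LinearMap.sub_apply, LinearMap.smul_apply, smul_eq_mul]
          linarith)
      refine ⟨Fin.snoc u (g x₀ - ∑ i : Fin n, u i * f i.castSucc x₀), fun i => ?_, fun x => ?_⟩
      · refine Fin.lastCases ?_ (fun j => ?_) i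
        · simp only [Fin.snoc_last]
          have : ∑ i : Fin n, u i * f i.castSucc x₀ ≤ 0 :=
            Finset.sum_nonpos fun i _ => mul_nonpos_of_nonneg_of_nonpos (hu i) (hx₀' i)
          linarith
        · simpa using hu j
      · have := hg x
        simp only [LinearMap.sub_apply, LinearMap.smul_apply, smul_eq_mul, mul_sub,
          Finset.sum_sub_distrib] at this
        rw [Fin.sum_univ_castSucc]
        simp only [Fin.snoc_castSucc, Fin.snoc_last]
        have h3 : ∑ i : Fin n, u i * (f i.castSucc x₀ * f (Fin.last n) x)
            = (∑ i : Fin n, u i * f i.castSucc x₀) * f (Fin.last n) x := by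
          rw [Finset.sum_mul]
          exact Finset.sum_congr rfl fun i _ => by ring
        rw [h3] at this
        linarith

/-- Affine Farkas lemma for a system of inequalities satisfied by `0`. -/
theorem farkas_affine {W : Type*} [AddCommGroup W] [Module ℝ W] {n : ℕ}
    (f : Fin n → (W →ₗ[ℝ] ℝ)) (c : Fin n → ℝ) (hc : ∀ i, 0 ≤ c i) (g : W →ₗ[ℝ] ℝ) (γ : ℝ)
    (h : ∀ x, (∀ i, f i x ≤ c i) → g x ≤ γ) :
    ∃ u : Fin n → ℝ, (∀ i, 0 ≤ u i) ∧ (∀ x, g x = ∑ i, u i * f i x) ∧ ∑ i, u i * c i ≤ γ := by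
  obtain ⟨u, hu, hg⟩ := farkas_homogeneous (W := W × ℝ) (n + 1)
    (Fin.snoc (fun i => (f i).comp (LinearMap.fst ℝ W ℝ) - c i • LinearMap.snd ℝ W ℝ)
      (-LinearMap.snd ℝ W ℝ))
    (g.comp (LinearMap.fst ℝ W ℝ) - γ • LinearMap.snd ℝ W ℝ) (by
      rintro ⟨x, t⟩ hx
      have hx1 : ∀ i : Fin n, f i x ≤ c i * t := fun i => by
        have := hx i.castSucc
        simp at this
        linarith
      have ht : 0 ≤ t := by
        have := hx (Fin.last n)
        simpa using this
      simp only [LinearMap.sub_apply, LinearMap.comp_apply, LinearMap.fst_apply,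
        LinearMap.smul_apply, LinearMap.snd_apply, smul_eq_mul]
      rcases ht.eq_or_lt with rfl | ht
      · by_contra hcon
        push Not at hcon
        simp only [mul_zero, sub_zero] at hcon hx1
        have := h (((|γ| + 1) / g x) • x) (fun i => by
          simp only [map_smul, smul_eq_mul]
          have : 0 ≤ (|γ| + 1) / g x := by positivity
          exact (mul_nonpos_of_nonneg_of_nonpos this (hx1 i)).trans (hc i))
        simp only [map_smul, smul_eq_mul] at this
        rw [div_mul_cancel₀ _ hcon.ne'] at this
        linarith [le_abs_self γ]
      · have := h (t⁻¹ • x) (fun i => by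
          simp only [map_smul, smul_eq_mul]
          rw [inv_mul_le_iff₀ ht]
          linarith [hx1 i])
        simp only [map_smul, smul_eq_mul] at this
        rw [inv_mul_le_iff₀ ht] at this
        linarith)
  refine ⟨fun i => u i.castSucc, fun i => hu _, fun x => ?_, ?_⟩
  · have := hg (x, 0)
    rw [Fin.sum_univ_castSucc] at this
    simpa using this
  · have := hg (0, 1)
    rw [Fin.sum_univ_castSucc] at this
    simp at this
    linarith [hu (Fin.last n)]

/-- If the points of `X` have integral `σ`-images that are congruent modulo `N`, then every `y`
whose `σ`-image lies in the affine span of these images can be pushed slightly towards a point of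
`convexHull X` such that its `σ`-image becomes integral. -/
theorem exists_mem_convexHull_isLatticePoint {l k N : ℕ} (hN : 0 < N)
    (σ : (Fin l → ℝ) →ᵃ[ℝ] (Fin k → ℝ)) (X : Set (Fin l → ℝ)) (x₀ : Fin l → ℝ) (hx₀ : x₀ ∈ X)
    (hx₀int : IsLatticePoint (σ x₀))
    (hcong : ∀ x ∈ X, ∃ w : Fin k → ℤ, ∀ i, σ x i - σ x₀ i = N * w i)
    (y : Fin l → ℝ) (hy : σ y - σ x₀ ∈ Submodule.span ℝ ((fun x => σ x - σ x₀) '' X))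
    (δ : ℝ) (hδ : 0 < δ) (hk : (k : ℝ) ≤ δ * N) :
    ∃ x' ∈ convexHull ℝ X, IsLatticePoint (σ ((1 - δ) • y + δ • x')) := by
  classical
  obtain ⟨B, hBs, hBspan, hBli⟩ := exists_linearIndependent ℝ ((fun x => σ x - σ x₀) '' X)
  have hBfin : B.Finite := hBli.setFinite
  have : Fintype B := hBfin.fintype
  have hcard : Fintype.card B ≤ k := by
    simpa using hBli.fintype_card_le_finrank
  rw [← hBspan] at hy
  have hy' : σ y - σ x₀ ∈ Submodule.span ℝ (Set.range ((↑) : B → (Fin k → ℝ))) := by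
    simpa using hy
  obtain ⟨t, ht⟩ := (Submodule.mem_span_range_iff_exists_fun ℝ).1 hy'
  choose xb hxb hxbσ using fun b : B => hBs b.2
  choose w hw using fun b : B => hcong (xb b) (hxb b)
  have hbw : ∀ (b : B) i, (b : Fin k → ℝ) i = N * w b i := fun b i => by
    rw [← hw b i, ← hxbσ b]
    rfl
  have hNr : (0 : ℝ) < N := by exact_mod_cast hN
  set s : B → ℝ := fun b => (⌈N * ((1 - δ) * t b)⌉ - N * ((1 - δ) * t b)) / (δ * N) with hs
  have hs0 : ∀ b, 0 ≤ s b := fun b =>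
    div_nonneg (sub_nonneg.2 (Int.le_ceil _)) (by positivity)
  have hs1 : ∀ b, s b ≤ 1 / (δ * N) := fun b => by
    apply div_le_div_of_nonneg_right _ (by positivity)
    linarith [Int.ceil_lt_add_one (N * ((1 - δ) * t b))]
  have hsum : ∑ b, s b ≤ 1 := by
    calc ∑ b, s b ≤ ∑ _b : B, 1 / (δ * N) := Finset.sum_le_sum fun b _ => hs1 b
      _ = Fintype.card B / (δ * N) := by simp [div_eq_mul_inv]
      _ ≤ 1 := by
        rw [div_le_one (by positivity)]
        exact le_trans (by exact_mod_cast hcard) hk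
  refine ⟨(1 - ∑ b, s b) • x₀ + ∑ b, s b • xb b, ?_, fun i => ?_⟩
  · have := (convex_convexHull ℝ X).sum_mem (t := (Finset.univ : Finset (Option B)))
      (w := fun o => o.elim (1 - ∑ b, s b) s) (z := fun o => o.elim x₀ xb)
      (by rintro (_ | b) _ <;> simp [hs0, hsum])
      (by simp [Fintype.sum_option])
      (by
        rintro (_ | b) _
        · exact subset_convexHull ℝ X hx₀
        · exact subset_convexHull ℝ X (hxb b))
    simpa [Fintype.sum_option] using this
  · obtain ⟨z, hz⟩ := hx₀int i
    have hlin : ∀ x, σ x = σ.linear x + σ 0 := fun x => by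
      have := σ.decomp
      exact congrFun this x
    have key : σ ((1 - δ) • y + δ • ((1 - ∑ b, s b) • x₀ + ∑ b, s b • xb b))
        = σ x₀ + (1 - δ) • (σ y - σ x₀) + δ • ∑ b, s b • (σ (xb b) - σ x₀) := by
      have h1 : ∀ b, σ (xb b) - σ x₀ = σ.linear (xb b) - σ.linear x₀ := fun b => by
        rw [hlin (xb b), hlin x₀]; abel
      simp only [h1]
      rw [hlin, hlin y, hlin x₀]
      simp only [map_add, map_smul, map_sum, smul_sub, Finset.sum_sub_distrib, ← Finset.sum_smul]
      module
    rw [key, ← ht]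
    have h2 : ∀ b, σ (xb b) - σ x₀ = b := hxbσ
    simp only [h2, Pi.add_apply, Pi.smul_apply, Finset.sum_apply, smul_eq_mul, hz, hbw]
    refine ⟨z + ∑ b, ⌈N * ((1 - δ) * t b)⌉ * w b i, ?_⟩
    push_cast
    rw [add_assoc, Finset.mul_sum, Finset.mul_sum, ← Finset.sum_add_distrib]
    congr 1
    refine Finset.sum_congr rfl fun b _ => ?_
    simp only [hs]
    field_simp
    ring

/-- The points of a mixed-integer set that lie in one residue class modulo `N` satisfy a slightly
relaxed valid inequality, and its validity is certified by the inequality description alone. -/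
theorem exists_certificate_of_residue_class {ι : Type*} {l k nh N : ℕ} (hN : 0 < N)
    (S : AffineSubspace ℝ (Fin l → ℝ)) (f : Fin nh → ((Fin l → ℝ) →ₗ[ℝ] ℝ)) (b : Fin nh → ℝ)
    (σ : (Fin l → ℝ) →ᵃ[ℝ] (Fin k → ℝ)) (π : (Fin l → ℝ) →ᵃ[ℝ] (ι → ℝ))
    (a : (ι → ℝ) →ₗ[ℝ] ℝ) (lo hi β δ : ℝ) (hδ : 0 < δ) (hδ1 : δ < 1) (hk : (k : ℝ) ≤ δ * N)
    (hbd : ∀ x ∈ S, (∀ i, f i x ≤ b i) → IsLatticePoint (σ x) →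
      lo ≤ a (π x) ∧ a (π x) ≤ hi)
    (hβ : hi - δ * lo ≤ (1 - δ) * β) (r : Fin k → ZMod N) :
    ∃ p : Option (Fin nh) → ℝ, (∀ o, 0 ≤ p o) ∧
      ∀ x ∈ S, (∀ i, f i x ≤ b i) →
        (∃ z : Fin k → ℤ, (∀ i, σ x i = z i) ∧ ∀ i, (z i : ZMod N) = r i) →
        β - a (π x) = p none + ∑ i, p (some i) * (b i - f i x) := by
  set X : Set (Fin l → ℝ) := {x | x ∈ S ∧ (∀ i, f i x ≤ b i) ∧
    ∃ z : Fin k → ℤ, (∀ i, σ x i = z i) ∧ ∀ i, (z i : ZMod N) = r i} with hX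
  by_cases hne : X.Nonempty
  swap
  · refine ⟨fun _ => 0, fun _ => le_rfl, fun x hxS hxf hxz => ?_⟩
    exact absurd ⟨x, hxS, hxf, hxz⟩ hne
  obtain ⟨x₀, hx₀⟩ := hne
  obtain ⟨hx₀S, hx₀f, z₀, hz₀, hz₀r⟩ := id hx₀
  have hcong : ∀ x ∈ X, ∃ w : Fin k → ℤ, ∀ i, σ x i - σ x₀ i = N * w i := by
    rintro x ⟨_, _, z, hz, hzr⟩
    have : ∀ i, ∃ w : ℤ, z i - z₀ i = N * w := fun i => by
      have h : ((z₀ i : ℤ) : ZMod N) = (z i : ZMod N) := by rw [hzr, hz₀r]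
      exact (ZMod.intCast_eq_intCast_iff_dvd_sub _ _ _).1 h
    choose w hw using this
    refine ⟨w, fun i => ?_⟩
    rw [hz, hz₀]
    exact_mod_cast hw i
  have hcongr : ∀ x, σ x - σ x₀ = σ.linear (x - x₀) := fun x => by
    have := σ.linearMap_vsub x x₀
    simpa using this.symm
  have hpi : ∀ x, a (π x) - a (π x₀) = a (π.linear (x - x₀)) := fun x => by
    have := π.linearMap_vsub x x₀
    simp only [vsub_eq_sub] at this
    rw [this, map_sub]
  set V := Submodule.span ℝ ((fun x => σ x - σ x₀) '' X) with hV
  set W : Submodule ℝ (Fin l → ℝ) := S.direction ⊓ V.comap σ.linear with hW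
  obtain ⟨u, hu, hg, hγ⟩ := farkas_affine (W := W) (fun i => (f i).comp W.subtype)
    (fun i => b i - f i x₀) (fun i => sub_nonneg.2 (hx₀f i))
    ((a.comp π.linear).comp W.subtype) (β - a (π x₀)) (by
      rintro ⟨d, hdS, hdV⟩ hd
      simp only [LinearMap.comp_apply, Submodule.subtype_apply] at hd ⊢
      have hdV' : σ.linear d ∈ V := hdV
      have hyS : x₀ + d ∈ S := by
        have := AffineSubspace.vadd_mem_of_mem_direction hdS hx₀S
        rwa [vadd_eq_add, add_comm] at this
      have hyf : ∀ i, f i (x₀ + d) ≤ b i := fun i => by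
        rw [map_add]; linarith [hd i]
      obtain ⟨x', hx', hlat⟩ := exists_mem_convexHull_isLatticePoint hN σ X x₀ hx₀
        (fun i => ⟨z₀ i, hz₀ i⟩) hcong (x₀ + d) (by rw [hcongr]; simpa using hdV') δ hδ hk
      have hx'S : x' ∈ S ∧ ∀ i, f i x' ≤ b i := by
        have hconv : Convex ℝ {x | x ∈ S ∧ ∀ i, f i x ≤ b i} := by
          have h2 : Convex ℝ (⋂ i, {x | f i x ≤ b i}) :=
            convex_iInter fun i => convex_halfSpace_le (f i).isLinear (b i)
          have h3 : {x | x ∈ S ∧ ∀ i, f i x ≤ b i} = (S : Set _) ∩ ⋂ i, {x | f i x ≤ b i} := by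
            ext x; simp
          rw [h3]
          exact S.convex.inter h2
        exact convexHull_min (t := {x | x ∈ S ∧ ∀ i, f i x ≤ b i})
          (fun x (hx : x ∈ X) => ⟨hx.1, hx.2.1⟩) hconv hx'
      have hx'lo : lo ≤ a (π x') := by
        have hconv : Convex ℝ (π ⁻¹' {c | lo ≤ a c}) :=
          (convex_halfSpace_ge a.isLinear lo).affine_preimage π
        exact convexHull_min (s := X)
          (fun x hx => (hbd x hx.1 hx.2.1
            (by obtain ⟨z, hz, _⟩ := hx.2.2; exact fun i => ⟨z i, hz i⟩)).1) hconv hx'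
      have hp := hbd ((1 - δ) • (x₀ + d) + δ • x')
        (S.convex hyS hx'S.1 (by linarith) hδ.le (by ring))
        (fun i => by
          simp only [map_add, map_smul, smul_eq_mul]
          have h1 := hyf i
          rw [map_add] at h1
          have h2 := hx'S.2 i
          nlinarith [mul_le_mul_of_nonneg_left h1 (by linarith : 0 ≤ 1 - δ),
            mul_le_mul_of_nonneg_left h2 hδ.le]) hlat
      have e1 := hpi ((1 - δ) • (x₀ + d) + δ • x')
      have e2 := hpi x'
      have e3 : (1 - δ) • (x₀ + d) + δ • x' - x₀ = (1 - δ) • d + δ • (x' - x₀) := by module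
      have e4 : a (π.linear ((1 - δ) • d + δ • (x' - x₀)))
          = (1 - δ) * a (π.linear d) + δ * a (π.linear (x' - x₀)) := by
        simp only [map_add, map_smul, smul_eq_mul]
      rw [e3, e4, ← e2] at e1
      have h4 : (1 - δ) * a (π.linear d) ≤ (1 - δ) * (β - a (π x₀)) := by
        nlinarith [mul_le_mul_of_nonneg_left hx'lo hδ.le, hp.2]
      exact le_of_mul_le_mul_left h4 (by linarith))
  refine ⟨fun o => o.elim (β - a (π x₀) - ∑ i, u i * (b i - f i x₀)) u, ?_, ?_⟩
  · rintro (_ | i)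
    · exact sub_nonneg.2 hγ
    · exact hu i
  · intro x hxS hxf hxz
    have hxX : x ∈ X := ⟨hxS, hxf, hxz⟩
    have hd : x - x₀ ∈ W := by
      refine ⟨AffineSubspace.vsub_mem_direction hxS hx₀S, ?_⟩
      change σ.linear (x - x₀) ∈ V
      rw [← hcongr]
      exact Submodule.subset_span ⟨x, hxX, rfl⟩
    have := hg ⟨x - x₀, hd⟩
    simp only [LinearMap.comp_apply, Submodule.subtype_apply] at this
    rw [← hpi] at this
    simp only [Option.elim]
    have e : ∑ i, u i * (b i - f i x) = ∑ i, u i * (b i - f i x₀) - ∑ i, u i * f i (x - x₀) := by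
      rw [← Finset.sum_sub_distrib]
      exact Finset.sum_congr rfl fun i _ => by rw [map_sub]; ring
    rw [e]
    linarith

/-- A mixed-integer extended formulation yields nonnegative factorizations of slightly relaxed
slack matrices, whose size is the number of halfspaces plus one, times `N ^ k`. -/
theorem exists_nonneg_factorization {ι 𝒰 : Type*} {l k nh N : ℕ} [NeZero N]
    (S : AffineSubspace ℝ (Fin l → ℝ)) (f : Fin nh → ((Fin l → ℝ) →ₗ[ℝ] ℝ)) (b : Fin nh → ℝ)
    (σ : (Fin l → ℝ) →ᵃ[ℝ] (Fin k → ℝ)) (π : (Fin l → ℝ) →ᵃ[ℝ] (ι → ℝ))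
    (a : 𝒰 → (ι → ℝ) →ₗ[ℝ] ℝ) (lo hi β : 𝒰 → ℝ) (δ : ℝ) (hδ : 0 < δ) (hδ1 : δ < 1)
    (hk : (k : ℝ) ≤ δ * N)
    (hbd : ∀ U, ∀ x ∈ S, (∀ i, f i x ≤ b i) → IsLatticePoint (σ x) →
      lo U ≤ a U (π x) ∧ a U (π x) ≤ hi U)
    (hβ : ∀ U, hi U - δ * lo U ≤ (1 - δ) * β U) :
    ∃ u : 𝒰 → (Fin k → ZMod N) × Option (Fin nh) → ℝ, (∀ U r, 0 ≤ u U r) ∧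
      ∀ c ∈ convexHull ℝ (π '' (((S : Set (Fin l → ℝ)) ∩ {x | ∀ i, f i x ≤ b i}) ∩
          {x | IsLatticePoint (σ x)})),
        ∃ v : (Fin k → ZMod N) × Option (Fin nh) → ℝ, (∀ r, 0 ≤ v r) ∧
          ∀ U, β U - a U c = ∑ r, u U r * v r := by
  classical
  have hN : 0 < N := Nat.pos_of_ne_zero (NeZero.ne N)
  choose p hp hpe using fun (U : 𝒰) (r : Fin k → ZMod N) =>
    exists_certificate_of_residue_class hN S f b σ π (a U) (lo U) (hi U) (β U) δ hδ hδ1 hk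
      (hbd U) (hβ U) r
  refine ⟨fun U r => p U r.1 r.2, fun U r => hp U r.1 r.2, ?_⟩
  apply convexHull_min (t := {c | ∃ v : (Fin k → ZMod N) × Option (Fin nh) → ℝ, (∀ r, 0 ≤ v r) ∧
          ∀ U, β U - a U c = ∑ r, p U r.1 r.2 * v r})
  · rintro _ ⟨x, ⟨⟨hxS, hxf⟩, hxl⟩, rfl⟩
    choose z hz using hxl
    refine ⟨fun r => if r.1 = (fun i => (z i : ZMod N)) then
      r.2.elim 1 (fun i => b i - f i x) else 0, ?_, fun U => ?_⟩
    · rintro ⟨r, _ | i⟩ <;> dsimp only [Option.elim] <;> split_ifs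
      · exact zero_le_one
      · exact le_rfl
      · exact sub_nonneg.2 (hxf i)
      · exact le_rfl
    · rw [hpe U (fun i => (z i : ZMod N)) x hxS hxf ⟨z, hz, fun _ => rfl⟩,
        Fintype.sum_prod_type, Finset.sum_eq_single (fun i => (z i : ZMod N))]
      · simp [Fintype.sum_option]
      · intro r _ hr
        simp [hr]
      · simp
  · rintro c₁ ⟨v₁, hv₁, h₁⟩ c₂ ⟨v₂, hv₂, h₂⟩ s t hs ht hst
    refine ⟨fun r => s * v₁ r + t * v₂ r, fun r =>
      add_nonneg (mul_nonneg hs (hv₁ r)) (mul_nonneg ht (hv₂ r)), fun U => ?_⟩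
    have : ∑ r, p U r.1 r.2 * (s * v₁ r + t * v₂ r)
        = s * ∑ r, p U r.1 r.2 * v₁ r + t * ∑ r, p U r.1 r.2 * v₂ r := by
      rw [Finset.mul_sum, Finset.mul_sum, ← Finset.sum_add_distrib]
      exact Finset.sum_congr rfl fun r _ => by ring
    rw [this, ← h₁ U, ← h₂ U]
    simp only [map_add, map_smul, smul_eq_mul]
    have : t = 1 - s := by linarith
    subst this
    ring

theorem bounds_of_relDist_le {ι : Type*} {A B : Set (ι → ℝ)} {ε D η lo hi : ℝ}
    (h : relDist A B ≤ ENNReal.ofReal ε) (hε : 0 ≤ ε) (a : (ι → ℝ) →ₗ[ℝ] ℝ)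
    (hA : ∀ c ∈ A, lo ≤ a c ∧ a c ≤ hi) (hD : hi - lo ≤ D) (hη : ε * D < η) (hη0 : 0 < η)
    {b : ι → ℝ} (hb : b ∈ B) : lo - η ≤ a b ∧ a b ≤ hi + η := by
  have h1 := (le_iSup (fun π : (ι → ℝ) →ₗ[ℝ] ℝ =>
    (⨆ b ∈ B, ⨅ a ∈ A, ENNReal.ofReal |π b - π a|) /
      (⨆ a ∈ A, ⨆ a' ∈ A, ENNReal.ofReal |π a - π a'|)) a).trans h
  have hden : (⨆ c ∈ A, ⨆ c' ∈ A, ENNReal.ofReal |a c - a c'|) ≤ ENNReal.ofReal D := by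
    refine iSup₂_le fun c hc => iSup₂_le fun c' hc' => ENNReal.ofReal_le_ofReal ?_
    rw [abs_le]
    constructor <;> linarith [(hA c hc).1, (hA c hc).2, (hA c' hc').1, (hA c' hc').2]
  rw [ENNReal.div_le_iff_le_mul (Or.inr ENNReal.ofReal_ne_top)
    (Or.inl (ne_top_of_le_ne_top ENNReal.ofReal_ne_top hden))] at h1
  have h2 : (⨅ c ∈ A, ENNReal.ofReal |a b - a c|) < ENNReal.ofReal η := by
    calc (⨅ c ∈ A, ENNReal.ofReal |a b - a c|)
        ≤ ⨆ b ∈ B, ⨅ c ∈ A, ENNReal.ofReal |a b - a c| :=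
          le_iSup₂ (f := fun b (_ : b ∈ B) => ⨅ c ∈ A, ENNReal.ofReal |a b - a c|) b hb
      _ ≤ ENNReal.ofReal ε * ENNReal.ofReal D := h1.trans (by gcongr)
      _ = ENNReal.ofReal (ε * D) := (ENNReal.ofReal_mul hε).symm
      _ < ENNReal.ofReal η := (ENNReal.ofReal_lt_ofReal_iff hη0).2 hη
  simp only [iInf_lt_iff] at h2
  obtain ⟨c, hc, hlt⟩ := h2
  rw [ENNReal.ofReal_lt_ofReal_iff hη0, abs_lt] at hlt
  constructor <;> linarith [hlt.1, hlt.2, (hA c hc).1, (hA c hc).2]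

/-- The functional `x ↦ 2 * x(E[U])` on `ℝ^E`. -/
noncomputable def twiceInnerEdges (n : ℕ) (U : Finset (Fin n)) : (CompleteEdge n → ℝ) →ₗ[ℝ] ℝ :=
  ∑ a ∈ U, ∑ b ∈ U, if h : a = b then 0 else
    LinearMap.proj (⟨s(a, b), by simpa using h⟩ : CompleteEdge n)

/-- The characteristic vector of an edge set. -/
noncomputable def edgeVector (n : ℕ) (M : Set (Sym2 (Fin n))) : CompleteEdge n → ℝ :=
  fun e => Set.indicator M (fun _ => (1 : ℝ)) e.val

open Classical in
theorem twiceInnerEdges_edgeVector {n : ℕ} (U : Finset (Fin n)) {M : Set (Sym2 (Fin n))}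
    (hM : IsMatchingIn n M) :
    twiceInnerEdges n U (edgeVector n M) =
      ∑ a ∈ U, ((U.filter fun b => s(a, b) ∈ M).card : ℝ) := by
  simp only [twiceInnerEdges, LinearMap.sum_apply]
  refine Finset.sum_congr rfl fun a _ => ?_
  rw [Finset.card_filter]
  push_cast
  refine Finset.sum_congr rfl fun b _ => ?_
  by_cases h : a = b
  · subst h
    have : s(a, a) ∉ M := fun hm => hM.1 _ hm (by simp)
    simp [this]
  · simp [h, edgeVector, Set.indicator_apply]

theorem IsMatchingIn.eq_of_mem {n : ℕ} {M : Set (Sym2 (Fin n))} (hM : IsMatchingIn n M)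
    {a b c : Fin n} (hb : s(a, b) ∈ M) (hc : s(a, c) ∈ M) : b = c := by
  by_contra hne
  refine hM.2 _ hb _ hc (fun h => hne ?_) a ⟨by simp, by simp⟩
  exact Sym2.congr_right.1 h

open Classical in
theorem twiceInnerEdges_edgeVector_bounds {n : ℕ} (U : Finset (Fin n)) {M : Set (Sym2 (Fin n))}
    (hM : IsMatchingIn n M) :
    0 ≤ twiceInnerEdges n U (edgeVector n M) ∧
      twiceInnerEdges n U (edgeVector n M) ≤ U.card ∧
      (Odd U.card → twiceInnerEdges n U (edgeVector n M) ≤ U.card - 1) := by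
  rw [twiceInnerEdges_edgeVector U hM]
  set T := U.filter fun a => ∃ b ∈ U, s(a, b) ∈ M with hT
  have hle : ∀ a ∈ U, ((U.filter fun b => s(a, b) ∈ M).card : ℝ) ≤
      if ∃ b ∈ U, s(a, b) ∈ M then 1 else 0 := by
    intro a _
    split_ifs with h
    · have : (U.filter fun b => s(a, b) ∈ M).card ≤ 1 := by
        rw [Finset.card_le_one]
        intro b hb c hc
        exact hM.eq_of_mem (Finset.mem_filter.1 hb).2 (Finset.mem_filter.1 hc).2
      exact_mod_cast this
    · have : (U.filter fun b => s(a, b) ∈ M) = ∅ := by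
        rw [Finset.filter_eq_empty_iff]
        exact fun b hb hm => h ⟨b, hb, hm⟩
      simp [this]
  have hsum : ∑ a ∈ U, ((U.filter fun b => s(a, b) ∈ M).card : ℝ) ≤ T.card := by
    refine (Finset.sum_le_sum hle).trans (le_of_eq ?_)
    rw [hT, Finset.card_filter]
    push_cast
    rfl
  refine ⟨Finset.sum_nonneg fun _ _ => Nat.cast_nonneg _, hsum.trans ?_, fun hodd => hsum.trans ?_⟩
  · exact_mod_cast Finset.card_filter_le _ _
  · have hTU : T.card ≤ U.card := Finset.card_filter_le _ _
    have heven : Even T.card := by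
      have hex : ∀ a ∈ T, ∃ b ∈ U, s(a, b) ∈ M := fun a ha => (Finset.mem_filter.1 ha).2
      choose g hgU hgM using hex
      have hgT : ∀ a ha, g a ha ∈ T := fun a ha =>
        Finset.mem_filter.2 ⟨hgU a ha, a, (Finset.mem_filter.1 ha).1, by
          rw [Sym2.eq_swap]; exact hgM a ha⟩
      have := Finset.sum_involution (s := T) (f := fun _ => (1 : ZMod 2)) g
        (fun _ _ => by decide)
        (fun a ha _ h => hM.1 _ (hgM a ha) (by simp [h]))
        hgT
        (fun a ha => hM.eq_of_mem (hgM _ (hgT a ha)) (by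
          rw [Sym2.eq_swap]; exact hgM a ha))
      simp only [Finset.sum_const, nsmul_eq_mul, mul_one] at this
      exact (ZMod.natCast_eq_zero_iff_even).1 this
    have hne : T.card ≠ U.card := fun h => by
      rw [h] at heven
      exact (Nat.not_even_iff_odd.2 hodd) heven
    have : T.card + 1 ≤ U.card := by omega
    have : ((T.card + 1 : ℕ) : ℝ) ≤ U.card := by exact_mod_cast this
    push_cast at this
    linarith

theorem matchingPolytope_bounds {n : ℕ} (a : (CompleteEdge n → ℝ) →ₗ[ℝ] ℝ) {lo hi : ℝ}
    (h : ∀ M, IsMatchingIn n M → lo ≤ a (edgeVector n M) ∧ a (edgeVector n M) ≤ hi) :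
    ∀ c ∈ matchingPolytope n, lo ≤ a c ∧ a c ≤ hi := by
  intro c hc
  refine convexHull_min (t := {c | lo ≤ a c} ∩ {c | a c ≤ hi}) ?_
    ((convex_halfSpace_ge a.isLinear lo).inter (convex_halfSpace_le a.isLinear hi)) hc
  rintro _ ⟨M, hM, rfl⟩
  exact h M hM

theorem edgeVector_mem_matchingPolytope {n : ℕ} {M : Set (Sym2 (Fin n))}
    (hM : IsMatchingIn n M) : edgeVector n M ∈ matchingPolytope n :=
  subset_convexHull ℝ _ ⟨M, hM, rfl⟩

/-- An approximate MILEF of the matching polytope gives a nonnegative factorization of a slightly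
relaxed slack matrix of the odd set inequalities. -/
theorem exists_nonneg_factorization_of_isMILEF {n m k N : ℕ} (hn : 2 ≤ n) [NeZero N]
    (h : IsMILEF (matchingPolytope n) (1 / 1000 / (n : ℝ)) m k)
    (hk : (k : ℝ) ≤ 1 / 1000 / (n : ℝ) * N) :
    ∃ nh ≤ m, ∃ u : {U : Finset (Fin n) // Odd U.card} →
        (Fin k → ZMod N) × Option (Fin nh) → ℝ, (∀ U r, 0 ≤ u U r) ∧
      ∀ M, IsMatchingIn n M →
        ∃ v : (Fin k → ZMod N) × Option (Fin nh) → ℝ, (∀ r, 0 ≤ v r) ∧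
          ∀ U : {U : Finset (Fin n) // Odd U.card},
            (U.1.card - 1 + 8 / 1000) - twiceInnerEdges n U.1 (edgeVector n M)
              = ∑ r, u U r * v r := by
  obtain ⟨l, Q, σ, π, ⟨S, nh, hnh, f, b, rfl⟩, hsub, hdist⟩ := h
  have hn' : (2 : ℝ) ≤ n := by exact_mod_cast hn
  set δ : ℝ := 1 / 1000 / (n : ℝ) with hδdef
  have hδ : 0 < δ := by positivity
  have hδn : δ * n = 1 / 1000 := by rw [hδdef]; field_simp
  have hδ1 : δ ≤ 1 / 2 := by nlinarith
  obtain ⟨u, hu, hv⟩ := exists_nonneg_factorization (N := N) S f b σ π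
    (fun U : {U : Finset (Fin n) // Odd U.card} => twiceInnerEdges n U.1)
    (fun _ => 0 - 2 / 1000) (fun U => (U.1.card - 1) + 2 / 1000)
    (fun U => U.1.card - 1 + 8 / 1000) δ hδ (by linarith) hk
    (by
      intro U x hxS hxf hxl
      have hcard : ((U.1.card : ℕ) : ℝ) ≤ n := by
        have := Finset.card_le_univ U.1
        rw [Fintype.card_fin] at this
        exact_mod_cast this
      refine bounds_of_relDist_le (D := n) hdist hδ.le (twiceInnerEdges n U.1)
        (matchingPolytope_bounds _ fun M hM => ?_) (by linarith) (by linarith) (by norm_num)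
        (subset_convexHull ℝ _ ⟨x, ⟨⟨hxS, hxf⟩, hxl⟩, rfl⟩)
      have := twiceInnerEdges_edgeVector_bounds U.1 hM
      exact ⟨this.1, this.2.2 U.2⟩)
    (by
      intro U
      have hcard : ((U.1.card : ℕ) : ℝ) ≤ n := by
        have := Finset.card_le_univ U.1
        rw [Fintype.card_fin] at this
        exact_mod_cast this
      nlinarith [mul_le_mul_of_nonneg_left hcard hδ.le])
  exact ⟨nh, hnh, u, hu, fun M hM => hv _ (hsub (edgeVector_mem_matchingPolytope hM))⟩

/-- A polyhedron with at most one facet is not an approximate extended formulation of the matching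
polytope. -/
theorem not_isMILEF_matchingPolytope_one_zero {n m : ℕ} (hn : 2 ≤ n) (hm : m ≤ 1) :
    ¬ IsMILEF (matchingPolytope n) (1 / 1000 / (n : ℝ)) m 0 := by
  rintro ⟨l, Q, σ, π, ⟨S, nh, hnh, f, b, rfl⟩, hsub, hdist⟩
  set Q : Set (Fin l → ℝ) := (S : Set (Fin l → ℝ)) ∩ {x | ∀ i, f i x ≤ b i} with hQ
  have hQl : Q ∩ {x | IsLatticePoint (σ x)} = Q := by
    refine Set.inter_eq_left.2 fun x _ i => i.elim0
  rw [hQl] at hsub hdist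
  have hn' : (2 : ℝ) ≤ n := by exact_mod_cast hn
  let v₀ : Fin n := ⟨0, by omega⟩
  let v₁ : Fin n := ⟨1, by omega⟩
  have hv : v₀ ≠ v₁ := by simp [v₀, v₁]
  have hM₀ : IsMatchingIn n ∅ := ⟨by simp, by simp⟩
  have hM₁ : IsMatchingIn n {s(v₀, v₁)} := by
    refine ⟨by simpa using hv, ?_⟩
    intro e he f hf hne
    exact absurd (he.trans hf.symm) hne
  have hne : edgeVector n ∅ ≠ edgeVector n {s(v₀, v₁)} := by
    intro h
    have := congrFun h ⟨s(v₀, v₁), by simpa using hv⟩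
    simp [edgeVector] at this
  have hnsub : ∃ x ∈ Q, ∃ y ∈ Q, π x ≠ π y := by
    by_contra hcon
    push Not at hcon
    have hss : (π '' Q).Subsingleton := by
      rintro _ ⟨x, hx, rfl⟩ _ ⟨y, hy, rfl⟩
      exact hcon x hx y hy
    have hconv : convexHull ℝ (π '' Q) = π '' Q := hss.convex.convexHull_eq
    rw [hconv] at hsub
    exact hne (hss (hsub (edgeVector_mem_matchingPolytope hM₀))
      (hsub (edgeVector_mem_matchingPolytope hM₁)))
  obtain ⟨x, hx, d, hd, hfd, hπd⟩ : ∃ x ∈ Q, ∃ d ∈ S.direction, (∀ i, f i d ≤ 0) ∧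
      π.linear d ≠ 0 := by
    obtain ⟨x, hx, y, hy, hxy⟩ := hnsub
    have hlin : π.linear (x - y) = π x - π y := by simpa using π.linearMap_vsub x y
    have hlin' : π.linear (y - x) = π y - π x := by simpa using π.linearMap_vsub y x
    by_cases hc : ∀ i, f i (x - y) ≤ 0
    · exact ⟨x, hx, x - y, AffineSubspace.vsub_mem_direction hx.1 hy.1, hc, by
        rw [hlin]; exact sub_ne_zero.2 hxy⟩
    · push Not at hc
      obtain ⟨i, hi⟩ := hc
      refine ⟨x, hx, y - x, AffineSubspace.vsub_mem_direction hy.1 hx.1, fun j => ?_, by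
        rw [hlin']; exact sub_ne_zero.2 hxy.symm⟩
      have : j = i := by
        apply Fin.ext
        omega
      subst this
      rw [map_sub] at hi ⊢
      linarith
  obtain ⟨⟨e, he⟩, hed⟩ : ∃ e, π.linear d e ≠ 0 := by
    by_contra hcon
    push Not at hcon
    exact hπd (funext hcon)
  have hray : ∀ t : ℝ, 0 ≤ t → x + t • d ∈ Q := fun t ht => by
    refine ⟨?_, fun i => ?_⟩
    · have := AffineSubspace.vadd_mem_of_mem_direction (S.direction.smul_mem t hd) hx.1
      rwa [vadd_eq_add, add_comm] at this
    · rw [map_add, map_smul, smul_eq_mul]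
      have := hx.2 i
      linarith [mul_nonpos_of_nonneg_of_nonpos ht (hfd i)]
  have hbd : ∀ t : ℝ, 0 ≤ t → 0 - 1 ≤ π (x + t • d) ⟨e, he⟩ ∧ π (x + t • d) ⟨e, he⟩ ≤ 1 + 1 := by
    intro t ht
    refine bounds_of_relDist_le (D := 1) hdist (by positivity)
      (LinearMap.proj (⟨e, he⟩ : CompleteEdge n)) (matchingPolytope_bounds _ fun M _ => ?_)
      (by norm_num) ?_ (by norm_num) (subset_convexHull ℝ _ ⟨_, hray t ht, rfl⟩)
    · by_cases heM : e ∈ M <;> simp [edgeVector, heM]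
    · rw [div_div, mul_one, div_lt_one (by positivity)]
      linarith
  have hval : ∀ t : ℝ, π (x + t • d) ⟨e, he⟩ = π x ⟨e, he⟩ + t * π.linear d ⟨e, he⟩ := fun t => by
    have := π.map_vadd x (t • d)
    rw [vadd_eq_add, vadd_eq_add, add_comm, map_smul] at this
    rw [this, Pi.add_apply, Pi.smul_apply, smul_eq_mul, add_comm]
  set q := π.linear d ⟨e, he⟩ with hq
  have h0 := hbd 0 le_rfl
  have h1 := hbd (4 / |q|) (by positivity)
  rw [hval] at h0 h1
  rcases lt_or_gt_of_ne hed with hneg | hpos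
  · rw [abs_of_neg hneg, div_neg, neg_mul, div_mul_cancel₀ _ hed] at h1
    linarith [h0.2, h1.1]
  · rw [abs_of_pos hpos, div_mul_cancel₀ _ hed] at h1
    linarith [h0.1, h1.2]

/-- The sum of `f` over all words whose `i`-th letter is `o`. -/
noncomputable def condSum {J O : Type*} [Fintype J] [DecidableEq J] [Fintype O] [DecidableEq O]
    (f : (J → O) → ℝ) (i : J) (o : O) : ℝ :=
  ∑ w, if w i = o then f w else 0

/-- Fixing the `i`-th letter hardly changes the average of `f`. -/
def IsBalancedAt {J O : Type*} [Fintype J] [DecidableEq J] [Fintype O] [DecidableEq O]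
    (ε : ℝ) (f : (J → O) → ℝ) (i : J) : Prop :=
  ∀ o, |Fintype.card O * condSum f i o - ∑ w, f w| ≤ ε * ∑ w, f w

section

variable {J O : Type*} [Fintype J] [DecidableEq J] [Fintype O]

theorem condSum_nonneg [DecidableEq O] {f : (J → O) → ℝ} (h0 : ∀ w, 0 ≤ f w) (i : J) (o : O) :
    0 ≤ condSum f i o :=
  Finset.sum_nonneg fun w _ => by split_ifs <;> simp [h0]

theorem condSum_le_sum [DecidableEq O] {f : (J → O) → ℝ} (h0 : ∀ w, 0 ≤ f w) (i : J) (o : O) :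
    condSum f i o ≤ ∑ w, f w :=
  Finset.sum_le_sum fun w _ => by split_ifs <;> simp [h0]

/-- A dense function has large correlation with a sum of independent centred variables on few
coordinates only. -/
theorem exp_mul_sum_le_of_correlation (f : (J → O) → ℝ) (h0 : ∀ w, 0 ≤ f w) (h1 : ∀ w, f w ≤ 1)
    (g : O → ℝ) (q : ℝ) (hq : 1 ≤ q) (hg : ∀ o, |g o| ≤ q) (hgs : ∑ o, g o = 0)
    (ε : ℝ) (hε : 0 < ε) (hε1 : ε ≤ 1) (B : Finset J)
    (hB : ∀ i ∈ B, ε * ∑ w, f w ≤ ∑ w, f w * g (w i)) :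
    Real.exp (ε ^ 2 / (4 * q ^ 2) * B.card) * ∑ w, f w
      ≤ (Fintype.card O : ℝ) ^ Fintype.card J := by
  set t : ℝ := ε / (2 * q ^ 2) with ht
  have ht0 : 0 < t := by positivity
  have htq : t * q ≤ 1 := by
    rw [ht, div_mul_eq_mul_div, div_le_one (by positivity)]
    nlinarith
  set F := ∑ w, f w with hF
  set G : (J → O) → ℝ := fun w => ∑ i ∈ B, g (w i) with hG
  have hFG : ε * B.card * F ≤ ∑ w, f w * G w := by
    have : ∑ w, f w * G w = ∑ i ∈ B, ∑ w, f w * g (w i) := by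
      rw [Finset.sum_comm]
      exact Finset.sum_congr rfl fun w _ => by rw [hG, Finset.mul_sum]
    rw [this]
    calc ε * B.card * F = ∑ _i ∈ B, ε * F := by simp; ring
      _ ≤ _ := Finset.sum_le_sum hB
  have hlow : Real.exp (t * ε * B.card) * F ≤ ∑ w, Real.exp (t * G w) := by
    set c := t * ε * B.card with hc
    have hpt : ∀ w, Real.exp c * (f w * (1 - c) + t * (f w * G w)) ≤ Real.exp (t * G w) := by
      intro w
      have h2 : Real.exp c * (t * G w - c + 1) ≤ Real.exp (t * G w) := by
        have : Real.exp (t * G w) = Real.exp c * Real.exp (t * G w - c) := by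
          rw [← Real.exp_add]; congr 1; ring
        rw [this]
        exact mul_le_mul_of_nonneg_left (Real.add_one_le_exp _) (Real.exp_nonneg _)
      have h3 : Real.exp c * (f w * (1 - c) + t * (f w * G w))
          = f w * (Real.exp c * (t * G w - c + 1)) := by ring
      rw [h3]
      calc f w * (Real.exp c * (t * G w - c + 1)) ≤ f w * Real.exp (t * G w) :=
            mul_le_mul_of_nonneg_left h2 (h0 w)
        _ ≤ 1 * Real.exp (t * G w) := mul_le_mul_of_nonneg_right (h1 w) (Real.exp_nonneg _)
        _ = _ := one_mul _
    refine le_trans ?_ (Finset.sum_le_sum fun w _ => hpt w)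
    rw [← Finset.mul_sum, Finset.sum_add_distrib, ← Finset.sum_mul, ← Finset.mul_sum, ← hF]
    refine mul_le_mul_of_nonneg_left ?_ (Real.exp_nonneg _)
    nlinarith [mul_le_mul_of_nonneg_left hFG ht0.le]
  have hup : ∑ w, Real.exp (t * G w)
      ≤ (Fintype.card O : ℝ) ^ Fintype.card J * Real.exp (t ^ 2 * q ^ 2 * B.card) := by
    have hprod : ∑ w, Real.exp (t * G w)
        = ∏ i : J, ∑ o : O, Real.exp (if i ∈ B then t * g o else 0) := by
      rw [Finset.prod_univ_sum, Fintype.piFinset_univ]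
      refine Finset.sum_congr rfl fun w _ => ?_
      rw [← Real.exp_sum]
      congr 1
      rw [hG, Finset.mul_sum]
      simp [Finset.sum_ite_mem]
    rw [hprod]
    have hfac : ∀ i : J, ∑ o : O, Real.exp (if i ∈ B then t * g o else 0)
        ≤ Fintype.card O * Real.exp (if i ∈ B then t ^ 2 * q ^ 2 else 0) := by
      intro i
      split_ifs with hi
      · have hpt : ∀ o, Real.exp (t * g o) ≤ 1 + t * g o + t ^ 2 * q ^ 2 := by
          intro o
          have habs : |t * g o| ≤ t * q := by
            rw [abs_mul, abs_of_pos ht0]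
            exact mul_le_mul_of_nonneg_left (hg o) ht0.le
          have h2 := (abs_le.1 (Real.abs_exp_sub_one_sub_id_le (habs.trans htq))).2
          have h3 : (t * g o) ^ 2 ≤ (t * q) ^ 2 := sq_le_sq' (abs_le.1 habs).1 (abs_le.1 habs).2
          nlinarith
        calc ∑ o, Real.exp (t * g o) ≤ ∑ o, (1 + t * g o + t ^ 2 * q ^ 2) :=
              Finset.sum_le_sum fun o _ => hpt o
          _ = Fintype.card O * (1 + t ^ 2 * q ^ 2) := by
              rw [Finset.sum_add_distrib, Finset.sum_add_distrib, ← Finset.mul_sum, hgs]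
              simp; ring
          _ ≤ Fintype.card O * Real.exp (t ^ 2 * q ^ 2) := by
              refine mul_le_mul_of_nonneg_left ?_ (Nat.cast_nonneg _)
              linarith [Real.add_one_le_exp (t ^ 2 * q ^ 2)]
      · simp
    refine (Finset.prod_le_prod (fun i _ => Finset.sum_nonneg fun o _ => Real.exp_nonneg _)
      fun i _ => hfac i).trans (le_of_eq ?_)
    rw [Finset.prod_mul_distrib, ← Real.exp_sum]
    simp [Finset.sum_ite_mem]
    left
    ring
  have hcomb := hlow.trans hup
  have h4 : Real.exp (t * ε * B.card) = Real.exp (ε ^ 2 / (4 * q ^ 2) * B.card) *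
      Real.exp (t ^ 2 * q ^ 2 * B.card) := by
    rw [← Real.exp_add]
    congr 1
    rw [ht]
    field_simp
    ring
  rw [h4, mul_assoc, mul_comm (Real.exp (t ^ 2 * q ^ 2 * B.card)) F, ← mul_assoc] at hcomb
  exact le_of_mul_le_mul_right hcomb (Real.exp_pos _)

open Classical in
/-- A dense function is unbalanced at few coordinates only. -/
theorem card_unbalanced_le [DecidableEq O] (f : (J → O) → ℝ) (h0 : ∀ w, 0 ≤ f w) (h1 : ∀ w, f w ≤ 1)
    (hO : 1 ≤ Fintype.card O) (ε δ : ℝ) (hε : 0 < ε) (hε1 : ε ≤ 1)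
    (hF : Real.exp (-(δ * Fintype.card J)) * (Fintype.card O : ℝ) ^ Fintype.card J < ∑ w, f w) :
    ((Finset.univ.filter fun i : J => ¬ IsBalancedAt ε f i).card : ℝ)
      ≤ 2 * Fintype.card O * (4 * (Fintype.card O : ℝ) ^ 2 / ε ^ 2 * (δ * Fintype.card J)) := by
  set q : ℝ := (Fintype.card O : ℝ) with hq
  have hq1 : 1 ≤ q := by rw [hq]; exact_mod_cast hO
  have hqpos : 0 < q ^ Fintype.card J := by positivity
  set F := ∑ w, f w with hFdef
  have hFpos : 0 < F := lt_trans (by positivity) hF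
  set K : ℝ := 4 * q ^ 2 / ε ^ 2 * (δ * Fintype.card J) with hK
  have hbound : ∀ (g : O → ℝ), (∀ o, |g o| ≤ q) → ∑ o, g o = 0 →
      ((Finset.univ.filter fun i : J => ε * F ≤ ∑ w, f w * g (w i)).card : ℝ) ≤ K := by
    intro g hg hgs
    set B := Finset.univ.filter fun i : J => ε * F ≤ ∑ w, f w * g (w i) with hB
    have h2 := exp_mul_sum_le_of_correlation f h0 h1 g q hq1 hg hgs ε hε hε1 B
      (fun i hi => (Finset.mem_filter.1 hi).2)
    have h3 : Real.exp (ε ^ 2 / (4 * q ^ 2) * B.card) *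
        Real.exp (-(δ * Fintype.card J)) ≤ 1 := by
      have : Real.exp (ε ^ 2 / (4 * q ^ 2) * B.card) *
        (Real.exp (-(δ * Fintype.card J)) * q ^ Fintype.card J) ≤ 1 * q ^ Fintype.card J := by
        rw [one_mul]
        exact (mul_le_mul_of_nonneg_left hF.le (Real.exp_nonneg _)).trans h2
      rw [← mul_assoc] at this
      exact le_of_mul_le_mul_right this hqpos
    rw [← Real.exp_add, Real.exp_le_one_iff] at h3
    rw [hK, div_mul_eq_mul_div, le_div_iff₀ (by positivity)]
    have h4 : ε ^ 2 / (4 * q ^ 2) * B.card ≤ δ * Fintype.card J := by linarith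
    rw [div_mul_eq_mul_div, div_le_iff₀ (by positivity)] at h4
    linarith
  let g : O → O → ℝ := fun o o' => q * (if o' = o then 1 else 0) - 1
  have hg : ∀ o o', |g o o'| ≤ q := by
    intro o o'
    simp only [g]
    split_ifs
    · rw [abs_le]; constructor <;> linarith
    · simpa using hq1
  have hgs : ∀ o, ∑ o', g o o' = 0 := by
    intro o
    simp [g, Finset.sum_sub_distrib, hq]
  have hcor : ∀ o i, ∑ w, f w * g o (w i) = q * condSum f i o - F := by
    intro o i
    simp only [g, mul_sub, mul_one, Finset.sum_sub_distrib, condSum, Finset.mul_sum, ← hFdef]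
    congr 1
    refine Finset.sum_congr rfl fun w _ => ?_
    split_ifs <;> ring
  have hsub : (Finset.univ.filter fun i : J => ¬ IsBalancedAt ε f i) ⊆
      Finset.univ.biUnion fun o : O =>
        (Finset.univ.filter fun i : J => ε * F ≤ ∑ w, f w * g o (w i)) ∪
        (Finset.univ.filter fun i : J => ε * F ≤ ∑ w, f w * (-g o) (w i)) := by
    intro i hi
    simp only [Finset.mem_filter, Finset.mem_univ, true_and, IsBalancedAt, not_forall,
      not_le] at hi
    obtain ⟨o, ho⟩ := hi
    simp only [Finset.mem_biUnion, Finset.mem_univ, true_and, Finset.mem_union,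
      Finset.mem_filter, Pi.neg_apply, mul_neg, Finset.sum_neg_distrib, hcor]
    refine ⟨o, ?_⟩
    rcases lt_abs.1 ho with h | h
    · exact Or.inl h.le
    · exact Or.inr h.le
  have hcard : ((Finset.univ.filter fun i : J => ¬ IsBalancedAt ε f i).card : ℝ) ≤
      ∑ _o : O, (K + K) := by
    calc ((Finset.univ.filter fun i : J => ¬ IsBalancedAt ε f i).card : ℝ)
        ≤ ((∑ o : O, ((Finset.univ.filter fun i : J => ε * F ≤ ∑ w, f w * g o (w i)) ∪
          (Finset.univ.filter fun i : J => ε * F ≤ ∑ w, f w * (-g o) (w i))).card : ℕ) : ℝ) := by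
          exact_mod_cast (Finset.card_le_card hsub).trans Finset.card_biUnion_le
      _ ≤ _ := by
          push_cast
          refine Finset.sum_le_sum fun o _ => ?_
          refine le_trans (Nat.cast_le.2 (Finset.card_union_le _ _)) ?_
          push_cast
          refine add_le_add (hbound (g o) (hg o) (hgs o)) (hbound (-g o) (fun o' => ?_) ?_)
          · simpa using hg o o'
          · simp [hgs o]
  refine hcard.trans (le_of_eq ?_)
  simp only [Finset.sum_const, Finset.card_univ, nsmul_eq_mul, ← hq]
  ring

end

open Classical in
/-- Unbalanced coordinates contribute little to the conditional sums. -/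
theorem exists_sum_unbalanced_condSum_le (O : Type) [Fintype O] [DecidableEq O] [Nonempty O]
    (ε ε' : ℝ) (hε : 0 < ε) (hε1 : ε < 1) (hε' : 0 < ε') (hε'1 : ε' ≤ 1) :
    ∃ δ : ℝ, 0 < δ ∧ ∀ (J : Type) [Fintype J] [DecidableEq J] (f : (J → O) → ℝ),
      (∀ w, 0 ≤ f w) → (∀ w, f w ≤ 1) → ∀ o : O,
      (∑ i, if IsBalancedAt ε f i then 0 else condSum f i o) ≤ ε' * ∑ i, condSum f i o +
        Fintype.card J * (Real.exp (-(δ * Fintype.card J)) *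
          (Fintype.card O : ℝ) ^ Fintype.card J) := by
  set q : ℝ := (Fintype.card O : ℝ) with hq
  have hO : 1 ≤ Fintype.card O := Fintype.card_pos
  have hq1 : 1 ≤ q := by rw [hq]; exact_mod_cast hO
  set η : ℝ := ε' * (1 - ε) / (2 * q) with hη
  have hη0 : 0 < η := by
    have : 0 < 1 - ε := by linarith
    positivity
  have hη1 : η ≤ 1 / 2 := by
    rw [hη, div_le_iff₀ (by positivity)]
    nlinarith
  refine ⟨η * ε ^ 2 / (8 * q ^ 3), by positivity, ?_⟩
  intro J _ _ f h0 h1 o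
  set δ := η * ε ^ 2 / (8 * q ^ 3) with hδ
  set F := ∑ w, f w with hF
  have hF0 : 0 ≤ F := Finset.sum_nonneg fun w _ => h0 w
  have hc0 : ∀ i, 0 ≤ condSum f i o := fun i => condSum_nonneg h0 i o
  have hcF : ∀ i, condSum f i o ≤ F := fun i => condSum_le_sum h0 i o
  set bad := Finset.univ.filter fun i : J => ¬ IsBalancedAt ε f i with hbad
  have hlhs : (∑ i, if IsBalancedAt ε f i then 0 else condSum f i o) =
      ∑ i ∈ bad, condSum f i o := by
    rw [hbad, Finset.sum_filter]
    exact Finset.sum_congr rfl fun i _ => by split_ifs <;> simp_all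
  have hlhs' : (∑ i, if IsBalancedAt ε f i then 0 else condSum f i o) ≤ bad.card * F := by
    rw [hlhs]
    calc ∑ i ∈ bad, condSum f i o ≤ ∑ _i ∈ bad, F := Finset.sum_le_sum fun i _ => hcF i
      _ = _ := by simp
  have hsum0 : 0 ≤ ∑ i, condSum f i o := Finset.sum_nonneg fun i _ => hc0 i
  by_cases hdense : Real.exp (-(δ * Fintype.card J)) * q ^ Fintype.card J < F
  · have hcard := card_unbalanced_le f h0 h1 hO ε δ hε hε1.le hdense
    rw [← hbad, ← hq] at hcard
    have hcard' : (bad.card : ℝ) ≤ η * Fintype.card J := by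
      refine hcard.trans (le_of_eq ?_)
      rw [hδ]
      field_simp
      ring
    have hgood : ∑ i ∈ Finset.univ.filter (fun i : J => IsBalancedAt ε f i), (1 - ε) * F / q
        ≤ ∑ i, condSum f i o := by
      rw [Finset.sum_filter]
      refine Finset.sum_le_sum fun i _ => ?_
      split_ifs with hi
      · have := (abs_le.1 (hi o)).1
        rw [div_le_iff₀ (by positivity)]
        linarith
      · exact hc0 i
    have hgc : ((Finset.univ.filter (fun i : J => IsBalancedAt ε f i)).card : ℝ)
        = Fintype.card J - bad.card := by
      have := Finset.card_filter_add_card_filter_not (s := (Finset.univ : Finset J))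
        (fun i : J => IsBalancedAt ε f i)
      rw [Finset.card_univ] at this
      rw [← this]
      push_cast
      ring
    rw [Finset.sum_const, nsmul_eq_mul, hgc] at hgood
    have h2 : (1 / 2 : ℝ) * Fintype.card J ≤ Fintype.card J - bad.card := by
      nlinarith [(Nat.cast_nonneg (Fintype.card J) : (0 : ℝ) ≤ _)]
    have h3 : 0 ≤ (1 - ε) * F / q := by
      have : 0 < 1 - ε := by linarith
      positivity
    have h4 : (1 / 2 : ℝ) * Fintype.card J * ((1 - ε) * F / q) ≤ ∑ i, condSum f i o :=
      (mul_le_mul_of_nonneg_right h2 h3).trans hgood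
    have h5 : η * Fintype.card J * F = ε' * ((1 / 2 : ℝ) * Fintype.card J * ((1 - ε) * F / q)) := by
      rw [hη]; field_simp
    calc _ ≤ bad.card * F := hlhs'
      _ ≤ η * Fintype.card J * F := mul_le_mul_of_nonneg_right hcard' hF0
      _ ≤ ε' * ∑ i, condSum f i o := by
          rw [h5]; exact mul_le_mul_of_nonneg_left h4 hε'.le
      _ ≤ _ := le_add_of_nonneg_right (by positivity)
  · push Not at hdense
    have hbc : (bad.card : ℝ) ≤ Fintype.card J := by exact_mod_cast Finset.card_le_univ bad
    calc _ ≤ bad.card * F := hlhs'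
      _ ≤ Fintype.card J * (Real.exp (-(δ * Fintype.card J)) * q ^ Fintype.card J) :=
          mul_le_mul hbc hdense hF0 (Nat.cast_nonneg _)
      _ ≤ _ := le_add_of_nonneg_left (by positivity)

theorem sum_comp_swap {J O : Type*} [Fintype J] [DecidableEq J] [Fintype O]
    (F : (J → O) → ℝ) (i j : J) : ∑ w, F (w ∘ Equiv.swap i j) = ∑ w, F w :=
  Fintype.sum_equiv ((Equiv.swap i j).arrowCongr (Equiv.refl O)) _ _ fun w => by
    congr 1

theorem condSum_comp_swap {J O : Type*} [Fintype J] [DecidableEq J] [Fintype O] [DecidableEq O]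
    (f : (J → O) → ℝ) (i j : J) (o : O) :
    condSum (fun w => f (w ∘ Equiv.swap i j)) i o = condSum f j o := by
  rw [condSum, condSum, ← sum_comp_swap _ i j]
  refine Finset.sum_congr rfl fun w _ => ?_
  simp [Function.comp_def]

theorem isBalancedAt_comp_swap {J O : Type*} [Fintype J] [DecidableEq J] [Fintype O]
    [DecidableEq O] (ε : ℝ) (f : (J → O) → ℝ) (i j : J) :
    IsBalancedAt ε (fun w => f (w ∘ Equiv.swap i j)) i ↔ IsBalancedAt ε f j := by
  simp only [IsBalancedAt, condSum_comp_swap, sum_comp_swap]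

theorem condSum_le_card_pow {J O : Type*} [Fintype J] [DecidableEq J] [Fintype O] [DecidableEq O]
    {f : (J → O) → ℝ} (h0 : ∀ w, 0 ≤ f w) (h1 : ∀ w, f w ≤ 1) (i : J) (o : O) :
    condSum f i o ≤ (Fintype.card O : ℝ) ^ Fintype.card J :=
  calc condSum f i o ≤ ∑ w, f w := condSum_le_sum h0 i o
    _ ≤ ∑ _w : J → O, (1 : ℝ) := Finset.sum_le_sum fun w _ => h1 w
    _ = _ := by simp

theorem condSum_congr {J O : Type*} [Fintype J] [DecidableEq J] [Fintype O] [DecidableEq O]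
    {f g : (J → O) → ℝ} {i : J} {o : O} (h : ∀ w, w i = o → f w = g w) :
    condSum f i o = condSum g i o :=
  Finset.sum_congr rfl fun w _ => by split_ifs with hw <;> simp [h, hw]

/-- At a balanced coordinate all conditional sums are comparable. -/
theorem IsBalancedAt.condSum_le {J O : Type*} [Fintype J] [DecidableEq J] [Fintype O]
    [DecidableEq O] [Nonempty O] {f : (J → O) → ℝ} {i : J}
    (h : IsBalancedAt (1 / 7) f i) (o o' : O) : condSum f i o ≤ 4 / 3 * condSum f i o' := by
  have hO : (0 : ℝ) < Fintype.card O := by exact_mod_cast Fintype.card_pos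
  have h1 := (abs_le.1 (h o)).2
  have h2 := (abs_le.1 (h o')).1
  refine le_of_mul_le_mul_left ?_ hO
  linarith

open Classical in
/-- Averaging over block exchanges: unbalanced positions contribute little. -/
theorem sum_unbalanced_mul_le {E J O : Type} [Group E] [Fintype E] [Fintype J] [DecidableEq J]
    [Fintype O] [DecidableEq O] (j₀ : J) (o : O) (ε ε' C D : ℝ) (f : E → (J → O) → ℝ)
    (R : E → ℝ) (hR0 : ∀ e, 0 ≤ R e) (hRC : ∀ e, R e ≤ C) (hD : 0 ≤ D) (s : J → E)
    (hfs : ∀ e i w, f (e * s i) w = f e (w ∘ Equiv.swap j₀ i))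
    (hRs : ∀ e i, R (e * s i) = R e)
    (hub : ∀ e, (∑ i, if IsBalancedAt ε (f e) i then 0 else condSum (f e) i o) ≤
      ε' * ∑ i, condSum (f e) i o + Fintype.card J * D) :
    (∑ e, if IsBalancedAt ε (f e) j₀ then 0 else condSum (f e) j₀ o * R e) ≤
      ε' * ∑ e, condSum (f e) j₀ o * R e + Fintype.card E * (D * C) := by
  have hJ : (0 : ℝ) < Fintype.card J := by
    exact_mod_cast Fintype.card_pos_iff.2 ⟨j₀⟩
  have hfs' : ∀ e i, f (e * s i) = fun w => f e (w ∘ Equiv.swap j₀ i) :=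
    fun e i => funext (hfs e i)
  have key : ∀ F : E → ℝ, Fintype.card J * ∑ e, F e = ∑ e, ∑ i, F (e * s i) := by
    intro F
    rw [Finset.sum_comm]
    have : ∀ i, ∑ e, F (e * s i) = ∑ e, F e := fun i =>
      Fintype.sum_equiv (Equiv.mulRight (s i)) _ _ fun e => rfl
    simp [this]
  refine le_of_mul_le_mul_left ?_ hJ
  rw [mul_add, mul_left_comm (Fintype.card J : ℝ) ε', key, key]
  simp only [hfs', condSum_comp_swap, isBalancedAt_comp_swap, hRs]
  have hstep : ∀ e, (∑ i, if IsBalancedAt ε (f e) i then 0 else condSum (f e) i o * R e) ≤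
      ε' * ∑ i, condSum (f e) i o * R e + Fintype.card J * (D * C) := by
    intro e
    calc (∑ i, if IsBalancedAt ε (f e) i then 0 else condSum (f e) i o * R e)
        = (∑ i, if IsBalancedAt ε (f e) i then 0 else condSum (f e) i o) * R e := by
          rw [Finset.sum_mul]
          exact Finset.sum_congr rfl fun i _ => by split_ifs <;> simp
      _ ≤ (ε' * ∑ i, condSum (f e) i o + Fintype.card J * D) * R e :=
          mul_le_mul_of_nonneg_right (hub e) (hR0 e)
      _ = ε' * ∑ i, condSum (f e) i o * R e + Fintype.card J * (D * R e) := by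
          rw [← Finset.sum_mul]; ring
      _ ≤ _ := by
          have := mul_le_mul_of_nonneg_left (mul_le_mul_of_nonneg_left (hRC e) hD) hJ.le
          linarith
  refine (Finset.sum_le_sum fun e _ => hstep e).trans (le_of_eq ?_)
  rw [Finset.sum_add_distrib, ← Finset.mul_sum]
  simp
  ring

/-- The combinatorial core of the lower bound: an inequality satisfied by all pairs of bounded
functions on a finite group which are symmetric in the prescribed way. -/
theorem exists_sum_mul_condSum_le (G : Type) [Fintype G] [DecidableEq G] [Nonempty G] :
    ∃ δ : ℝ, 0 < δ ∧ ∀ (E J : Type) [Group E] [Fintype E] [Fintype J] [DecidableEq J] (j₀ : J)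
      (c₀ v₀ : G) (f : E → (J → G) → ℝ) (h : E → (J → Bool) → ℝ) (φ : Fin 7 → E)
      (sA sB : J → E) (p : Fin 7 → Fin 7 → G),
      (∀ e w, 0 ≤ f e w) → (∀ e w, f e w ≤ 1) → (∀ e I, 0 ≤ h e I) → (∀ e I, h e I ≤ 1) →
      (∀ e j w, w j₀ = c₀ → f (e * φ j) w = f e w) →
      (∀ e j I, I j₀ = true → h (e * φ j) I = h e I) →
      (∀ e i w, f (e * sB i) w = f e (w ∘ Equiv.swap j₀ i)) →
      (∀ e i I, I j₀ = false → h (e * sB i) I = h e I) →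
      (∀ e i I, h (e * sA i) I = h e (I ∘ Equiv.swap j₀ i)) →
      (∀ e i w, w j₀ = v₀ → f (e * sA i) w = f e w) →
      13 / 2 * ∑ e, condSum (f e) j₀ v₀ * condSum (h e) j₀ false
        - 16 / 9 * ∑ e, condSum (f e) j₀ c₀ * condSum (h e) j₀ true
        - 16 / 9 * ∑ e, ∑ j, ∑ l, (if j = l then 0 else
            condSum (f (e * φ l)) j₀ (p j l) * condSum (h (e * φ j)) j₀ false) ≤
      14 * (Fintype.card E * (Real.exp (-(δ * Fintype.card J)) *
        ((2 * Fintype.card G : ℝ) ^ Fintype.card J))) := by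
  classical
  obtain ⟨δ₁, hδ₁, H₁⟩ := exists_sum_unbalanced_condSum_le G (1 / 7) (1 / 28)
    (by norm_num) (by norm_num) (by norm_num) (by norm_num)
  obtain ⟨δ₂, hδ₂, H₂⟩ := exists_sum_unbalanced_condSum_le Bool (1 / 7) (1 / 28)
    (by norm_num) (by norm_num) (by norm_num) (by norm_num)
  refine ⟨min δ₁ δ₂, lt_min hδ₁ hδ₂, ?_⟩
  intro E J _ _ _ _ j₀ c₀ v₀ f h φ sA sB p hf0 hf1 hh0 hh1 hφf hφh hBf hBh hAh hAf
  set N := Fintype.card J with hN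
  set δ := min δ₁ δ₂ with hδ
  have hX0 : ∀ e o, 0 ≤ condSum (f e) j₀ o := fun e o => condSum_nonneg (hf0 e) _ _
  have hY0 : ∀ e b, 0 ≤ condSum (h e) j₀ b := fun e o => condSum_nonneg (hh0 e) _ _
  have hexp : ∀ δ', δ ≤ δ' → Real.exp (-(δ' * N)) ≤ Real.exp (-(δ * N)) := by
    intro δ' h'
    refine Real.exp_le_exp.2 (neg_le_neg ?_)
    exact mul_le_mul_of_nonneg_right h' (Nat.cast_nonneg _)
  set Z : ℝ := Fintype.card E * (Real.exp (-(δ * N)) * ((2 * Fintype.card G : ℝ) ^ N)) with hZ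
  have hbadf : (∑ e, if IsBalancedAt (1 / 7) (f e) j₀ then 0 else
      condSum (f e) j₀ v₀ * condSum (h e) j₀ false) ≤
      1 / 28 * ∑ e, condSum (f e) j₀ v₀ * condSum (h e) j₀ false + Z := by
    have h1 := sum_unbalanced_mul_le j₀ v₀ (1 / 7) (1 / 28) ((2 : ℝ) ^ N)
      (Real.exp (-(δ₁ * N)) * (Fintype.card G : ℝ) ^ N) f
      (fun e => condSum (h e) j₀ false) (fun e => hY0 e _)
      (fun e => by simpa using condSum_le_card_pow (hh0 e) (hh1 e) j₀ false)
      (by positivity) sB hBf (fun e i => condSum_congr (hBh e i))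
      (fun e => H₁ J (f e) (hf0 e) (hf1 e) v₀)
    refine h1.trans (add_le_add le_rfl ?_)
    rw [hZ, mul_pow, mul_comm ((2 : ℝ) ^ N), ← mul_assoc (Real.exp _)]
    refine mul_le_mul_of_nonneg_left (mul_le_mul_of_nonneg_right (mul_le_mul_of_nonneg_right
      (hexp _ (min_le_left _ _)) (by positivity)) (by positivity)) (Nat.cast_nonneg _)
  have hbadh : (∑ e, if IsBalancedAt (1 / 7) (h e) j₀ then 0 else
      condSum (f e) j₀ v₀ * condSum (h e) j₀ false) ≤
      1 / 28 * ∑ e, condSum (f e) j₀ v₀ * condSum (h e) j₀ false + Z := by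
    have h1 := sum_unbalanced_mul_le j₀ false (1 / 7) (1 / 28) ((Fintype.card G : ℝ) ^ N)
      (Real.exp (-(δ₂ * N)) * (Fintype.card Bool : ℝ) ^ N) h
      (fun e => condSum (f e) j₀ v₀) (fun e => hX0 e _)
      (fun e => condSum_le_card_pow (hf0 e) (hf1 e) j₀ v₀)
      (by positivity) sA hAh (fun e i => condSum_congr (hAf e i))
      (fun e => H₂ J (h e) (hh0 e) (hh1 e) false)
    simp only [mul_comm (condSum (h _) j₀ false)] at h1
    refine h1.trans (add_le_add le_rfl ?_)
    rw [hZ, mul_pow, ← mul_assoc (Real.exp _), Fintype.card_bool]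
    push_cast
    refine mul_le_mul_of_nonneg_left (mul_le_mul_of_nonneg_right (mul_le_mul_of_nonneg_right
      (hexp _ (min_le_right _ _)) (by positivity)) (by positivity)) (Nat.cast_nonneg _)
  set good : E → Prop := fun e => IsBalancedAt (1 / 7) (f e) j₀ ∧ IsBalancedAt (1 / 7) (h e) j₀
    with hgood
  have hpt : ∀ e, (∑ j, if good (e * φ j) then
      condSum (f (e * φ j)) j₀ v₀ * condSum (h (e * φ j)) j₀ false else 0) ≤
      16 / 9 * (condSum (f e) j₀ c₀ * condSum (h e) j₀ true) +
      16 / 9 * ∑ j, ∑ l, (if j = l then 0 else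
        condSum (f (e * φ l)) j₀ (p j l) * condSum (h (e * φ j)) j₀ false) := by
    intro e
    have hXc : ∀ j, condSum (f (e * φ j)) j₀ c₀ = condSum (f e) j₀ c₀ :=
      fun j => condSum_congr (hφf e j)
    have hYc : ∀ j, condSum (h (e * φ j)) j₀ true = condSum (h e) j₀ true :=
      fun j => condSum_congr (hφh e j)
    have hterm0 : ∀ j l, 0 ≤ (if j = l then 0 else
        condSum (f (e * φ l)) j₀ (p j l) * condSum (h (e * φ j)) j₀ false) := by
      intro j l
      split_ifs
      · exact le_rfl
      · exact mul_nonneg (hX0 _ _) (hY0 _ _)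
    by_cases hsub : ∀ j l, good (e * φ j) → good (e * φ l) → j = l
    · refine le_add_of_le_of_nonneg ?_ (mul_nonneg (by norm_num)
        (Finset.sum_nonneg fun j _ => Finset.sum_nonneg fun l _ => hterm0 j l))
      by_cases hex : ∃ j, good (e * φ j)
      · obtain ⟨j, hj⟩ := hex
        rw [Finset.sum_eq_single j (fun l _ hl => if_neg fun hg => hl (hsub l j hg hj))
          (fun hj' => absurd (Finset.mem_univ j) hj'), if_pos hj]
        have h1 := hj.1.condSum_le v₀ c₀
        have h2 := hj.2.condSum_le false true
        rw [hXc] at h1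
        rw [hYc] at h2
        calc _ ≤ 4 / 3 * condSum (f e) j₀ c₀ * (4 / 3 * condSum (h e) j₀ true) :=
              mul_le_mul h1 h2 (hY0 _ _) (mul_nonneg (by norm_num) (hX0 _ _))
          _ = _ := by ring
      · push Not at hex
        simp only [hex, if_false, Finset.sum_const_zero]
        exact mul_nonneg (by norm_num) (mul_nonneg (hX0 _ _) (hY0 _ _))
    · push Not at hsub
      obtain ⟨j₁, j₂, hg₁, hg₂, hne⟩ := hsub
      refine le_add_of_nonneg_of_le (mul_nonneg (by norm_num)
        (mul_nonneg (hX0 _ _) (hY0 _ _))) ?_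
      rw [Finset.mul_sum]
      refine Finset.sum_le_sum fun j _ => ?_
      split_ifs with hj
      · obtain ⟨l, hl, hjl⟩ : ∃ l, good (e * φ l) ∧ j ≠ l := by
          by_cases h1 : j = j₁
          · exact ⟨j₂, hg₂, h1 ▸ hne⟩
          · exact ⟨j₁, hg₁, h1⟩
        have h1 := hj.1.condSum_le v₀ c₀
        have h2 := hl.1.condSum_le c₀ (p j l)
        rw [hXc] at h1 h2
        calc _ ≤ (16 / 9 * condSum (f (e * φ l)) j₀ (p j l)) * condSum (h (e * φ j)) j₀ false :=
              mul_le_mul_of_nonneg_right (by linarith) (hY0 _ _)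
          _ = 16 / 9 * (if j = l then 0 else
                condSum (f (e * φ l)) j₀ (p j l) * condSum (h (e * φ j)) j₀ false) := by
              rw [if_neg hjl]; ring
          _ ≤ _ := mul_le_mul_of_nonneg_left
              (Finset.single_le_sum (fun l _ => hterm0 j l) (Finset.mem_univ l)) (by norm_num)
      · exact mul_nonneg (by norm_num) (Finset.sum_nonneg fun l _ => hterm0 j l)
  have hsum := Finset.sum_le_sum fun e (_ : e ∈ Finset.univ) => hpt e
  rw [Finset.sum_add_distrib, ← Finset.mul_sum, ← Finset.mul_sum, Finset.sum_comm] at hsum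
  have hre : ∀ (F : E → ℝ) j, ∑ e, F (e * φ j) = ∑ e, F e := fun F j =>
    Fintype.sum_equiv (Equiv.mulRight (φ j)) _ _ fun e => rfl
  have hL : ∀ j, (∑ e, if good (e * φ j) then
      condSum (f (e * φ j)) j₀ v₀ * condSum (h (e * φ j)) j₀ false else 0) =
      ∑ e, if good e then condSum (f e) j₀ v₀ * condSum (h e) j₀ false else 0 := fun j =>
    hre (fun e => if good e then condSum (f e) j₀ v₀ * condSum (h e) j₀ false else 0) j
  simp only [hL, Finset.sum_const, Finset.card_univ, Fintype.card_fin, nsmul_eq_mul] at hsum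
  have hsplit : ∑ e, condSum (f e) j₀ v₀ * condSum (h e) j₀ false ≤
      (∑ e, if good e then condSum (f e) j₀ v₀ * condSum (h e) j₀ false else 0) +
      ((∑ e, if IsBalancedAt (1 / 7) (f e) j₀ then 0 else
        condSum (f e) j₀ v₀ * condSum (h e) j₀ false) +
      (∑ e, if IsBalancedAt (1 / 7) (h e) j₀ then 0 else
        condSum (f e) j₀ v₀ * condSum (h e) j₀ false)) := by
    rw [← Finset.sum_add_distrib, ← Finset.sum_add_distrib]
    refine Finset.sum_le_sum fun e _ => ?_
    have := mul_nonneg (hX0 e v₀) (hY0 e false)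
    by_cases h1 : IsBalancedAt (1 / 7) (f e) j₀ <;> by_cases h2 : IsBalancedAt (1 / 7) (h e) j₀ <;>
      simp only [hgood, h1, h2, and_self, and_true, and_false, if_true,
        if_false] <;> linarith
  push_cast at hsum
  linarith

/-- The points of the Fano plane: a line at infinity and the affine plane over the field with
two elements. -/
abbrev FanoPoint := Fin 3 ⊕ (Bool × Bool)

/-- The translation with direction `v`. -/
def addBits (v g : Bool × Bool) : Bool × Bool := (xor g.1 v.1, xor g.2 v.2)

/-- A cyclic collineation of the Fano plane. -/
def singerCycle : Equiv.Perm FanoPoint where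
  toFun
    | .inl 0 => .inl 1
    | .inl 1 => .inr (false, false)
    | .inl 2 => .inr (false, true)
    | .inr (false, false) => .inl 2
    | .inr (false, true) => .inr (true, true)
    | .inr (true, true) => .inr (true, false)
    | .inr (true, false) => .inl 0
  invFun
    | .inl 1 => .inl 0
    | .inr (false, false) => .inl 1
    | .inr (false, true) => .inl 2
    | .inl 2 => .inr (false, false)
    | .inr (true, true) => .inr (false, true)
    | .inr (true, false) => .inr (true, true)
    | .inl 0 => .inr (true, false)
  left_inv := by decide
  right_inv := by decide

/-- The vertices of the central gadget: two copies of the Fano plane. -/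
abbrev CoreVertex := FanoPoint × Bool

/-- The matching on the central gadget with choice `w`. -/
def coreMatching (w : Bool × Bool) : CoreVertex → CoreVertex
  | (.inl a, s) => (.inl a, !s)
  | (.inr g, s) => if w = (false, false) then (.inr g, !s) else (.inr (addBits w g), s)

/-- The vertex set on the central gadget with choice `I`. -/
def coreSet (I : Bool) : CoreVertex → Bool
  | (.inl _, s) => !s
  | (.inr _, s) => I && !s

/-- The collineation moving the line at infinity to the `j`-th line, on both copies. -/
def coreMove (j : Fin 7) : Equiv.Perm CoreVertex :=
  Equiv.prodCongr (singerCycle ^ (j : ℕ)) (Equiv.refl Bool)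

/-- The number of elements of the set `U` mapped outside `U` by `τ`. -/
def cutSize {X : Type*} [Fintype X] (U : X → Bool) (τ : X → X) : ℕ :=
  (Finset.univ.filter fun x => U x = true ∧ U (τ x) = false).card

theorem coreMatching_involutive (w : Bool × Bool) : Function.Involutive (coreMatching w) := by
  revert w; unfold Function.Involutive; decide

theorem coreMatching_ne (w : Bool × Bool) (x : CoreVertex) : coreMatching w x ≠ x := by
  revert w x; decide

theorem coreMove_coreMatching (j : Fin 7) (x : CoreVertex) :
    coreMove j (coreMatching (false, false) x) = coreMatching (false, false) (coreMove j x) := by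
  revert j x; decide +kernel

theorem coreSet_true_coreMove (j : Fin 7) (x : CoreVertex) :
    coreSet true (coreMove j x) = coreSet true x := by
  revert j x; decide +kernel

theorem exists_cutSize_core_eq_one (j l : Fin 7) (h : j ≠ l) : ∃ p : Bool × Bool,
    cutSize (coreSet false ∘ (coreMove j).symm)
      (coreMove l ∘ coreMatching p ∘ (coreMove l).symm) = 1 := by
  revert j l; decide +kernel

theorem cutSize_core_zero : cutSize (coreSet true) (coreMatching (false, false)) = 7 := by
  decide +kernel

theorem cutSize_core_internal :
    cutSize (coreSet false) (coreMatching (true, false)) = 3 := by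
  decide +kernel

/-- The vertices of the outer blocks: for each index one inner block and a pair of partner
blocks. -/
abbrev BlockVertex (m : ℕ) := Fin m × Fin 3 × (Bool × Bool)

/-- The matching on the outer blocks with choices `w`. -/
def blockMatching {m : ℕ} (w : Fin m → Bool × Bool) : BlockVertex m → BlockVertex m
  | (i, 0, g) => (i, 0, addBits (true, false) g)
  | (i, 1, g) => if w i = (false, false) then (i, 2, g) else (i, 1, addBits (w i) g)
  | (i, 2, g) => if w i = (false, false) then (i, 1, g) else (i, 2, addBits (w i) g)

/-- The vertex set on the outer blocks with choices `I`. -/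
def blockSet {m : ℕ} (I : Fin m → Bool) : BlockVertex m → Bool
  | (i, 0, _) => I i
  | (_, 1, _) => false
  | (_, 2, _) => false

/-- The vertices of the gadget. -/
abbrev GadgetVertex (m : ℕ) := CoreVertex ⊕ BlockVertex m

/-- The perfect matching of the gadget with choices `w`. -/
def gadgetMatching {m : ℕ} (w : Option (Fin m) → Bool × Bool) : GadgetVertex m → GadgetVertex m :=
  Sum.map (coreMatching (w none)) (blockMatching (w ∘ some))

/-- The odd set of the gadget with choices `I`. -/
def gadgetSet {m : ℕ} (I : Option (Fin m) → Bool) : GadgetVertex m → Bool :=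
  Sum.elim (coreSet (I none)) (blockSet (I ∘ some))

/-- Exchanging the central copy of the affine plane with an inner block. -/
def innerExchangeFun {m : ℕ} (i : Fin m) : GadgetVertex m → GadgetVertex m
  | .inl (.inl a, s) => .inl (.inl a, s)
  | .inl (.inr g, false) => .inr (i, 0, g)
  | .inl (.inr g, true) => .inl (.inr g, true)
  | .inr (j, 0, g) => if j = i then .inl (.inr g, false) else .inr (j, 0, g)
  | .inr (j, 1, g) => .inr (j, 1, g)
  | .inr (j, 2, g) => .inr (j, 2, g)

/-- Exchanging both central copies of the affine plane with a pair of partner blocks. -/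
def outerExchangeFun {m : ℕ} (i : Fin m) : GadgetVertex m → GadgetVertex m
  | .inl (.inl a, s) => .inl (.inl a, s)
  | .inl (.inr g, false) => .inr (i, 1, g)
  | .inl (.inr g, true) => .inr (i, 2, g)
  | .inr (j, 0, g) => .inr (j, 0, g)
  | .inr (j, 1, g) => if j = i then .inl (.inr g, false) else .inr (j, 1, g)
  | .inr (j, 2, g) => if j = i then .inl (.inr g, true) else .inr (j, 2, g)

theorem innerExchangeFun_involutive {m : ℕ} (i : Fin m) :
    Function.Involutive (innerExchangeFun i) := by
  rintro (⟨a | g, s⟩ | ⟨j, t, g⟩)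
  · rfl
  · cases s <;> simp [innerExchangeFun]
  · fin_cases t
    · by_cases h : j = i <;> simp [innerExchangeFun, h]
    · rfl
    · rfl

theorem outerExchangeFun_involutive {m : ℕ} (i : Fin m) :
    Function.Involutive (outerExchangeFun i) := by
  rintro (⟨a | g, s⟩ | ⟨j, t, g⟩)
  · rfl
  · cases s <;> simp [outerExchangeFun]
  · fin_cases t
    · rfl
    · by_cases h : j = i <;> simp [outerExchangeFun, h]
    · by_cases h : j = i <;> simp [outerExchangeFun, h]

/-- The exchange of inner blocks as a permutation. -/
def innerExchange {m : ℕ} : Option (Fin m) → Equiv.Perm (GadgetVertex m)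
  | none => 1
  | some i => (innerExchangeFun_involutive i).toPerm

/-- The exchange of partner blocks as a permutation. -/
def outerExchange {m : ℕ} : Option (Fin m) → Equiv.Perm (GadgetVertex m)
  | none => 1
  | some i => (outerExchangeFun_involutive i).toPerm

/-- A collineation of the core, extended by the identity. -/
def gadgetMove {m : ℕ} (j : Fin 7) : Equiv.Perm (GadgetVertex m) :=
  Equiv.sumCongr (coreMove j) (Equiv.refl _)

theorem addBits_addBits (v g : Bool × Bool) : addBits v (addBits v g) = g := by
  revert v g; decide

theorem addBits_ne {v : Bool × Bool} (hv : v ≠ (false, false)) (g : Bool × Bool) :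
    addBits v g ≠ g := by
  revert v g; decide

theorem blockMatching_involutive {m : ℕ} (w : Fin m → Bool × Bool) :
    Function.Involutive (blockMatching w) := by
  rintro ⟨j, t, g⟩
  fin_cases t
  · simp [blockMatching, addBits_addBits]
  · by_cases h : w j = (false, false) <;> simp [blockMatching, h, addBits_addBits]
  · by_cases h : w j = (false, false) <;> simp [blockMatching, h, addBits_addBits]

theorem blockMatching_ne {m : ℕ} (w : Fin m → Bool × Bool) (x : BlockVertex m) :
    blockMatching w x ≠ x := by
  obtain ⟨j, t, g⟩ := x
  have h0 : addBits (true, false) g ≠ g := addBits_ne (by decide) g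
  fin_cases t
  · simp [blockMatching, h0]
  · by_cases h : w j = (false, false)
    · simp [blockMatching, h]
    · simp [blockMatching, h, addBits_ne h g]
  · by_cases h : w j = (false, false)
    · simp [blockMatching, h]
    · simp [blockMatching, h, addBits_ne h g]

theorem blockSet_blockMatching {m : ℕ} (I : Fin m → Bool) (w : Fin m → Bool × Bool)
    (x : BlockVertex m) : blockSet I (blockMatching w x) = blockSet I x := by
  obtain ⟨j, t, g⟩ := x
  fin_cases t
  · rfl
  · by_cases h : w j = (false, false) <;> simp [blockMatching, blockSet, h]
  · by_cases h : w j = (false, false) <;> simp [blockMatching, blockSet, h]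

theorem gadgetMatching_involutive {m : ℕ} (w : Option (Fin m) → Bool × Bool) :
    Function.Involutive (gadgetMatching w) := by
  rintro (x | x)
  · simp [gadgetMatching, coreMatching_involutive (w none) x]
  · simp [gadgetMatching, blockMatching_involutive (w ∘ some) x]

theorem gadgetMatching_ne {m : ℕ} (w : Option (Fin m) → Bool × Bool) (x : GadgetVertex m) :
    gadgetMatching w x ≠ x := by
  obtain x | x := x
  · simp [gadgetMatching, coreMatching_ne (w none) x]
  · simp [gadgetMatching, blockMatching_ne (w ∘ some) x]

theorem gadgetMove_gadgetMatching {m : ℕ} (j : Fin 7) {w : Option (Fin m) → Bool × Bool}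
    (hw : w none = (false, false)) (x : GadgetVertex m) :
    gadgetMove j (gadgetMatching w x) = gadgetMatching w (gadgetMove j x) := by
  obtain x | x := x
  · simp [gadgetMatching, gadgetMove, hw, coreMove_coreMatching]
  · simp [gadgetMatching, gadgetMove]

theorem gadgetSet_gadgetMove {m : ℕ} (j : Fin 7) {I : Option (Fin m) → Bool}
    (hI : I none = true) (x : GadgetVertex m) :
    gadgetSet I (gadgetMove j x) = gadgetSet I x := by
  obtain x | x := x
  · simp [gadgetSet, gadgetMove, hI, coreSet_true_coreMove]
  · simp [gadgetSet, gadgetMove]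

theorem outerExchange_gadgetMatching {m : ℕ} (i : Option (Fin m))
    (w : Option (Fin m) → Bool × Bool) (x : GadgetVertex m) :
    outerExchange i (gadgetMatching w x) =
      gadgetMatching (w ∘ Equiv.swap none i) (outerExchange i x) := by
  obtain _ | i := i
  · simp [outerExchange]
  have hne : ∀ j, j ≠ i → Equiv.swap none (some i) (some j) = some j := fun j hj =>
    Equiv.swap_apply_of_ne_of_ne (by simp) (by simpa using hj)
  obtain ⟨a | g, s⟩ | ⟨j, t, g⟩ := x
  · simp [outerExchange, gadgetMatching, outerExchangeFun, coreMatching]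
  · by_cases h : w none = (false, false) <;> cases s <;>
      simp [outerExchange, gadgetMatching, outerExchangeFun, coreMatching, blockMatching, h]
  · by_cases hj : j = i
    · subst hj
      by_cases h : w (some j) = (false, false) <;> fin_cases t <;>
        simp [outerExchange, gadgetMatching, outerExchangeFun, coreMatching, blockMatching, h]
    · by_cases h : w (some j) = (false, false) <;> fin_cases t <;>
        simp [outerExchange, gadgetMatching, outerExchangeFun, blockMatching, h, hj, hne j hj]

theorem gadgetSet_outerExchange {m : ℕ} (i : Option (Fin m)) {I : Option (Fin m) → Bool}
    (hI : I none = false) (x : GadgetVertex m) :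
    gadgetSet I (outerExchange i x) = gadgetSet I x := by
  obtain _ | i := i
  · simp [outerExchange]
  obtain ⟨a | g, s⟩ | ⟨j, t, g⟩ := x
  · simp [outerExchange, gadgetSet, outerExchangeFun]
  · cases s <;> simp [outerExchange, gadgetSet, outerExchangeFun, coreSet, blockSet, hI]
  · by_cases hj : j = i <;> fin_cases t <;>
      simp [outerExchange, gadgetSet, outerExchangeFun, coreSet, blockSet, hI, hj]

theorem innerExchange_gadgetMatching {m : ℕ} (i : Option (Fin m))
    {w : Option (Fin m) → Bool × Bool} (hw : w none = (true, false)) (x : GadgetVertex m) :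
    innerExchange i (gadgetMatching w x) = gadgetMatching w (innerExchange i x) := by
  obtain _ | i := i
  · simp [innerExchange]
  obtain ⟨a | g, s⟩ | ⟨j, t, g⟩ := x
  · simp [innerExchange, gadgetMatching, innerExchangeFun, coreMatching]
  · cases s <;>
      simp [innerExchange, gadgetMatching, innerExchangeFun, coreMatching, blockMatching, hw]
  · by_cases hj : j = i <;> by_cases h : w (some j) = (false, false) <;> fin_cases t <;>
      simp_all [innerExchange, gadgetMatching, innerExchangeFun, coreMatching, blockMatching]

theorem gadgetSet_innerExchange {m : ℕ} (i : Option (Fin m)) (I : Option (Fin m) → Bool)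
    (x : GadgetVertex m) :
    gadgetSet (I ∘ Equiv.swap none i) (innerExchange i x) = gadgetSet I x := by
  obtain _ | i := i
  · simp [innerExchange]
  have hne : ∀ j, j ≠ i → Equiv.swap none (some i) (some j) = some j := fun j hj =>
    Equiv.swap_apply_of_ne_of_ne (by simp) (by simpa using hj)
  obtain ⟨a | g, s⟩ | ⟨j, t, g⟩ := x
  · simp [innerExchange, gadgetSet, innerExchangeFun, coreSet]
  · cases s <;> simp [innerExchange, gadgetSet, innerExchangeFun, coreSet, blockSet]
  · by_cases hj : j = i
    · subst hj
      fin_cases t <;> simp [innerExchange, gadgetSet, innerExchangeFun, coreSet, blockSet]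
    · fin_cases t <;>
        simp [innerExchange, gadgetSet, innerExchangeFun, blockSet, hj, hne j hj]

theorem cutSize_conj {X : Type*} [Fintype X] (U : X → Bool) (τ : X → X) (e : Equiv.Perm X) :
    cutSize (U ∘ e.symm) (e ∘ τ ∘ e.symm) = cutSize U τ := by
  refine Finset.card_equiv e.symm fun x => ?_
  simp

theorem cutSize_sumMap {X Y : Type*} [Fintype X] [Fintype Y] (U : X → Bool) (V : Y → Bool)
    (τ : X → X) (σ : Y → Y) (h : ∀ y, V (σ y) = V y) :
    cutSize (Sum.elim U V) (Sum.map τ σ) = cutSize U τ := by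
  rw [cutSize, cutSize, ← Finset.card_map (Function.Embedding.inl : X ↪ X ⊕ Y)]
  congr 1
  ext (x | y) <;> simp [h]

theorem cutSize_gadget {m : ℕ} (j l : Fin 7) (w : Option (Fin m) → Bool × Bool)
    (I : Option (Fin m) → Bool) :
    cutSize (gadgetSet I ∘ (gadgetMove j).symm)
      (gadgetMove l ∘ gadgetMatching w ∘ (gadgetMove l).symm) =
    cutSize (coreSet (I none) ∘ (coreMove j).symm)
      (coreMove l ∘ coreMatching (w none) ∘ (coreMove l).symm) := by
  rw [← cutSize_sumMap (coreSet (I none) ∘ (coreMove j).symm) (blockSet (I ∘ some))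
    (coreMove l ∘ coreMatching (w none) ∘ (coreMove l).symm) (blockMatching (w ∘ some))
    (blockSet_blockMatching _ _)]
  congr 1 <;> ext (x | x) <;> rfl

theorem cutSize_gadgetSet {m : ℕ} (w : Option (Fin m) → Bool × Bool)
    (I : Option (Fin m) → Bool) :
    cutSize (gadgetSet I) (gadgetMatching w) = cutSize (coreSet (I none)) (coreMatching (w none)) :=
  cutSize_sumMap _ _ _ _ (blockSet_blockMatching _ _)

theorem odd_card_gadgetSet {m : ℕ} (I : Option (Fin m) → Bool) :
    Odd (Finset.univ.filter fun x => gadgetSet I x = true).card := by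
  have hcore : Odd (Finset.univ.filter fun x => coreSet (I none) x = true).card := by
    cases I none <;> decide
  have hblock : Even (Finset.univ.filter fun x => blockSet (I ∘ some) x = true).card := by
    have : (Finset.univ.filter fun x => blockSet (I ∘ some) x = true) =
        (Finset.univ.filter fun i => I (some i) = true) ×ˢ
          (({0} : Finset (Fin 3)) ×ˢ (Finset.univ : Finset (Bool × Bool))) := by
      ext ⟨i, t, g⟩
      rw [Finset.mem_filter]
      fin_cases t <;> simp [blockSet]
    rw [this, Finset.card_product]
    exact Even.mul_left (by decide) _
  have hdisj : (Finset.univ.filter fun x => gadgetSet I x = true) =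
      (Finset.univ.filter fun x => coreSet (I none) x = true).disjSum
        (Finset.univ.filter fun x => blockSet (I ∘ some) x = true) := by
    ext (x | x) <;> rw [Finset.mem_filter] <;> simp [gadgetSet]
  rw [hdisj, Finset.card_disjSum]
  exact hcore.add_even hblock

theorem card_gadgetVertex (m : ℕ) : Fintype.card (GadgetVertex m) = 14 + 12 * m := by
  simp
  ring

theorem condSum_const_mul {J O : Type*} [Fintype J] [DecidableEq J] [Fintype O] [DecidableEq O]
    (c : ℝ) (f : (J → O) → ℝ) (i : J) (o : O) :
    condSum (fun w => c * f w) i o = c * condSum f i o := by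
  simp only [condSum, Finset.mul_sum, mul_ite, mul_zero]

/-- The version of `exists_sum_mul_condSum_le` for functions with bounded product. -/
theorem exists_sum_mul_condSum_le_mul (G : Type) [Fintype G] [DecidableEq G] [Nonempty G] :
    ∃ δ : ℝ, 0 < δ ∧ ∀ (E J : Type) [Group E] [Fintype E] [Fintype J] [DecidableEq J] (j₀ : J)
      (c₀ v₀ : G) (f : E → (J → G) → ℝ) (h : E → (J → Bool) → ℝ) (φ : Fin 7 → E)
      (sA sB : J → E) (p : Fin 7 → Fin 7 → G) (B : ℝ),
      (∀ e w, 0 ≤ f e w) → (∀ e I, 0 ≤ h e I) → (∀ e w e' I, f e w * h e' I ≤ B) →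
      (∀ e j w, w j₀ = c₀ → f (e * φ j) w = f e w) →
      (∀ e j I, I j₀ = true → h (e * φ j) I = h e I) →
      (∀ e i w, f (e * sB i) w = f e (w ∘ Equiv.swap j₀ i)) →
      (∀ e i I, I j₀ = false → h (e * sB i) I = h e I) →
      (∀ e i I, h (e * sA i) I = h e (I ∘ Equiv.swap j₀ i)) →
      (∀ e i w, w j₀ = v₀ → f (e * sA i) w = f e w) →
      13 / 2 * ∑ e, condSum (f e) j₀ v₀ * condSum (h e) j₀ false
        - 16 / 9 * ∑ e, condSum (f e) j₀ c₀ * condSum (h e) j₀ true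
        - 16 / 9 * ∑ e, ∑ j, ∑ l, (if j = l then 0 else
            condSum (f (e * φ l)) j₀ (p j l) * condSum (h (e * φ j)) j₀ false) ≤
      B * (14 * (Fintype.card E * (Real.exp (-(δ * Fintype.card J)) *
        ((2 * Fintype.card G : ℝ) ^ Fintype.card J)))) := by
  obtain ⟨δ, hδ, H⟩ := exists_sum_mul_condSum_le G
  refine ⟨δ, hδ, ?_⟩
  intro E J _ _ _ _ j₀ c₀ v₀ f h φ sA sB p B hf0 hh0 hB hφf hφh hBf hBh hAh hAf
  obtain ⟨⟨e₁, w₁⟩, hmax₁⟩ := Finite.exists_max fun x : E × (J → G) => f x.1 x.2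
  obtain ⟨⟨e₂, I₂⟩, hmax₂⟩ := Finite.exists_max fun x : E × (J → Bool) => h x.1 x.2
  set a := f e₁ w₁ with ha
  set b := h e₂ I₂ with hb
  have hfa : ∀ e w, f e w ≤ a := fun e w => hmax₁ (e, w)
  have hhb : ∀ e I, h e I ≤ b := fun e I => hmax₂ (e, I)
  have ha0 : 0 ≤ a := hf0 _ _
  have hb0 : 0 ≤ b := hh0 _ _
  have hfe : ∀ e, f e = fun w => a * (f e w / a) := by
    intro e
    funext w
    rcases ha0.eq_or_lt with h0 | h0
    · have := hfa e w
      rw [← h0] at this ⊢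
      simpa using le_antisymm this (hf0 e w)
    · field_simp
  have hhe : ∀ e, h e = fun I => b * (h e I / b) := by
    intro e
    funext I
    rcases hb0.eq_or_lt with h0 | h0
    · have := hhb e I
      rw [← h0] at this ⊢
      simpa using le_antisymm this (hh0 e I)
    · field_simp
  have hmain := H E J j₀ c₀ v₀ (fun e w => f e w / a) (fun e I => h e I / b) φ sA sB p
    (fun e w => div_nonneg (hf0 e w) ha0) (fun e w => div_le_one_of_le₀ (hfa e w) ha0)
    (fun e I => div_nonneg (hh0 e I) hb0) (fun e I => div_le_one_of_le₀ (hhb e I) hb0)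
    (fun e j w hw => by rw [hφf e j w hw]) (fun e j I hI => by rw [hφh e j I hI])
    (fun e i w => by rw [hBf e i w]) (fun e i I hI => by rw [hBh e i I hI])
    (fun e i I => by rw [hAh e i I]) (fun e i w hw => by rw [hAf e i w hw])
  have hX : ∀ e o, condSum (f e) j₀ o = a * condSum (fun w => f e w / a) j₀ o := by
    intro e o
    rw [← condSum_const_mul, ← hfe e]
  have hY : ∀ e o, condSum (h e) j₀ o = b * condSum (fun I => h e I / b) j₀ o := by
    intro e o
    rw [← condSum_const_mul, ← hhe e]
  have hXY : ∀ e e' o o', condSum (f e) j₀ o * condSum (h e') j₀ o' = a * b *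
      (condSum (fun w => f e w / a) j₀ o * condSum (fun I => h e' I / b) j₀ o') := by
    intro e e' o o'
    rw [hX, hY]; ring
  have hite : ∀ (P : Prop) [Decidable P] (c x : ℝ),
      (if P then 0 else c * x) = c * (if P then 0 else x) := by
    intro P _ c x; split_ifs <;> simp
  simp only [hXY, hite, ← Finset.mul_sum]
  have hab : a * b ≤ B := hB _ _ _ _
  refine le_trans ?_ (mul_le_mul_of_nonneg_right hab (by positivity))
  refine le_trans (le_of_eq ?_) (mul_le_mul_of_nonneg_left hmain (mul_nonneg ha0 hb0))
  rw [mul_sub, mul_sub, mul_left_comm (a * b) (13 / 2), mul_left_comm (a * b) (16 / 9),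
    mul_left_comm (a * b) (16 / 9)]
  simp only [hite]

theorem sum_ite_none_eq {J O : Type*} [Fintype J] [DecidableEq J] [Fintype O] [DecidableEq O]
    (o : O) : (∑ w : Option J → O, if w none = o then (1 : ℝ) else 0) =
      (Fintype.card O : ℝ) ^ Fintype.card J := by
  have : (Finset.univ.filter fun w : Option J → O => w none = o) =
      Fintype.piFinset fun i => Option.elim i {o} fun _ => Finset.univ := by
    ext w
    simp [Option.forall]
  rw [Finset.sum_boole, this, Fintype.card_piFinset, Fintype.prod_option]
  simp

theorem sum_condSum_mul_condSum {J G R : Type*} [Fintype J] [DecidableEq J] [Fintype G]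
    [DecidableEq G] [Fintype R] (f : R → (Option J → G) → ℝ) (h : R → (Option J → Bool) → ℝ)
    (o : G) (b : Bool) (c : ℝ)
    (H : ∀ w I, w none = o → I none = b → ∑ r, f r w * h r I = c) :
    ∑ r, condSum (f r) none o * condSum (h r) none b =
      c * ((Fintype.card G : ℝ) ^ Fintype.card J * 2 ^ Fintype.card J) := by
  have h2 : (2 : ℝ) ^ Fintype.card J = ∑ I : Option J → Bool, if I none = b then 1 else 0 := by
    rw [sum_ite_none_eq]; simp
  rw [h2, ← sum_ite_none_eq (J := J) o, Finset.sum_mul_sum, Finset.mul_sum]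
  calc ∑ r, condSum (f r) none o * condSum (h r) none b
      = ∑ r, ∑ w : Option J → G, ∑ I : Option J → Bool, (if w none = o then f r w else 0) *
          (if I none = b then h r I else 0) :=
        Finset.sum_congr rfl fun r _ => Finset.sum_mul_sum _ _ _ _
    _ = ∑ w : Option J → G, ∑ I : Option J → Bool, ∑ r, (if w none = o then f r w else 0) *
          (if I none = b then h r I else 0) := by
        rw [Finset.sum_comm]
        exact Finset.sum_congr rfl fun w _ => Finset.sum_comm
    _ = _ := by
        refine Finset.sum_congr rfl fun w _ => ?_
        rw [Finset.mul_sum]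
        refine Finset.sum_congr rfl fun I _ => ?_
        by_cases hw : w none = o <;> by_cases hI : I none = b <;> simp [hw, hI]
        exact H w I hw hI

theorem odd_card_comp_perm {X : Type*} [Fintype X] (U : X → Bool) (e : Equiv.Perm X)
    (h : Odd (Finset.univ.filter fun x => U x = true).card) :
    Odd (Finset.univ.filter fun x => (U ∘ e.symm) x = true).card := by
  have : (Finset.univ.filter fun x => (U ∘ e.symm) x = true).card =
      (Finset.univ.filter fun x => U x = true).card :=
    Finset.card_equiv e.symm fun x => by simp
  rwa [this]

/-- The slack matrix of the odd set inequalities, slightly shifted, has exponential nonnegative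
rank. -/
theorem exists_nonneg_factorization_bound : ∃ δ : ℝ, 0 < δ ∧ ∀ (m : ℕ) (R : Type) [Fintype R]
    (u : R → (GadgetVertex m → Bool) → ℝ) (v : R → (GadgetVertex m → GadgetVertex m) → ℝ),
    (∀ r U, 0 ≤ u r U) → (∀ r τ, 0 ≤ v r τ) →
    (∀ U τ, Odd (Finset.univ.filter fun x => U x = true).card → Function.Involutive τ →
      (∀ x, τ x ≠ x) → ∑ r, v r τ * u r U = cutSize U τ - 1 + 8 / 1000) →
    1 ≤ 112 * (Fintype.card R * Fintype.card (GadgetVertex m)) *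
      Real.exp (-(δ * (m + 1))) := by
  classical
  obtain ⟨δ, hδ, H⟩ := exists_sum_mul_condSum_le_mul (Bool × Bool)
  refine ⟨δ, hδ, ?_⟩
  intro m R _ u v hu hv hS
  have : Fintype (Equiv.Perm (GadgetVertex m)) := Fintype.ofFinite _
  choose! p hp using exists_cutSize_core_eq_one
  let f : R → Equiv.Perm (GadgetVertex m) → (Option (Fin m) → Bool × Bool) → ℝ :=
    fun r e w => v r (e ∘ gadgetMatching w ∘ e.symm)
  let h : R → Equiv.Perm (GadgetVertex m) → (Option (Fin m) → Bool) → ℝ :=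
    fun r e I => u r (gadgetSet I ∘ e.symm)
  have hval : ∀ (e e' : Equiv.Perm (GadgetVertex m)) w I, ∑ r, f r e w * h r e' I =
      cutSize (gadgetSet I ∘ e'.symm) (e ∘ gadgetMatching w ∘ e.symm) - 1 + 8 / 1000 := by
    intro e e' w I
    refine hS _ _ (odd_card_comp_perm _ _ (odd_card_gadgetSet I)) ?_ ?_
    · intro x
      simp only [Function.comp_apply, Equiv.symm_apply_apply]
      rw [gadgetMatching_involutive w (e.symm x), Equiv.apply_symm_apply]
    · intro x hx
      exact gadgetMatching_ne w (e.symm x) ((Equiv.eq_symm_apply e).2 hx)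
  have hB : ∀ r e w e' I, f r e w * h r e' I ≤ Fintype.card (GadgetVertex m) := by
    intro r e w e' I
    have h1 : f r e w * h r e' I ≤ ∑ r, f r e w * h r e' I :=
      Finset.single_le_sum (f := fun r => f r e w * h r e' I)
        (fun r _ => mul_nonneg (hv _ _) (hu _ _)) (Finset.mem_univ r)
    rw [hval] at h1
    have h2 : (cutSize (gadgetSet I ∘ e'.symm) (e ∘ gadgetMatching w ∘ e.symm) : ℝ) ≤
        Fintype.card (GadgetVertex m) := by
      exact_mod_cast Finset.card_le_univ _
    linarith
  have hmain := fun r => H (Equiv.Perm (GadgetVertex m)) (Option (Fin m)) none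
    (false, false) (true, false) (f r) (h r)
    gadgetMove innerExchange outerExchange p (Fintype.card (GadgetVertex m))
    (fun _ _ => hv _ _) (fun _ _ => hu _ _) (hB r)
    (fun e j w hw => by
      refine congrArg (v r) (funext fun x => ?_)
      have h1 : ∀ y, gadgetMove j (gadgetMatching w ((gadgetMove j).symm y)) =
          gadgetMatching w y := fun y => by
        rw [gadgetMove_gadgetMatching j hw, Equiv.apply_symm_apply]
      exact congrArg e (h1 (e.symm x)))
    (fun e j I hI => by
      refine congrArg (u r) (funext fun x => ?_)
      have h1 : ∀ y, gadgetSet I ((gadgetMove j).symm y) = gadgetSet I y := fun y => by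
        rw [← gadgetSet_gadgetMove j hI, Equiv.apply_symm_apply]
      exact h1 (e.symm x))
    (fun e i w => by
      refine congrArg (v r) (funext fun x => ?_)
      have h1 : ∀ y, outerExchange i (gadgetMatching w ((outerExchange i).symm y)) =
          gadgetMatching (w ∘ Equiv.swap none i) y := fun y => by
        rw [outerExchange_gadgetMatching, Equiv.apply_symm_apply]
      exact congrArg e (h1 (e.symm x)))
    (fun e i I hI => by
      refine congrArg (u r) (funext fun x => ?_)
      have h1 : ∀ y, gadgetSet I ((outerExchange i).symm y) = gadgetSet I y := fun y => by
        rw [← gadgetSet_outerExchange i hI, Equiv.apply_symm_apply]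
      exact h1 (e.symm x))
    (fun e i I => by
      refine congrArg (u r) (funext fun x => ?_)
      have h1 : ∀ y, gadgetSet I ((innerExchange i).symm y) =
          gadgetSet (I ∘ Equiv.swap none i) y := fun y => by
        rw [← gadgetSet_innerExchange i, Equiv.apply_symm_apply]
      exact h1 (e.symm x))
    (fun e i w hw => by
      refine congrArg (v r) (funext fun x => ?_)
      have h1 : ∀ y, innerExchange i (gadgetMatching w ((innerExchange i).symm y)) =
          gadgetMatching w y := fun y => by
        rw [innerExchange_gadgetMatching i hw, Equiv.apply_symm_apply]
      exact congrArg e (h1 (e.symm x)))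
  set NE : ℝ := (Fintype.card (Equiv.Perm (GadgetVertex m)) : ℝ) with hNE
  have hsum := Finset.sum_le_sum fun r (_ : r ∈ Finset.univ) => hmain r
  set T : ℝ := (Fintype.card (Bool × Bool) : ℝ) ^ Fintype.card (Fin m) * 2 ^ Fintype.card (Fin m)
    with hT
  have hPR : ∀ e : Equiv.Perm (GadgetVertex m),
      ∑ r, condSum (f r e) none (true, false) * condSum (h r e) none false =
      (2 + 8 / 1000) * T := by
    intro e
    refine sum_condSum_mul_condSum (fun r => f r e) (fun r => h r e) _ _ _ fun w I hw hI => ?_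
    rw [hval, cutSize_conj, cutSize_gadgetSet, hw, hI, cutSize_core_internal]
    norm_num
  have hXS : ∀ e : Equiv.Perm (GadgetVertex m),
      ∑ r, condSum (f r e) none (false, false) * condSum (h r e) none true =
      (6 + 8 / 1000) * T := by
    intro e
    refine sum_condSum_mul_condSum (fun r => f r e) (fun r => h r e) _ _ _ fun w I hw hI => ?_
    rw [hval, cutSize_conj, cutSize_gadgetSet, hw, hI, cutSize_core_zero]
    norm_num
  have hXR : ∀ (e : Equiv.Perm (GadgetVertex m)) j l, (∑ r, if j = l then 0 else
      condSum (f r (e * gadgetMove l)) none (p j l) *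
      condSum (h r (e * gadgetMove j)) none false) ≤ 8 / 1000 * T := by
    intro e j l
    by_cases hjl : j = l
    · simp only [hjl, if_true, Finset.sum_const_zero]
      positivity
    · simp only [hjl, if_false]
      refine le_of_eq (sum_condSum_mul_condSum (fun r => f r (e * gadgetMove l))
        (fun r => h r (e * gadgetMove j)) _ _ _ fun w I hw hI => ?_)
      rw [hval]
      have := cutSize_conj (gadgetSet I ∘ (gadgetMove j).symm)
        (gadgetMove l ∘ gadgetMatching w ∘ (gadgetMove l).symm) e
      rw [cutSize_gadget, hw, hI, hp j l hjl] at this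
      have h2 : cutSize (gadgetSet I ∘ (e * gadgetMove j).symm)
          (⇑(e * gadgetMove l : Equiv.Perm (GadgetVertex m)) ∘ gadgetMatching w ∘
            (e * gadgetMove l).symm) = 1 := this
      rw [h2]
      norm_num
  have hXR' : (∑ r, ∑ e : Equiv.Perm (GadgetVertex m), ∑ j, ∑ l, if j = l then 0 else
      condSum (f r (e * gadgetMove l)) none (p j l) *
        condSum (h r (e * gadgetMove j)) none false) ≤
      NE * (49 * (8 / 1000 * T)) := by
    rw [Finset.sum_comm]
    have : ∀ e : Equiv.Perm (GadgetVertex m), (∑ r, ∑ j, ∑ l, if j = l then 0 else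
        condSum (f r (e * gadgetMove l)) none (p j l) *
          condSum (h r (e * gadgetMove j)) none false) ≤ 49 * (8 / 1000 * T) := by
      intro e
      rw [Finset.sum_comm]
      calc _ = ∑ j : Fin 7, ∑ l : Fin 7, ∑ r, (if j = l then 0 else
          condSum (f r (e * gadgetMove l)) none (p j l) *
            condSum (h r (e * gadgetMove j)) none false) :=
            Finset.sum_congr rfl fun j _ => Finset.sum_comm
        _ ≤ ∑ _j : Fin 7, ∑ _l : Fin 7, 8 / 1000 * T :=
            Finset.sum_le_sum fun j _ => Finset.sum_le_sum fun l _ => hXR e j l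
        _ = _ := by simp; ring
    calc _ ≤ ∑ _e : Equiv.Perm (GadgetVertex m), 49 * (8 / 1000 * T) :=
          Finset.sum_le_sum fun e _ => this e
      _ = _ := by rw [Finset.sum_const, Finset.card_univ, nsmul_eq_mul]
  rw [Finset.sum_sub_distrib, Finset.sum_sub_distrib, ← Finset.mul_sum, ← Finset.mul_sum,
    ← Finset.mul_sum, Finset.sum_comm (f := fun r e => condSum (f r e) none (true, false) * _),
    Finset.sum_comm (f := fun r e => condSum (f r e) none (false, false) * _)] at hsum
  simp only [hPR, hXS, Finset.sum_const, nsmul_eq_mul, Finset.card_univ] at hsum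
  have hT' : T = 8 ^ m := by
    rw [hT, ← mul_pow]; norm_num
  have hE : 0 < NE := by rw [hNE]; exact_mod_cast Fintype.card_pos
  have hET : 0 < NE * T := by rw [hT']; positivity
  have h8 : (2 * (Fintype.card (Bool × Bool) : ℝ)) ^ Fintype.card (Option (Fin m)) = 8 * T := by
    rw [hT', Fintype.card_option, Fintype.card_fin, pow_succ]
    norm_num
    ring
  rw [h8, Fintype.card_option, Fintype.card_fin] at hsum
  push_cast at hsum
  refine le_of_mul_le_mul_left ?_ hET
  linarith

/-- The image of the edges joining each `x` with `τ x`. -/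
def inducedEdges {X : Type*} {n : ℕ} (ι : X ↪ Fin n) (τ : X → X) : Set (Sym2 (Fin n)) :=
  Set.range fun x => s(ι x, ι (τ x))

theorem mem_inducedEdges_iff {X : Type*} {n : ℕ} (ι : X ↪ Fin n) {τ : X → X}
    (hτ : Function.Involutive τ) (x y : X) : s(ι x, ι y) ∈ inducedEdges ι τ ↔ y = τ x := by
  constructor
  · rintro ⟨z, hz⟩
    simp only [Sym2.eq_iff, ι.injective.eq_iff] at hz
    rcases hz with ⟨rfl, rfl⟩ | ⟨rfl, rfl⟩
    · rfl
    · exact (hτ z).symm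
  · rintro rfl
    exact ⟨x, rfl⟩

theorem isMatchingIn_inducedEdges {X : Type*} {n : ℕ} (ι : X ↪ Fin n) {τ : X → X}
    (hτ : Function.Involutive τ) (hne : ∀ x, τ x ≠ x) : IsMatchingIn n (inducedEdges ι τ) := by
  refine ⟨?_, ?_⟩
  · rintro _ ⟨x, rfl⟩ h
    exact hne x (ι.injective (Sym2.mk_isDiag_iff.1 h)).symm
  · rintro _ ⟨x, rfl⟩ _ ⟨y, rfl⟩ hxy v ⟨hv, hv'⟩
    refine hxy ?_
    have key : ∀ z, v = ι z ∨ v = ι (τ z) → ∀ w, v = ι w → s(ι z, ι (τ z)) = s(ι w, ι (τ w)) := by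
      rintro z (h | h) w hw
      · rw [ι.injective (h.symm.trans hw)]
      · rw [← ι.injective (h.symm.trans hw), hτ z, Sym2.eq_swap]
    simp only [Sym2.mem_iff] at hv hv'
    rcases hv with h | h
    · exact (key x (Or.inl h) x h).trans (key y hv' x h).symm
    · exact (key x (Or.inr h) _ h).trans (key y hv' _ h).symm

theorem card_sub_twiceInnerEdges_inducedEdges {X : Type*} [Fintype X] {n : ℕ} (ι : X ↪ Fin n)
    {τ : X → X} (hτ : Function.Involutive τ) (hne : ∀ x, τ x ≠ x) (U : X → Bool) :
    (((Finset.univ.filter fun x => U x = true).map ι).card : ℝ) -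
      twiceInnerEdges n ((Finset.univ.filter fun x => U x = true).map ι)
        (edgeVector n (inducedEdges ι τ)) = cutSize U τ := by
  classical
  rw [twiceInnerEdges_edgeVector _ (isMatchingIn_inducedEdges ι hτ hne), Finset.sum_map,
    Finset.card_map, cutSize, sub_eq_iff_eq_add]
  have h : ∀ x, (((Finset.univ.filter fun x => U x = true).map ι).filter
      fun b => s(ι x, b) ∈ inducedEdges ι τ).card = if U (τ x) = true then 1 else 0 := by
    intro x
    rw [Finset.filter_map, Finset.card_map, Finset.filter_filter]
    simp only [Function.comp_apply, mem_inducedEdges_iff ι hτ]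
    split_ifs with hx
    · rw [Finset.card_eq_one]
      refine ⟨τ x, Finset.ext fun y => ?_⟩
      simp only [Finset.mem_filter, Finset.mem_univ, true_and, Finset.mem_singleton]
      exact ⟨fun h => h.2, fun h => ⟨h ▸ hx, h⟩⟩
    · rw [Finset.card_eq_zero, Finset.filter_eq_empty_iff]
      rintro y - ⟨hy, rfl⟩
      exact hx hy
  have h2 : (Finset.univ.filter fun x => U x = true).card =
      (Finset.univ.filter fun x => U x = true ∧ U (τ x) = false).card +
        ∑ x ∈ Finset.univ.filter (fun x => U x = true), if U (τ x) = true then 1 else 0 := by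
    rw [← Finset.card_filter, Finset.filter_filter,
      ← Finset.filter_filter (p := fun x => U x = true)
      (q := fun x => U (τ x) = false), ← Finset.filter_filter (p := fun x => U x = true)
      (q := fun x => U (τ x) = true)]
    simp only [← Bool.not_eq_true]
    rw [add_comm, Finset.card_filter_add_card_filter_not]
  simp only [h]
  exact_mod_cast h2

/-- The trade-off between the size and the number of integer variables of an approximate MILEF
of the matching polytope. -/
theorem exists_isMILEF_tradeoff : ∃ δ : ℝ, 0 < δ ∧ ∀ n m k N b : ℕ, 2 ≤ n → 0 < N →
    14 + 12 * b ≤ n → IsMILEF (matchingPolytope n) (1 / 1000 / (n : ℝ)) m k →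
    (k : ℝ) ≤ 1 / 1000 / (n : ℝ) * N →
    1 ≤ 112 * ((N : ℝ) ^ k * (m + 1) * n) * Real.exp (-(δ * (b + 1))) := by
  classical
  obtain ⟨δ, hδ, H⟩ := exists_nonneg_factorization_bound
  refine ⟨δ, hδ, fun n m k N b hn hN hb h hk => ?_⟩
  have : NeZero N := ⟨hN.ne'⟩
  obtain ⟨nh, hnh, u, hu, hv⟩ := exists_nonneg_factorization_of_isMILEF hn h hk
  choose! v hv0 hv using hv
  have hcard : Fintype.card (GadgetVertex b) ≤ n := (card_gadgetVertex b).trans_le hb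
  have ι : GadgetVertex b ↪ Fin n :=
    (Function.Embedding.nonempty_of_card_le (by simpa using hcard)).some
  let S : (GadgetVertex b → Bool) → Finset (Fin n) := fun U =>
    (Finset.univ.filter fun x => U x = true).map ι
  have hmain := H b ((Fin k → ZMod N) × Option (Fin nh))
    (fun r U => if hU : Odd (S U).card then u ⟨S U, hU⟩ r else 0)
    (fun r τ => if Function.Involutive τ ∧ ∀ x, τ x ≠ x then v (inducedEdges ι τ) r else 0)
    (fun r U => by split_ifs; exacts [hu _ _, le_rfl])
    (fun r τ => by
      split_ifs with hτ
      exacts [hv0 _ (isMatchingIn_inducedEdges ι hτ.1 hτ.2) _, le_rfl])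
    (fun U τ hU hτ hne => by
      have hU' : Odd (S U).card := by simpa only [S, Finset.card_map] using hU
      have := hv _ (isMatchingIn_inducedEdges ι hτ hne) ⟨S U, hU'⟩
      have h2 := card_sub_twiceInnerEdges_inducedEdges ι hτ hne U
      simp only [dif_pos hU', if_pos (And.intro hτ hne)]
      simp only [mul_comm (v _ _)]
      rw [← this]
      dsimp only [S]
      linarith)
  refine hmain.trans (mul_le_mul_of_nonneg_right ?_ (Real.exp_nonneg _))
  have h1 : (Fintype.card ((Fin k → ZMod N) × Option (Fin nh)) : ℝ) ≤ (N : ℝ) ^ k * (m + 1) := by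
    rw [Fintype.card_prod, Fintype.card_fun, ZMod.card, Fintype.card_option, Fintype.card_fin,
      Fintype.card_fin]
    push_cast
    have : (nh : ℝ) ≤ m := by exact_mod_cast hnh
    gcongr
  have h2 : (Fintype.card (GadgetVertex b) : ℝ) ≤ n := by exact_mod_cast hcard
  gcongr

theorem mul_exp_neg_lt_one {δ x : ℝ} (hδ : 0 < δ) (hx : 224 * 18432 / δ ^ 2 < x) :
    224 * x * Real.exp (-(δ / 96 * x)) < 1 := by
  have hx0 : 0 < x := lt_trans (by positivity) hx
  have h1 := Real.quadratic_le_exp_of_nonneg (x := δ / 96 * x) (by positivity)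
  rw [div_lt_iff₀ (by positivity)] at hx
  rw [Real.exp_neg, ← div_eq_mul_inv, div_lt_one (Real.exp_pos _)]
  have h2 := mul_lt_mul_of_pos_left hx hx0
  have h3 : 0 < δ / 96 * x := by positivity
  nlinarith

theorem not_isMILEF_tradeoff_of_lt {δ κ γ : ℝ} {n m k : ℕ} (hδ : 0 < δ) (hκ : κ ≤ δ / 576)
    (hκ2 : κ ≤ 1 / 2) (hγ : γ ≤ δ / 96) (hγ0 : 0 < γ) (hn : 26 ≤ n)
    (hn2 : 224 * 18432 / δ ^ 2 < n)
    (hm : (m : ℝ) ≤ (2 : ℝ) ^ (γ * (n : ℝ))) (hk : (k : ℝ) * Real.log n < κ * n) :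
    112 * (((1000 * n * k + 1 : ℕ) : ℝ) ^ k * (m + 1) * n) *
      Real.exp (-(δ * (((n - 14) / 12 : ℕ) + 1))) < 1 := by
  have hn' : (26 : ℝ) ≤ n := by exact_mod_cast hn
  have hn0 : (0 : ℝ) < n := by linarith
  have hlog : 1 / 2 < Real.log n :=
    lt_of_lt_of_le (by linarith [Real.log_two_gt_d9])
      (Real.log_le_log (by norm_num) (by linarith : (2 : ℝ) ≤ n))
  have hkn : (k : ℝ) ≤ n := by
    have hk0 : (0 : ℝ) ≤ k := Nat.cast_nonneg k
    nlinarith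
  have hN : ((1000 * n * k + 1 : ℕ) : ℝ) ≤ Real.exp (12 * Real.log n) := by
    have h1 : Real.exp (12 * Real.log n) = (n : ℝ) ^ 12 := by
      rw [mul_comm, Real.exp_mul, Real.exp_log hn0]
      exact_mod_cast Real.rpow_natCast (n : ℝ) 12
    rw [h1]
    push_cast
    have h2 : (26 : ℝ) ^ 10 ≤ (n : ℝ) ^ 10 := by gcongr
    have h3 : (1000 : ℝ) * n * k ≤ 1000 * n * n := by gcongr
    have h4 : (26 : ℝ) ^ 10 * n ^ 2 ≤ (n : ℝ) ^ 10 * n ^ 2 := by gcongr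
    nlinarith
  have hNk : ((1000 * n * k + 1 : ℕ) : ℝ) ^ k ≤ Real.exp (δ / 48 * n) := by
    calc ((1000 * n * k + 1 : ℕ) : ℝ) ^ k ≤ Real.exp (12 * Real.log n) ^ k := by gcongr
      _ = Real.exp (k * (12 * Real.log n)) := (Real.exp_nat_mul _ _).symm
      _ ≤ Real.exp (δ / 48 * n) := Real.exp_le_exp.2 (by nlinarith)
  have hm' : (m : ℝ) + 1 ≤ 2 * Real.exp (δ / 96 * n) := by
    have h1 : (2 : ℝ) ^ (γ * (n : ℝ)) ≤ Real.exp (δ / 96 * n) := by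
      rw [Real.rpow_def_of_pos (by norm_num)]
      refine Real.exp_le_exp.2 ?_
      have : Real.log 2 ≤ 1 := by linarith [Real.log_two_lt_d9]
      have h2 : Real.log 2 * (γ * n) ≤ 1 * (γ * n) := by gcongr
      nlinarith
    have h3 : 1 ≤ Real.exp (δ / 96 * n) := Real.one_le_exp (by positivity)
    linarith
  have hb : (n : ℝ) / 24 ≤ ((n - 14) / 12 : ℕ) + 1 := by
    have h1 : n ≤ 24 * ((n - 14) / 12 + 1) := by omega
    have h2 : (n : ℝ) ≤ 24 * (((n - 14) / 12 : ℕ) + 1) := by exact_mod_cast h1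
    linarith
  calc 112 * (((1000 * n * k + 1 : ℕ) : ℝ) ^ k * (m + 1) * n) *
        Real.exp (-(δ * (((n - 14) / 12 : ℕ) + 1)))
      ≤ 112 * (Real.exp (δ / 48 * n) * (2 * Real.exp (δ / 96 * n)) * n) *
        Real.exp (-(δ * (n / 24))) := by gcongr
    _ = 224 * n * Real.exp (δ / 48 * n + δ / 96 * n + -(δ * (n / 24))) := by
        rw [Real.exp_add, Real.exp_add]; ring
    _ = 224 * n * Real.exp (-(δ / 96 * n)) := by
        congr 2; ring
    _ < 1 := mul_exp_neg_lt_one hδ hn2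

/-- There exist constants `α, γ, κ > 0` such that for every `n ≥ 2`,
every `(α/n)`-MILEF of the matching polytope of `K_n` of size at most `2^(γ·n)` has at least
`κ·n/log n` integer variables. -/
theorem matching_milef_lower_bound :
    ∃ α γ κ : ℝ, 0 < α ∧ 0 < γ ∧ 0 < κ ∧
      ∀ n : ℕ, 2 ≤ n → ∀ m k : ℕ,
        (m : ℝ) ≤ (2 : ℝ) ^ (γ * (n : ℝ)) →
        IsMILEF (matchingPolytope n) (α / (n : ℝ)) m k →
        κ * (n : ℝ) / Real.log (n : ℝ) ≤ (k : ℝ) := by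
  obtain ⟨δ, hδ, H⟩ := exists_isMILEF_tradeoff
  obtain ⟨n₀, hn₀⟩ := exists_nat_gt (max 26 (224 * 18432 / δ ^ 2))
  obtain ⟨h26, hlarge⟩ := max_lt_iff.1 hn₀
  have hn₀' : (0 : ℝ) < n₀ := by linarith
  have hpos : (0 : ℝ) < 1 / (2 * n₀) := by positivity
  refine ⟨1 / 1000, min (δ / 96) (1 / (2 * n₀)), min (δ / 576) (1 / (2 * n₀)), by norm_num,
    lt_min (by positivity) hpos, lt_min (by positivity) hpos, fun n hn m k hm h => ?_⟩
  have hn' : (2 : ℝ) ≤ n := by exact_mod_cast hn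
  have hlog : 1 / 2 < Real.log n :=
    lt_of_lt_of_le (by linarith [Real.log_two_gt_d9]) (Real.log_le_log (by norm_num) hn')
  rw [div_le_iff₀ (by linarith)]
  rcases le_total n₀ n with hnn | hnn
  · have hnn' : (n₀ : ℝ) ≤ n := by exact_mod_cast hnn
    have hn26 : 26 ≤ n := by exact_mod_cast h26.le.trans hnn'
    by_contra! hk
    refine (H n m k (1000 * n * k + 1) ((n - 14) / 12) hn (Nat.succ_pos _) (by omega) h
      ?_).not_gt (not_isMILEF_tradeoff_of_lt hδ (min_le_left _ _) ?_ (min_le_left _ _)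
        (lt_min (by positivity) hpos) hn26 (hlarge.trans_le hnn') hm hk)
    · push_cast
      rw [div_mul_eq_mul_div, le_div_iff₀ (by linarith)]
      nlinarith
    · refine (min_le_right _ _).trans ?_
      gcongr
      linarith
  · have hnn' : (n : ℝ) ≤ n₀ := by exact_mod_cast hnn
    have hsmall : ∀ t : ℝ, t ≤ 1 / (2 * n₀) → t * n ≤ 1 / 2 := fun t ht =>
      calc t * n ≤ 1 / (2 * n₀) * n₀ := mul_le_mul ht hnn' (by positivity) hpos.le
        _ = 1 / 2 := by field_simp
    rcases Nat.eq_zero_or_pos k with rfl | hk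
    · refine absurd h (not_isMILEF_matchingPolytope_one_zero hn ?_)
      have : (m : ℝ) < 2 := by
        refine hm.trans_lt ?_
        calc (2 : ℝ) ^ (min (δ / 96) (1 / (2 * n₀)) * (n : ℝ)) < (2 : ℝ) ^ (1 : ℝ) :=
              Real.rpow_lt_rpow_of_exponent_lt (by norm_num)
                ((hsmall _ (min_le_right _ _)).trans_lt (by norm_num))
          _ = 2 := Real.rpow_one 2
      have : m < 2 := by exact_mod_cast this
      omega
    · have hk' : (1 : ℝ) ≤ k := by exact_mod_cast hk
      have := hsmall _ (min_le_right (δ / 576) (1 / (2 * n₀)))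
      nlinarith
end

section
/- Let P ⊆ [0,1]^d be a 0/1-polytope and let ε ∈ (0,1) and M > 0 be such that every polyhedron K ⊆ ℝ^d with P↑ ⊆ K ⊆ (1−ε)·P↑ satisfies xc(K) ≥ M. Then P↑ ∩ [0,1]^d does not admit an (ε/d)-LEF of size less than M − 3d. -/
open scoped ENNReal Pointwise

/-- `C` admits an `ε`-LEF of size `m`: a polyhedron `Q ⊆ ℝ^ℓ` with at most `m` facets
and an affine map `π` with `C ⊆ π(Q)` and `rdist(C, π(Q)) ≤ ε`. -/
def IsLEF {ι : Type*} (C : Set (ι → ℝ)) (ε : ℝ) (m : ℕ) : Prop :=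
  ∃ (l : ℕ) (Q : Set (Fin l → ℝ)) (π : (Fin l → ℝ) →ᵃ[ℝ] (ι → ℝ)),
    IsPolyhedronOfSize Q m ∧ C ⊆ π '' Q ∧ relDist C (π '' Q) ≤ ENNReal.ofReal ε

/-- `P` admits a linear extended formulation of size at most `m`; thus `xc(P) ≤ m` iff
`ExtensionOfSizeLE P m`. -/
def ExtensionOfSizeLE {ι : Type*} (P : Set (ι → ℝ)) (m : ℕ) : Prop :=
  ∃ (l : ℕ) (Q : Set (Fin l → ℝ)) (π : (Fin l → ℝ) →ᵃ[ℝ] (ι → ℝ)),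
    IsPolyhedronOfSize Q m ∧ P = π '' Q

/-- A set cut out by finitely many closed halfspaces of a real vector space. -/
def IsFinHalfspaceInter {E : Type*} [AddCommGroup E] [Module ℝ E] (s : Set E) : Prop :=
  ∃ T : Set ((E →ₗ[ℝ] ℝ) × ℝ), T.Finite ∧ s = {x | ∀ p ∈ T, p.1 x ≤ p.2}

namespace IsFinHalfspaceInter

variable {E F : Type*} [AddCommGroup E] [Module ℝ E] [AddCommGroup F] [Module ℝ F]

theorem inter {s t : Set E} (hs : IsFinHalfspaceInter s) (ht : IsFinHalfspaceInter t) :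
    IsFinHalfspaceInter (s ∩ t) := by
  obtain ⟨S, hS, rfl⟩ := hs
  obtain ⟨T, hT, rfl⟩ := ht
  refine ⟨S ∪ T, hS.union hT, ?_⟩
  ext x
  simp only [Set.mem_inter_iff, Set.mem_ofPred_eq, Set.mem_union]
  exact ⟨fun h p hp => hp.elim (h.1 p) (h.2 p),
    fun h => ⟨fun p hp => h p (.inl hp), fun p hp => h p (.inr hp)⟩⟩

theorem setOf_forall_le {ι : Type*} [Finite ι] (f : ι → E →ₗ[ℝ] ℝ) (b : ι → ℝ) :
    IsFinHalfspaceInter {x | ∀ i, f i x ≤ b i} :=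
  ⟨Set.range fun i => (f i, b i), Set.finite_range _, by ext x; simp⟩

theorem setOf_forall_eq {ι : Type*} [Finite ι] (f : ι → E →ₗ[ℝ] ℝ) (b : ι → ℝ) :
    IsFinHalfspaceInter {x | ∀ i, f i x = b i} := by
  convert (setOf_forall_le f b).inter (setOf_forall_le (fun i => -f i) (fun i => -b i)) using 1
  ext x
  simp only [Set.mem_ofPred_eq, Set.mem_inter_iff, LinearMap.neg_apply, neg_le_neg_iff]
  exact ⟨fun h => ⟨fun i => (h i).le, fun i => (h i).ge⟩, fun h i => (h.1 i).antisymm (h.2 i)⟩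

theorem preimage {s : Set F} (hs : IsFinHalfspaceInter s) (g : E →ₗ[ℝ] F) :
    IsFinHalfspaceInter (g ⁻¹' s) := by
  obtain ⟨T, hT, rfl⟩ := hs
  refine ⟨(fun p => (p.1 ∘ₗ g, p.2)) '' T, hT.image _, ?_⟩
  ext x
  simp only [Set.mem_preimage, Set.mem_ofPred_eq, Set.forall_mem_image]
  rfl

theorem affineSubspace [FiniteDimensional ℝ E] (S : AffineSubspace ℝ E) :
    IsFinHalfspaceInter (S : Set E) := by
  obtain hS | ⟨p, hp⟩ := (S : Set E).eq_empty_or_nonempty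
  · refine ⟨{(0, -1)}, Set.finite_singleton _, ?_⟩
    rw [hS]
    ext x
    simp only [Set.mem_empty_iff_false, Set.mem_singleton_iff, forall_eq, Set.mem_ofPred_eq,
      LinearMap.zero_apply, false_iff]
    norm_num
  · let B := Module.finBasis ℝ (E ⧸ S.direction)
    convert setOf_forall_eq (fun i => B.coord i ∘ₗ S.direction.mkQ)
      (fun i => B.coord i (S.direction.mkQ p)) using 1
    ext x
    have : (x ∈ S) ↔ S.direction.mkQ x = S.direction.mkQ p := by
      rw [← AffineSubspace.vsub_right_mem_direction_iff_mem hp, Submodule.mkQ_apply,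
        Submodule.mkQ_apply, Submodule.Quotient.eq, vsub_eq_sub]
    rw [SetLike.mem_coe, this, B.ext_elem_iff]
    rfl

/-- Fourier–Motzkin elimination of one variable. -/
theorem image_fst_real {s : Set (E × ℝ)} (hs : IsFinHalfspaceInter s) :
    IsFinHalfspaceInter (Prod.fst '' s) := by
  obtain ⟨T, hT, rfl⟩ := hs
  let c : ((E × ℝ →ₗ[ℝ] ℝ) × ℝ) → ℝ := fun p => p.1 (0, 1)
  let g : ((E × ℝ →ₗ[ℝ] ℝ) × ℝ) → E →ₗ[ℝ] ℝ := fun p => p.1 ∘ₗ LinearMap.inl ℝ E ℝ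
  have hsplit : ∀ (p : (E × ℝ →ₗ[ℝ] ℝ) × ℝ) x t, p.1 (x, t) = g p x + t * c p := by
    intro p x t
    have : ((x, t) : E × ℝ) = (x, 0) + t • ((0 : E), (1 : ℝ)) := by simp
    rw [this, map_add, map_smul, smul_eq_mul]
    rfl
  refine ⟨(fun p => (g p, p.2)) '' {p ∈ T | c p = 0} ∪
    Set.image2 (fun p q => (c p • g q - c q • g p, c p * q.2 - c q * p.2))
      {p ∈ T | 0 < c p} {q ∈ T | c q < 0},
    ((hT.sep _).image _).union ((hT.sep _).image2 _ (hT.sep _)), ?_⟩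
  ext x
  have himage : x ∈ Prod.fst '' {x : E × ℝ | ∀ p ∈ T, p.1 x ≤ p.2} ↔
      ∃ t : ℝ, ∀ p ∈ T, p.1 (x, t) ≤ p.2 := by simp
  rw [himage]
  simp only [Set.mem_ofPred_eq, Set.mem_union, or_imp, forall_and, Set.forall_mem_image,
    Set.forall_mem_image2, hsplit]
  constructor
  · rintro ⟨t, ht⟩
    constructor
    · rintro p ⟨hp, hc⟩
      simpa [hc] using ht p hp
    · rintro p ⟨hp, hcp⟩ q ⟨hq, hcq⟩
      simp only [LinearMap.sub_apply, LinearMap.smul_apply, smul_eq_mul]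
      nlinarith [mul_le_mul_of_nonneg_left (ht q hq) hcp.le,
        mul_le_mul_of_nonneg_left (ht p hp) (neg_pos.2 hcq).le]
  · rintro ⟨hz, hpn⟩
    let φ : ((E × ℝ →ₗ[ℝ] ℝ) × ℝ) → ℝ := fun p => (p.2 - g p x) / c p
    obtain ⟨t, htl, htu⟩ : ∃ t, (∀ q ∈ {q ∈ T | c q < 0}, φ q ≤ t) ∧
        ∀ p ∈ {p ∈ T | 0 < c p}, t ≤ φ p := by
      obtain hL | hL := {q ∈ T | c q < 0}.eq_empty_or_nonempty
      · obtain ⟨t, ht⟩ := ((hT.sep fun p => 0 < c p).image φ).bddBelow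
        exact ⟨t, by simp [hL], fun p hp => ht ⟨p, hp, rfl⟩⟩
      · obtain ⟨q, hq, hmax⟩ := Set.exists_max_image _ φ (hT.sep _) hL
        refine ⟨φ q, hmax, fun p hp => ?_⟩
        have := hpn p hp q hq
        simp only [LinearMap.sub_apply, LinearMap.smul_apply, smul_eq_mul] at this
        have hcp : 0 < c p := hp.2
        have hcq : c q < 0 := hq.2
        rw [le_div_iff₀ hcp, div_mul_eq_mul_div, div_le_iff_of_neg hcq]
        nlinarith
    refine ⟨t, fun p hp => ?_⟩
    rcases lt_trichotomy (c p) 0 with h | h | h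
    · have := htl p ⟨hp, h⟩
      rw [div_le_iff_of_neg h] at this
      linarith
    · simpa [h] using hz ⟨hp, h⟩
    · have := htu p ⟨hp, h⟩
      rw [le_div_iff₀ h] at this
      linarith

theorem image_fst_pi (n : ℕ) {E : Type*} [AddCommGroup E] [Module ℝ E]
    {s : Set (E × (Fin n → ℝ))} (hs : IsFinHalfspaceInter s) :
    IsFinHalfspaceInter (Prod.fst '' s) := by
  induction n generalizing E with
  | zero =>
    convert hs.preimage (LinearMap.inl ℝ E (Fin 0 → ℝ)) using 1
    ext x
    constructor
    · rintro ⟨⟨x, y⟩, h, rfl⟩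
      obtain rfl : y = 0 := Subsingleton.elim _ _
      exact h
    · exact fun h => ⟨(x, 0), h, rfl⟩
  | succ n ih =>
    let g : (E × ℝ) × (Fin n → ℝ) →ₗ[ℝ] E × (Fin (n + 1) → ℝ) :=
      { toFun := fun z => (z.1.1, Fin.cons z.1.2 z.2)
        map_add' := fun y z => Prod.ext rfl <| by
          funext i
          refine Fin.cases ?_ (fun i => ?_) i <;> simp
        map_smul' := fun a z => Prod.ext rfl <| by
          funext i
          refine Fin.cases ?_ (fun i => ?_) i <;> simp }
    convert (ih (hs.preimage g)).image_fst_real using 1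
    ext x
    simp only [Set.mem_image, Prod.exists, exists_and_right, exists_eq_right, Set.mem_preimage]
    constructor
    · rintro ⟨y, hy⟩
      refine ⟨y 0, Fin.tail y, ?_⟩
      change (x, Fin.cons (y 0) (Fin.tail y)) ∈ s
      rwa [Fin.cons_self_tail]
    · rintro ⟨t, y, h⟩
      exact ⟨_, h⟩

theorem image_affineMap {l : ℕ} {ι : Type*} [Finite ι] {s : Set (Fin l → ℝ)}
    (hs : IsFinHalfspaceInter s) (π : (Fin l → ℝ) →ᵃ[ℝ] (ι → ℝ)) :
    IsFinHalfspaceInter (π '' s) := by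
  convert image_fst_pi l ((hs.preimage (LinearMap.snd ℝ (ι → ℝ) (Fin l → ℝ))).inter
    (setOf_forall_eq (fun i => LinearMap.proj i ∘ₗ (LinearMap.fst ℝ (ι → ℝ) (Fin l → ℝ) -
      π.linear ∘ₗ LinearMap.snd ℝ (ι → ℝ) (Fin l → ℝ))) (π 0))) using 1
  ext x
  have hπ : ∀ q, π q = π.linear q + π 0 := fun q => congrFun π.decomp q
  simp only [Set.mem_image, Set.mem_inter_iff, Set.mem_preimage, Set.mem_ofPred_eq, Prod.exists,
    exists_and_right, exists_eq_right, LinearMap.snd_apply, LinearMap.comp_apply,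
    LinearMap.sub_apply, LinearMap.fst_apply, LinearMap.proj_apply, Pi.sub_apply]
  refine exists_congr fun q => and_congr_right fun _ => ?_
  rw [hπ, funext_iff]
  refine forall_congr' fun i => ?_
  rw [Pi.add_apply]
  constructor <;> intro h <;> linarith

theorem isPolyhedron {ι : Type*} {s : Set (ι → ℝ)} (hs : IsFinHalfspaceInter s) :
    IsPolyhedron s := by
  obtain ⟨T, hT, rfl⟩ := hs
  have := hT.fintype
  let e := Fintype.equivFin T
  refine ⟨Fintype.card T, ⊤, _, le_rfl, fun i => (e.symm i).1.1, fun i => (e.symm i).1.2, ?_⟩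
  ext x
  simp only [AffineSubspace.top_coe, Set.univ_inter, Set.mem_ofPred_eq]
  rw [e.symm.forall_congr_left]
  simp

end IsFinHalfspaceInter

theorem IsPolyhedronOfSize.isFinHalfspaceInter {ι : Type*} [Finite ι] {Q : Set (ι → ℝ)} {m : ℕ}
    (hQ : IsPolyhedronOfSize Q m) : IsFinHalfspaceInter Q := by
  obtain ⟨S, nh, -, f, b, rfl⟩ := hQ
  exact (IsFinHalfspaceInter.affineSubspace S).inter (.setOf_forall_le f b)

theorem ExtensionOfSizeLE.isPolyhedron {ι : Type*} [Finite ι] {K : Set (ι → ℝ)} {m : ℕ}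
    (hK : ExtensionOfSizeLE K m) : IsPolyhedron K := by
  obtain ⟨l, Q, π, hQ, rfl⟩ := hK
  exact (hQ.isFinHalfspaceInter.image_affineMap π).isPolyhedron

theorem IsPolyhedronOfSize.of_fintype {ι κ : Type*} [Fintype κ] (S : AffineSubspace ℝ (ι → ℝ))
    (f : κ → (ι → ℝ) →ₗ[ℝ] ℝ) (b : κ → ℝ) :
    IsPolyhedronOfSize ((S : Set (ι → ℝ)) ∩ {x | ∀ k, f k x ≤ b k}) (Fintype.card κ) := by
  let e := Fintype.equivFin κ
  refine ⟨S, _, le_rfl, fun i => f (e.symm i), fun i => b (e.symm i), ?_⟩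
  congr 1
  ext x
  exact e.symm.forall_congr_right.symm

/-- The dominant of the nonnegative part of a set with an extended formulation of size `m`. -/
theorem ExtensionOfSizeLE.dominant_nonneg {d m : ℕ} {R : Set (Fin d → ℝ)}
    (hR : ExtensionOfSizeLE R m) :
    ExtensionOfSizeLE ((R ∩ {x | ∀ i, 0 ≤ x i}) + {x : Fin d → ℝ | ∀ i, 0 ≤ x i})
      (m + 2 * d) := by
  obtain ⟨l, Q, π, ⟨S, nh, hnh, f, b, rfl⟩, rfl⟩ := hR
  have hπ : ∀ q, π q = π.linear q + π 0 := fun q => congrFun π.decomp q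
  let p₁ : (Fin (l + d) → ℝ) →ₗ[ℝ] (Fin l → ℝ) := LinearMap.funLeft ℝ ℝ (Fin.castAdd d)
  let p₂ : (Fin (l + d) → ℝ) →ₗ[ℝ] (Fin d → ℝ) := LinearMap.funLeft ℝ ℝ (Fin.natAdd l)
  let F : Fin nh ⊕ Fin d ⊕ Fin d → (Fin (l + d) → ℝ) →ₗ[ℝ] ℝ :=
    Sum.elim (fun i => f i ∘ₗ p₁) (Sum.elim (fun i => -(LinearMap.proj i ∘ₗ π.linear ∘ₗ p₁))
      (fun i => -(LinearMap.proj i ∘ₗ p₂)))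
  let B : Fin nh ⊕ Fin d ⊕ Fin d → ℝ := Sum.elim b (Sum.elim (π 0) 0)
  obtain ⟨S', n, hn, F', B', hQ'⟩ :=
    IsPolyhedronOfSize.of_fintype (S.comap p₁.toAffineMap) F B
  refine ⟨l + d, _, π.comp p₁.toAffineMap + p₂.toAffineMap,
    ⟨S', n, hn.trans ?_, F', B', hQ'⟩, ?_⟩
  · simp only [Fintype.card_sum, Fintype.card_fin]
    omega
  have hmem : ∀ z, z ∈ (S.comap p₁.toAffineMap : Set (Fin (l + d) → ℝ)) ∩ {x | ∀ k, F k x ≤ B k} ↔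
      (p₁ z ∈ (S : Set (Fin l → ℝ)) ∩ {x | ∀ i, f i x ≤ b i} ∧ ∀ i, 0 ≤ π (p₁ z) i) ∧
        ∀ i, 0 ≤ p₂ z i := by
    intro z
    have hF : (∀ k, F k z ≤ B k) ↔ (∀ i, f i (p₁ z) ≤ b i) ∧ (∀ i, 0 ≤ π (p₁ z) i) ∧
        ∀ i, 0 ≤ p₂ z i := by
      simp only [Sum.forall]
      refine and_congr Iff.rfl (and_congr (forall_congr' fun i => ?_)
        (forall_congr' fun i => neg_nonpos))
      rw [hπ (p₁ z)]
      exact neg_le_iff_add_nonneg'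
    rw [Set.mem_inter_iff, Set.mem_ofPred_eq, hF]
    exact ⟨fun h => ⟨⟨⟨h.1, h.2.1⟩, h.2.2.1⟩, h.2.2.2⟩,
      fun h => ⟨h.1.1.1, h.1.1.2, h.1.2, h.2⟩⟩
  ext x
  constructor
  · rintro ⟨-, ⟨⟨q, hq, rfl⟩, hq0⟩, s, hs, rfl⟩
    have h₁ : p₁ (Fin.append q s) = q := by
      funext i
      exact Fin.append_left q s i
    have h₂ : p₂ (Fin.append q s) = s := by
      funext i
      exact Fin.append_right q s i
    refine ⟨Fin.append q s, (hmem _).2 ?_, ?_⟩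
    · rw [h₁, h₂]
      exact ⟨⟨hq, hq0⟩, hs⟩
    · exact congrArg₂ (fun q s => π q + s) h₁ h₂
  · rintro ⟨z, hz, rfl⟩
    obtain ⟨⟨hq, hq0⟩, hs⟩ := (hmem z).1 hz
    exact ⟨_, ⟨⟨_, hq, rfl⟩, hq0⟩, _, hs, rfl⟩

/-- A point violating the relaxation of the dominant of a `0/1`-polytope does so for a
nonnegative functional whose coefficients are bounded by its lower bound on the polytope. -/
theorem exists_bounded_separator {d : ℕ} {V : Set (Fin d → ℝ)} (hV : V.Nonempty)
    (h01 : ∀ v ∈ V, ∀ i, v i = 0 ∨ v i = 1) {ρ : ℝ} (hρ : 0 < ρ) {r : Fin d → ℝ}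
    (hr0 : ∀ i, 0 ≤ r i)
    (hr : r ∉ ρ • (convexHull ℝ V + {x : Fin d → ℝ | ∀ i, 0 ≤ x i})) :
    ∃ (c : Fin d → ℝ) (δ : ℝ), 0 < δ ∧ (∀ i, 0 ≤ c i ∧ c i ≤ δ) ∧ c ⬝ᵥ r < ρ * δ ∧
      ∀ x ∈ convexHull ℝ V + {x : Fin d → ℝ | ∀ i, 0 ≤ x i}, δ ≤ c ⬝ᵥ x := by
  have horth : {x : Fin d → ℝ | ∀ i, 0 ≤ x i} = Set.Ici 0 := rfl
  have hVfin : V.Finite := by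
    refine (Set.Finite.pi' fun _ : Fin d => Set.toFinite {(0 : ℝ), 1}).subset fun v hv i => ?_
    simpa using h01 v hv i
  have hclosed : IsClosed (ρ • (convexHull ℝ V + {x : Fin d → ℝ | ∀ i, 0 ≤ x i})) := by
    refine IsClosed.smul_of_ne_zero ?_ hρ.ne'
    exact (horth ▸ isClosed_Ici).add_left_of_isCompact (hVfin.isCompact_convexHull ℝ)
  have hconv : Convex ℝ (ρ • (convexHull ℝ V + {x : Fin d → ℝ | ∀ i, 0 ≤ x i})) :=
    ((convex_convexHull ℝ V).add (horth ▸ convex_Ici 0)).smul ρ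
  obtain ⟨f, u, hfr, hfu⟩ := geometric_hahn_banach_point_closed hconv hclosed hr
  let a : Fin d → ℝ := fun i => f (Pi.single i 1)
  have hfa : ∀ x, f x = a ⬝ᵥ x := by
    intro x
    conv_lhs => rw [pi_eq_sum_univ' x]
    simp [a, dotProduct, mul_comm]
  have hlow : ∀ v ∈ V, ∀ s : Fin d → ℝ, (∀ i, 0 ≤ s i) → u < ρ * (a ⬝ᵥ v + a ⬝ᵥ s) := by
    intro v hv s hs
    have := hfu _ (Set.smul_mem_smul_set (Set.add_mem_add (subset_convexHull ℝ V hv) hs))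
    rwa [hfa, dotProduct_smul, dotProduct_add, smul_eq_mul] at this
  have ha : ∀ i, 0 ≤ a i := by
    intro i
    obtain ⟨v, hv⟩ := hV
    by_contra! hi
    let t : ℝ := max 0 ((u / ρ - a ⬝ᵥ v) / a i)
    have h1 := hlow v hv (Pi.single i t) (fun j => by
      rcases eq_or_ne j i with rfl | h
      · simp [t]
      · simp [h])
    have h2 : t * a i ≤ u / ρ - a ⬝ᵥ v :=
      (div_le_iff_of_neg hi).1 (le_max_right _ _)
    rw [dotProduct_single] at h1
    rw [← div_lt_iff₀' hρ] at h1
    linarith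
  have hur : a ⬝ᵥ r < u := hfa r ▸ hfr
  have hδ : 0 < u / ρ :=
    div_pos ((Finset.sum_nonneg fun i _ => mul_nonneg (ha i) (hr0 i)).trans_lt hur) hρ
  have hc0 : ∀ i, 0 ≤ min (a i) (u / ρ) := fun i => le_min (ha i) hδ.le
  refine ⟨fun i => min (a i) (u / ρ), u / ρ, hδ, fun i => ⟨hc0 i, min_le_right _ _⟩, ?_, ?_⟩
  · rw [mul_div_cancel₀ _ hρ.ne']
    exact (Finset.sum_le_sum fun i _ =>
      mul_le_mul_of_nonneg_right (min_le_left _ _) (hr0 i)).trans_lt hur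
  · have hvert : ∀ v ∈ V, u / ρ ≤ (fun i => min (a i) (u / ρ)) ⬝ᵥ v := by
      intro v hv
      have hv0 : ∀ i, 0 ≤ v i := fun i => by rcases h01 v hv i with h | h <;> simp [h]
      by_cases h : ∃ i, v i = 1 ∧ u / ρ ≤ a i
      · obtain ⟨i, hi, hai⟩ := h
        refine le_trans ?_ (Finset.single_le_sum
          (fun j _ => mul_nonneg (hc0 j) (hv0 j)) (Finset.mem_univ i))
        simp [hi, hai]
      · push Not at h
        have heq : (fun i => min (a i) (u / ρ)) ⬝ᵥ v = a ⬝ᵥ v := by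
          refine Finset.sum_congr rfl fun i _ => ?_
          rcases h01 v hv i with h' | h'
          · simp [h']
          · simp [h', (h i h').le]
        rw [heq, div_le_iff₀' hρ]
        simpa using (hlow v hv 0 fun _ => le_rfl).le
    rintro - ⟨p, hp, s, hs, rfl⟩
    have hhalf : convexHull ℝ V ⊆ {x | u / ρ ≤ (fun i => min (a i) (u / ρ)) ⬝ᵥ x} :=
      convexHull_min hvert (convex_halfSpace_ge (𝕜 := ℝ)
        ⟨fun x y => dotProduct_add _ x y, fun k x => dotProduct_smul k _ x⟩ _)
    rw [dotProduct_add]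
    exact (hhalf hp).trans
      (le_add_of_nonneg_right (Finset.sum_nonneg fun i _ => mul_nonneg (hc0 i) (hs i)))

/-- A functional that bounds `A` from below by `δ`, varies by at most `D` on `A`, and takes a
smaller value at `b ∈ B` bounds the relative distance from below. -/
theorem ofReal_div_le_relDist {ι : Type*} {A B : Set (ι → ℝ)} (φ : (ι → ℝ) →ₗ[ℝ] ℝ) {δ D : ℝ}
    (hD : 0 < D) (hδ : ∀ a ∈ A, δ ≤ φ a) (hA : ∀ a ∈ A, ∀ a' ∈ A, |φ a - φ a'| ≤ D)
    {b : ι → ℝ} (hb : b ∈ B) : ENNReal.ofReal ((δ - φ b) / D) ≤ relDist A B := by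
  rw [ENNReal.ofReal_div_of_pos hD]
  refine le_trans (ENNReal.div_le_div ?_ ?_) (le_iSup (fun π : (ι → ℝ) →ₗ[ℝ] ℝ =>
    (⨆ b ∈ B, ⨅ a ∈ A, ENNReal.ofReal |π b - π a|) /
      (⨆ a ∈ A, ⨆ a' ∈ A, ENNReal.ofReal |π a - π a'|)) φ)
  · refine le_trans ?_ (le_iSup₂ b hb)
    refine le_iInf₂ fun a ha => ENNReal.ofReal_le_ofReal ?_
    rw [abs_sub_comm]
    exact (sub_le_sub_right (hδ a ha) _).trans (le_abs_self _)
  · exact iSup₂_le fun a ha => iSup₂_le fun a' ha' => ENNReal.ofReal_le_ofReal (hA a ha a' ha')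

/-- A nonnegative point close to the truncated dominant, in relative distance, lies in the
relaxation of the dominant. -/
theorem mem_smul_dominant_of_relDist_le {d : ℕ} {V : Set (Fin d → ℝ)} (hV : V.Nonempty)
    (h01 : ∀ v ∈ V, ∀ i, v i = 0 ∨ v i = 1) {ε : ℝ} (hε0 : 0 < ε) (hε1 : ε < 1)
    {R : Set (Fin d → ℝ)}
    (hR : relDist ((convexHull ℝ V + {x : Fin d → ℝ | ∀ i, 0 ≤ x i}) ∩
      {x | ∀ i, 0 ≤ x i ∧ x i ≤ 1}) R ≤ ENNReal.ofReal (ε / (d : ℝ)))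
    {r : Fin d → ℝ} (hr : r ∈ R) (hr0 : ∀ i, 0 ≤ r i) :
    r ∈ (1 - ε) • (convexHull ℝ V + {x : Fin d → ℝ | ∀ i, 0 ≤ x i}) := by
  by_contra hnot
  obtain ⟨c, δ, hδ, hc, hcr, hlow⟩ :=
    exists_bounded_separator hV h01 (sub_pos.2 hε1) hr0 hnot
  have hd : (0 : ℝ) < d := by
    rcases Nat.eq_zero_or_pos d with rfl | h
    · obtain ⟨v, hv⟩ := hV
      have := hlow _ (Set.add_mem_add (subset_convexHull ℝ V hv)
        (show (0 : Fin 0 → ℝ) ∈ {x : Fin 0 → ℝ | ∀ i, 0 ≤ x i} from fun _ => le_rfl))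
      simp only [dotProduct, Finset.univ_eq_empty, Finset.sum_empty] at this
      exact absurd this hδ.not_ge
    · exact_mod_cast h
  have hbound : ∀ x : Fin d → ℝ, (∀ i, 0 ≤ x i ∧ x i ≤ 1) → 0 ≤ c ⬝ᵥ x ∧ c ⬝ᵥ x ≤ d * δ := by
    intro x hx
    refine ⟨Finset.sum_nonneg fun i _ => mul_nonneg (hc i).1 (hx i).1, ?_⟩
    calc c ⬝ᵥ x ≤ ∑ _i : Fin d, δ := Finset.sum_le_sum fun i _ =>
          (mul_le_of_le_one_right (hc i).1 (hx i).2).trans (hc i).2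
      _ = d * δ := by simp
  have key := (ofReal_div_le_relDist (δ := δ) (D := d * δ)
    (dotProductBilin ℝ ℝ c) (by positivity) (fun a ha => hlow a ha.1)
    (fun a ha a' ha' => by
      have h := hbound a ha.2
      have h' := hbound a' ha'.2
      exact abs_sub_le_of_nonneg_of_le h.1 h.2 h'.1 h'.2) hr).trans hR
  rw [ENNReal.ofReal_le_ofReal_iff (by positivity), div_le_div_iff₀ (by positivity) hd] at key
  change (δ - c ⬝ᵥ r) * d ≤ _ at key
  have := mul_lt_mul_of_pos_right hcr hd
  nlinarith

/-- Let `P ⊆ [0,1]^d` be a `0/1`-polytope, `ε ∈ (0,1)`, `M > 0` such that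
every polyhedron `K` with `P↑ ⊆ K ⊆ (1-ε)·P↑` satisfies `xc(K) ≥ M`.  Then
`P↑ ∩ [0,1]^d` does not admit an `(ε/d)`-LEF of size less than `M - 3d`. -/
theorem inapprox_dominant_to_inapprox_LEF (d : ℕ) (P : Set (Fin d → ℝ))
    (h01 : ∃ V : Set (Fin d → ℝ), V.Nonempty ∧ (∀ v ∈ V, ∀ i, v i = 0 ∨ v i = 1) ∧
      P = convexHull ℝ V)
    (ε : ℝ) (hε0 : 0 < ε) (hε1 : ε < 1) (M : ℝ) (hM : 0 < M)
    (hxc : ∀ K : Set (Fin d → ℝ), IsPolyhedron K →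
        P + {x : Fin d → ℝ | ∀ i, 0 ≤ x i} ⊆ K →
        K ⊆ (1 - ε) • (P + {x : Fin d → ℝ | ∀ i, 0 ≤ x i}) →
        ∀ m : ℕ, ExtensionOfSizeLE K m → M ≤ (m : ℝ)) :
    ¬ ∃ m : ℕ, (m : ℝ) < M - 3 * (d : ℝ) ∧
        IsLEF ((P + {x : Fin d → ℝ | ∀ i, 0 ≤ x i}) ∩ {x | ∀ i, 0 ≤ x i ∧ x i ≤ 1})
          (ε / (d : ℝ)) m := by
  rintro ⟨m, hm, l, Q, π, hQ, hsub, hdist⟩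
  obtain ⟨V, hV, hV01, rfl⟩ := h01
  have hext := ExtensionOfSizeLE.dominant_nonneg ⟨l, Q, π, hQ, rfl⟩
  have hP : convexHull ℝ V ⊆ {x : Fin d → ℝ | ∀ i, 0 ≤ x i ∧ x i ≤ 1} := by
    have hIcc : convexHull ℝ V ⊆ Set.Icc 0 1 := by
      refine convexHull_min (fun v hv => ⟨fun i => ?_, fun i => ?_⟩) (convex_Icc 0 1) <;>
        rcases hV01 v hv i with h | h <;> simp [h]
    exact fun x hx i => ⟨(hIcc hx).1 i, (hIcc hx).2 i⟩
  have hM' := hxc _ hext.isPolyhedron ?_ ?_ _ hext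
  · push_cast at hM'
    linarith [(Nat.cast_nonneg d : (0 : ℝ) ≤ d)]
  · refine Set.add_subset_add_right fun p hp => ⟨hsub ⟨?_, hP hp⟩, fun i => (hP hp i).1⟩
    exact ⟨p, hp, 0, fun _ => le_rfl, add_zero p⟩
  · rintro - ⟨r, ⟨hr, hr0⟩, s, hs, rfl⟩
    obtain ⟨-, ⟨p, hp, t, ht, rfl⟩, rfl⟩ :=
      mem_smul_dominant_of_relDist_le hV hV01 hε0 hε1 hdist hr hr0
    have h1 : (0 : ℝ) < 1 - ε := sub_pos.2 hε1
    refine ⟨p + (t + (1 - ε)⁻¹ • s), ⟨p, hp, _, fun i => ?_, rfl⟩, ?_⟩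
    · exact add_nonneg (ht i) (mul_nonneg (inv_nonneg.2 h1.le) (hs i))
    · simp only [smul_add, smul_inv_smul₀ h1.ne', add_assoc]
end

section
/- Let n be even, K_n = (V,E) the complete undirected graph on n vertices, and fix any orientation of the edges of K_n; for v ∈ V let δ⁺(v) and δ⁻(v) denote the sets of edges leaving and entering v under this orientation, and for x ∈ ℝ^E and F ⊆ E write x(F) := Σ_{e∈F} x_e. Then the V-join polytope satisfies P_vjoin(n) = conv { x ∈ [0,1]^E : there exists z ∈ ℤ^V with x(δ⁺(v)) − x(δ⁻(v)) = 2·z_v + 1 for all v ∈ V }. -/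
open scoped ENNReal Pointwise

noncomputable instance (n : ℕ) : Fintype (CompleteEdge n) := Fintype.ofFinite _

/-- `F` is a `V`-join in `K_n`: every vertex has odd degree in `(V, F)`. -/
def IsVJoin (n : ℕ) (F : Set (Sym2 (Fin n))) : Prop :=
  (∀ e ∈ F, ¬ e.IsDiag) ∧ ∀ v : Fin n, Odd {e ∈ F | v ∈ e}.ncard

/-- The `V`-join polytope of `K_n`: the convex hull in `ℝ^E` of the characteristic vectors
of all `V`-joins. -/
noncomputable def vjoinPolytope (n : ℕ) : Set (CompleteEdge n → ℝ) :=
  convexHull ℝ { x | ∃ F : Set (Sym2 (Fin n)), IsVJoin n F ∧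
    x = fun e : CompleteEdge n => Set.indicator F (fun _ => (1 : ℝ)) e.val }

/-- `x(F) = ∑_{e ∈ F} x_e` for a set of edges `F`. -/
noncomputable def setSum {α : Type*} [Fintype α] (s : Set α) (x : α → ℝ) : ℝ :=
  ∑ e : α, Set.indicator s x e

/-- The net outflow `x(δ⁺(v)) - x(δ⁻(v))` under the orientation with heads `o`. -/
noncomputable def netOutflow {n : ℕ} (o : CompleteEdge n → Fin n) (x : CompleteEdge n → ℝ)
    (v : Fin n) : ℝ :=
  setSum {e : CompleteEdge n | v ∈ e.val ∧ o e ≠ v} x - setSum {e : CompleteEdge n | o e = v} x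

open Classical in
/-- The signed vertex-edge incidence coefficient: `1` at the tail, `-1` at the head. -/
noncomputable def incidenceSign {n : ℕ} (o : CompleteEdge n → Fin n) (v : Fin n)
    (e : CompleteEdge n) : ℤ :=
  (if v ∈ e.val then 1 else 0) - 2 * (if o e = v then 1 else 0)

/-- The points of the cube whose net outflow at every vertex `v` is `b v`. -/
def outflowPolytope {n : ℕ} (o : CompleteEdge n → Fin n) (b : Fin n → ℤ) :
    Set (CompleteEdge n → ℝ) :=
  {x | (∀ e, 0 ≤ x e ∧ x e ≤ 1) ∧ ∀ v, netOutflow o x v = b v}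

lemma netOutflow_eq_sum {n : ℕ} {o : CompleteEdge n → Fin n} (ho : ∀ e, o e ∈ e.val)
    (x : CompleteEdge n → ℝ) (v : Fin n) :
    netOutflow o x v = ∑ e, (incidenceSign o v e : ℝ) * x e := by
  classical
  unfold netOutflow setSum incidenceSign
  rw [← Finset.sum_sub_distrib]
  refine Finset.sum_congr rfl fun e _ => ?_
  have := ho e
  by_cases h : o e = v
  · have hv : v ∈ e.val := h ▸ this
    norm_num [h, hv]
  · by_cases hv : v ∈ e.val <;> simp [h, hv]

lemma incidenceSign_eq_zero {n : ℕ} {o : CompleteEdge n → Fin n} (ho : ∀ e, o e ∈ e.val)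
    {v : Fin n} {e : CompleteEdge n} (h : v ∉ e.val) : incidenceSign o v e = 0 := by
  have : o e ≠ v := fun h' => h (h' ▸ ho e)
  simp [incidenceSign, h, this]

lemma incidenceSign_eq_one_or_neg_one {n : ℕ} (o : CompleteEdge n → Fin n) {v : Fin n} {e : CompleteEdge n}
    (h : v ∈ e.val) : incidenceSign o v e = 1 ∨ incidenceSign o v e = -1 := by
  by_cases h' : o e = v <;> simp [incidenceSign, h, h']

open Classical in
lemma card_filter_mem_edge {n : ℕ} (e : CompleteEdge n) :
    (Finset.univ.filter fun v => v ∈ e.val).card = 2 := by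
  rw [← Sym2.card_toFinset_of_not_isDiag e.val e.property]
  congr 1
  ext v
  simp

lemma sum_incidenceSign {n : ℕ} (o : CompleteEdge n → Fin n) (e : CompleteEdge n) :
    ∑ v, incidenceSign o v e = 0 := by
  classical
  have h := card_filter_mem_edge e
  simp only [incidenceSign, Finset.sum_sub_distrib, ← Finset.mul_sum, Finset.sum_boole,
    Finset.filter_eq, Finset.mem_univ, if_true, Finset.card_singleton]
  rw [h]
  norm_num

/-- The net outflow of the characteristic vector of `F` has the parity of the degree in `F`. -/
lemma netOutflow_indicator {n : ℕ} {o : CompleteEdge n → Fin n} (ho : ∀ e, o e ∈ e.val)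
    {F : Set (Sym2 (Fin n))} (hF : ∀ e ∈ F, ¬ e.IsDiag) (v : Fin n) :
    ∃ k : ℕ, netOutflow o (fun e => F.indicator (fun _ => (1 : ℝ)) e.val) v
      = ({e ∈ F | v ∈ e}.ncard : ℝ) - 2 * k := by
  classical
  refine ⟨(Finset.univ.filter fun e : CompleteEdge n => o e = v ∧ e.val ∈ F).card, ?_⟩
  have h : {e ∈ F | v ∈ e}.ncard
      = (Finset.univ.filter fun e : CompleteEdge n => v ∈ e.val ∧ e.val ∈ F).card := by
    rw [← Set.ncard_coe_finset, ← Set.ncard_image_of_injective _ Subtype.val_injective]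
    congr 1
    ext e
    constructor
    · rintro ⟨h1, h2⟩
      exact ⟨⟨e, hF e h1⟩, by simpa using ⟨h2, h1⟩, rfl⟩
    · rintro ⟨f, hf, rfl⟩
      have hf' : v ∈ f.val ∧ f.val ∈ F := by simpa using hf
      exact ⟨hf'.2, hf'.1⟩
  rw [h, netOutflow_eq_sum ho, ← Finset.sum_boole, ← Finset.sum_boole, Finset.mul_sum,
    ← Finset.sum_sub_distrib]
  refine Finset.sum_congr rfl fun e _ => ?_
  by_cases h1 : e.val ∈ F <;> simp [incidenceSign, h1]

/-- If the net outflow at `v` is integral, `v` cannot be on exactly one fractional edge. -/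
lemma exists_ne_fractional {n : ℕ} {o : CompleteEdge n → Fin n} (ho : ∀ e, o e ∈ e.val)
    {b : Fin n → ℤ} {x : CompleteEdge n → ℝ} (hx : x ∈ outflowPolytope o b)
    {v : Fin n} {e : CompleteEdge n} (hv : v ∈ e.val) (he : x e ≠ 0 ∧ x e ≠ 1) :
    ∃ f, f ≠ e ∧ v ∈ f.val ∧ x f ≠ 0 ∧ x f ≠ 1 := by
  classical
  by_contra! hcon
  have hint : ∀ f ∈ Finset.univ.erase e, ∃ k : ℤ, (incidenceSign o v f : ℝ) * x f = k := by
    intro f hf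
    by_cases hvf : v ∈ f.val
    · by_cases h0 : x f = 0
      · exact ⟨0, by simp [h0]⟩
      · exact ⟨incidenceSign o v f, by simp [hcon f (Finset.ne_of_mem_erase hf) hvf h0]⟩
    · exact ⟨0, by simp [incidenceSign_eq_zero ho hvf]⟩
  choose! k hk using hint
  have hsum := hx.2 v
  rw [netOutflow_eq_sum ho, ← Finset.add_sum_erase _ _ (Finset.mem_univ e),
    Finset.sum_congr rfl hk, ← Int.cast_sum] at hsum
  obtain ⟨m, hm⟩ : ∃ m : ℤ, x e = m := by
    rcases incidenceSign_eq_one_or_neg_one o hv with h | h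
    · refine ⟨b v - ∑ f ∈ Finset.univ.erase e, k f, ?_⟩
      rw [h] at hsum
      push_cast at hsum ⊢
      linarith
    · refine ⟨-(b v - ∑ f ∈ Finset.univ.erase e, k f), ?_⟩
      rw [h] at hsum
      push_cast at hsum ⊢
      linarith
  obtain ⟨h0, h1⟩ := hx.1 e
  rw [hm] at he h0 h1
  have h0' : 0 ≤ m := by exact_mod_cast h0
  have h1' : m ≤ 1 := by exact_mod_cast h1
  obtain rfl | rfl : m = 0 ∨ m = 1 := by omega
  · exact he.1 (by simp)
  · exact he.2 (by simp)

/-- A fractional point admits a nonzero circulation supported on its fractional edges. -/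
lemma exists_circulation {n : ℕ} {o : CompleteEdge n → Fin n} (ho : ∀ e, o e ∈ e.val)
    {b : Fin n → ℤ} {x : CompleteEdge n → ℝ} (hx : x ∈ outflowPolytope o b)
    {e₀ : CompleteEdge n} (he₀ : x e₀ ≠ 0 ∧ x e₀ ≠ 1) :
    ∃ d : CompleteEdge n → ℝ, d ≠ 0 ∧ (∀ e, d e ≠ 0 → x e ≠ 0 ∧ x e ≠ 1) ∧
      ∀ v, ∑ e, (incidenceSign o v e : ℝ) * d e = 0 := by
  classical
  set S : Finset (CompleteEdge n) := Finset.univ.filter fun e => x e ≠ 0 ∧ x e ≠ 1 with hS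
  set U : Finset (Fin n) := Finset.univ.filter fun v => ∃ e ∈ S, v ∈ e.val with hU
  have hcard : U.card ≤ S.card := by
    refine Nat.le_of_mul_le_mul_right (Finset.card_mul_le_card_mul (m := 2) (n := 2)
      (fun v (e : CompleteEdge n) => v ∈ e.val) ?_ ?_) two_pos
    · intro v hv
      obtain ⟨e, he, hve⟩ := (Finset.mem_filter.1 hv).2
      obtain ⟨f, hfe, hvf, hf⟩ := exists_ne_fractional ho hx hve (Finset.mem_filter.1 he).2
      refine Finset.one_lt_card.2 ⟨f, ?_, e, ?_, hfe⟩
      · simp [Finset.bipartiteAbove, hS, hf, hvf]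
      · simp [Finset.bipartiteAbove, he, hve]
    · intro e _
      rw [← card_filter_mem_edge e]
      exact Finset.card_le_card (Finset.filter_subset_filter _ (Finset.subset_univ _))
  have hu₀ : o e₀ ∈ U := by
    simp only [hU, hS, Finset.mem_filter, Finset.mem_univ, true_and]
    exact ⟨e₀, he₀, ho e₀⟩
  let L : (S → ℝ) →ₗ[ℝ] (U.erase (o e₀) → ℝ) :=
    Matrix.mulVecLin (Matrix.of fun v e => (incidenceSign o v.1 e.1 : ℝ))
  have hker : LinearMap.ker L ≠ ⊥ := by
    apply LinearMap.ker_ne_bot_of_finrank_lt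
    simp only [Module.finrank_fintype_fun_eq_card, Fintype.card_coe]
    exact (Finset.card_erase_lt_of_mem hu₀).trans_le hcard
  obtain ⟨c, hc, hc0⟩ := (Submodule.ne_bot_iff _).1 hker
  let d : CompleteEdge n → ℝ := fun e => if h : e ∈ S then c ⟨e, h⟩ else 0
  have hsum : ∀ v, ∑ e, (incidenceSign o v e : ℝ) * d e
      = ∑ e : S, (incidenceSign o v e.1 : ℝ) * c e := by
    intro v
    rw [← Finset.sum_subset (Finset.subset_univ S), ← Finset.sum_coe_sort S]
    · exact Finset.sum_congr rfl fun e _ => by simp [d]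
    · intro e _ he
      simp [d, he]
  have hne : ∀ v, v ≠ o e₀ → ∑ e, (incidenceSign o v e : ℝ) * d e = 0 := by
    intro v hv
    rw [hsum]
    by_cases hvU : v ∈ U
    · exact congrFun (LinearMap.mem_ker.1 hc) ⟨v, Finset.mem_erase.2 ⟨hv, hvU⟩⟩
    · refine Finset.sum_eq_zero fun e _ => ?_
      rw [incidenceSign_eq_zero ho, Int.cast_zero, zero_mul]
      exact fun h => hvU (Finset.mem_filter.2 ⟨Finset.mem_univ _, e.1, e.2, h⟩)
  refine ⟨d, ?_, ?_, ?_⟩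
  · intro h
    apply hc0
    ext e
    simpa [d] using congrFun h e.1
  · intro e he
    by_contra h
    have heS : e ∉ S := fun h' => h (Finset.mem_filter.1 h').2
    exact he (dif_neg heS)
  · intro v
    by_cases hv : v = o e₀
    · have htot : ∑ v, ∑ e, (incidenceSign o v e : ℝ) * d e = 0 := by
        rw [Finset.sum_comm]
        refine Finset.sum_eq_zero fun e _ => ?_
        rw [← Finset.sum_mul, ← Int.cast_sum, sum_incidenceSign, Int.cast_zero, zero_mul]
      rwa [Finset.sum_eq_single v (fun w _ hw => hne w (hv ▸ hw)) (by simp)] at htot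
    · exact hne v hv

/-- The extreme points of `outflowPolytope o b` are integral. -/
lemma extremePoints_outflowPolytope_integral {n : ℕ} {o : CompleteEdge n → Fin n}
    (ho : ∀ e, o e ∈ e.val) {b : Fin n → ℤ} {x : CompleteEdge n → ℝ}
    (hx : x ∈ (outflowPolytope o b).extremePoints ℝ) (e : CompleteEdge n) :
    x e = 0 ∨ x e = 1 := by
  by_contra! he
  obtain ⟨d, hd0, hd, hdA⟩ := exists_circulation ho hx.1 he
  have hev : ∀ᶠ t in nhdsWithin (0 : ℝ) (Set.Ioi 0),
      ∀ f, |t * d f| ≤ x f ∧ |t * d f| ≤ 1 - x f := by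
    refine Filter.eventually_all.2 fun f => ?_
    obtain ⟨h0, h1⟩ := hx.1.1 f
    by_cases hf : d f = 0
    · exact Filter.Eventually.of_forall fun t => by simp [hf, h0, h1]
    · have hcont : Filter.Tendsto (fun t : ℝ => |t * d f|) (nhdsWithin 0 (Set.Ioi 0)) (nhds 0) := by
        have : Continuous fun t : ℝ => |t * d f| := by fun_prop
        simpa using (this.tendsto 0).mono_left nhdsWithin_le_nhds
      have hp0 : 0 < x f := h0.lt_of_ne (hd f hf).1.symm
      have hp1 : 0 < 1 - x f := sub_pos.2 (h1.lt_of_ne (hd f hf).2)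
      filter_upwards [hcont.eventually_lt_const hp0, hcont.eventually_lt_const hp1] with t ha hb
      exact ⟨ha.le, hb.le⟩
  obtain ⟨t, ht, htpos⟩ := (hev.and self_mem_nhdsWithin).exists
  have hmem : ∀ s : ℝ, |s| = t → x + s • d ∈ outflowPolytope o b := by
    intro s hs
    refine ⟨fun f => ?_, fun v => ?_⟩
    · obtain ⟨ha, hb⟩ := ht f
      have habs : |t * d f| = |s * d f| := by rw [abs_mul, abs_mul, ← hs, abs_abs]
      rw [habs] at ha hb
      simp only [Pi.add_apply, Pi.smul_apply, smul_eq_mul]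
      constructor <;> linarith [(abs_le.1 ha).1, (abs_le.1 hb).2]
    · rw [← hx.1.2 v, netOutflow_eq_sum ho, netOutflow_eq_sum ho]
      have : ∑ e, (incidenceSign o v e : ℝ) * (s * d e) = 0 := by
        simp only [mul_left_comm _ s, ← Finset.mul_sum, hdA v, mul_zero]
      simp only [Pi.add_apply, Pi.smul_apply, smul_eq_mul, mul_add, Finset.sum_add_distrib, this,
        add_zero]
  have htpos : 0 < t := htpos
  have hseg : x ∈ openSegment ℝ (x + t • d) (x + (-t) • d) :=
    ⟨1 / 2, 1 / 2, by norm_num, by norm_num, by norm_num, by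
      ext f
      simp only [Pi.add_apply, Pi.smul_apply, smul_eq_mul]
      ring⟩
  have heq := hx.2 (hmem t (abs_of_pos htpos)) (hmem (-t) (by rw [abs_neg, abs_of_pos htpos])) hseg
  have hz : t • d = 0 := by simpa using heq
  exact (smul_ne_zero htpos.ne' hd0) hz

lemma isCompact_outflowPolytope {n : ℕ} {o : CompleteEdge n → Fin n} (ho : ∀ e, o e ∈ e.val)
    (b : Fin n → ℤ) : IsCompact (outflowPolytope o b) := by
  have hcube : IsCompact (Set.Icc (0 : CompleteEdge n → ℝ) 1) := isCompact_Icc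
  refine hcube.of_isClosed_subset ?_ fun x hx => ⟨fun e => (hx.1 e).1, fun e => (hx.1 e).2⟩
  have : outflowPolytope o b = Set.Icc (0 : CompleteEdge n → ℝ) 1 ∩
      ⋂ v, {x | ∑ e, (incidenceSign o v e : ℝ) * x e = b v} := by
    ext x
    simp only [outflowPolytope, netOutflow_eq_sum ho, Set.mem_ofPred_eq, Set.mem_inter_iff,
      Set.mem_Icc, Set.mem_iInter, Pi.le_def, Pi.zero_apply, Pi.one_apply, forall_and]
  rw [this]
  exact isClosed_Icc.inter (isClosed_iInter fun v => isClosed_eq (by fun_prop) continuous_const)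

lemma convex_outflowPolytope {n : ℕ} {o : CompleteEdge n → Fin n} (ho : ∀ e, o e ∈ e.val)
    (b : Fin n → ℤ) : Convex ℝ (outflowPolytope o b) := by
  intro x hx y hy s t hs ht hst
  refine ⟨fun e => ?_, fun v => ?_⟩
  · exact convex_Icc (0 : ℝ) 1 (hx.1 e) (hy.1 e) hs ht hst
  · have h1 := hx.2 v
    have h2 := hy.2 v
    rw [netOutflow_eq_sum ho] at h1 h2 ⊢
    simp only [Pi.add_apply, Pi.smul_apply, smul_eq_mul, mul_add, Finset.sum_add_distrib,
      mul_left_comm _ s, mul_left_comm _ t, ← Finset.mul_sum, h1, h2]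
    rw [← add_mul, hst, one_mul]

/-- A 0/1 vector with odd net outflows is the characteristic vector of a `V`-join. -/
lemma exists_isVJoin_of_integral {n : ℕ} {o : CompleteEdge n → Fin n} (ho : ∀ e, o e ∈ e.val)
    {z : Fin n → ℤ} {x : CompleteEdge n → ℝ} (h01 : ∀ e, x e = 0 ∨ x e = 1)
    (hz : ∀ v, netOutflow o x v = 2 * (z v : ℝ) + 1) :
    ∃ F : Set (Sym2 (Fin n)), IsVJoin n F ∧
      x = fun e : CompleteEdge n => Set.indicator F (fun _ => (1 : ℝ)) e.val := by
  set F : Set (Sym2 (Fin n)) := Subtype.val '' {e | x e = 1} with hF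
  have hdiag : ∀ e ∈ F, ¬ e.IsDiag := by
    rintro _ ⟨e, _, rfl⟩
    exact e.2
  have hxF : x = fun e : CompleteEdge n => Set.indicator F (fun _ => (1 : ℝ)) e.val := by
    funext e
    have hmem : e.val ∈ F ↔ x e = 1 := Subtype.val_injective.mem_set_image
    rcases h01 e with h | h <;> simp [hmem, h]
  refine ⟨F, ⟨hdiag, fun v => ?_⟩, hxF⟩
  obtain ⟨k, hk⟩ := netOutflow_indicator ho hdiag v
  rw [← hxF, hz v] at hk
  have hk' : 2 * z v + 1 = ({e ∈ F | v ∈ e}.ncard : ℤ) - 2 * k := by exact_mod_cast hk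
  rw [Nat.odd_iff]
  omega

lemma exists_netOutflow_of_isVJoin {n : ℕ} {o : CompleteEdge n → Fin n} (ho : ∀ e, o e ∈ e.val)
    {F : Set (Sym2 (Fin n))} (hF : IsVJoin n F) (v : Fin n) :
    ∃ z : ℤ, netOutflow o (fun e => F.indicator (fun _ => (1 : ℝ)) e.val) v
      = 2 * (z : ℝ) + 1 := by
  obtain ⟨k, hk⟩ := netOutflow_indicator ho hF.1 v
  obtain ⟨m, hm⟩ := hF.2 v
  refine ⟨(m : ℤ) - k, ?_⟩
  rw [hk, hm]
  push_cast
  ring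

lemma isClosed_vjoinPolytope (n : ℕ) : IsClosed (vjoinPolytope n) := by
  refine Set.Finite.isClosed_convexHull ℝ ?_
  refine (Set.finite_range fun (F : Set (Sym2 (Fin n))) (e : CompleteEdge n) =>
    Set.indicator F (fun _ => (1 : ℝ)) e.val).subset ?_
  rintro x ⟨F, _, rfl⟩
  exact ⟨F, rfl⟩

/-- Let `n` be even and fix an orientation of `K_n` (given by a head
`o e ∈ e` for each edge `e`; the edge leaves its other endpoint and enters `o e`).  Then
`P_vjoin(n) = conv { x ∈ [0,1]^E : ∃ z ∈ ℤ^V, x(δ⁺(v)) - x(δ⁻(v)) = 2·z_v + 1 ∀ v }`. -/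
theorem vjoin_milef_formula (n : ℕ) (hn : Even n)
    (o : CompleteEdge n → Fin n) (ho : ∀ e : CompleteEdge n, o e ∈ e.val) :
    vjoinPolytope n =
      convexHull ℝ { x : CompleteEdge n → ℝ |
        (∀ e, 0 ≤ x e ∧ x e ≤ 1) ∧
        ∃ z : Fin n → ℤ, ∀ v : Fin n,
          setSum {e : CompleteEdge n | v ∈ e.val ∧ o e ≠ v} x -
            setSum {e : CompleteEdge n | o e = v} x = 2 * (z v : ℝ) + 1 } := by
  apply Set.Subset.antisymm
  · refine convexHull_mono ?_
    rintro x ⟨F, hF, rfl⟩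
    refine ⟨fun e => ?_, ?_⟩
    · by_cases h : e.val ∈ F <;> simp [h]
    · choose z hz using exists_netOutflow_of_isVJoin ho hF
      exact ⟨z, hz⟩
  · refine convexHull_min ?_ (convex_convexHull ℝ _)
    rintro x ⟨hx, z, hz⟩
    have hmem : x ∈ outflowPolytope o fun v => 2 * z v + 1 :=
      ⟨hx, fun v => by push_cast; exact hz v⟩
    rw [← closure_convexHull_extremePoints (isCompact_outflowPolytope ho _)
      (convex_outflowPolytope ho _)] at hmem
    refine closure_minimal (convexHull_mono fun y hy => ?_) (isClosed_vjoinPolytope n) hmem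
    refine exists_isVJoin_of_integral ho (z := z)
      (extremePoints_outflowPolytope_integral ho hy) fun v => ?_
    simpa using hy.1.2 v
end

section
/- Let G = (V,E) be any undirected graph and fix any orientation of its edges; for v ∈ V let δ(v) denote the set of edges incident to v and δ⁺(v) the set of edges leaving v under this orientation, and for x ∈ ℝ^E and F ⊆ E write x(F) := Σ_{e∈F} x_e. Then the matching polytope P of G satisfies P = conv { x ∈ ℝ^E_{≥0} : x(δ(v)) ≤ 1 and x(δ⁺(v)) ∈ ℤ for every v ∈ V }. -/
open scoped ENNReal

/-- The matching polytope of a graph `G`: the convex hull in `ℝ^E` of the characteristic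
vectors of all matchings of `G` (edge sets in which every vertex lies in at most one
edge). -/
noncomputable def graphMatchingPolytope {V : Type*} (G : SimpleGraph V) :
    Set (G.edgeSet → ℝ) :=
  convexHull ℝ { x | ∃ M : Set G.edgeSet,
    (∀ e ∈ M, ∀ f ∈ M, e ≠ f → ∀ v : V, ¬ (v ∈ (e : Sym2 V) ∧ v ∈ (f : Sym2 V))) ∧
    x = fun e => Set.indicator M (fun _ => (1 : ℝ)) e }

section FractionalMatching

variable {V E : Type*}

theorem setSum_nonneg [Fintype E] {x : E → ℝ} (hx : ∀ e, 0 ≤ x e) (s : Set E) :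
    0 ≤ setSum s x :=
  Finset.sum_nonneg fun e _ => Set.indicator_nonneg (fun e _ => hx e) e

theorem setSum_union_of_disjoint [Fintype E] (x : E → ℝ) {s t : Set E} (h : Disjoint s t) :
    setSum (s ∪ t) x = setSum s x + setSum t x := by
  simp [setSum, Set.indicator_union_of_disjoint h, Finset.sum_add_distrib]

theorem le_setSum_of_mem [Fintype E] {x : E → ℝ} (hx : ∀ e, 0 ≤ x e) {s : Set E} {e : E}
    (he : e ∈ s) : x e ≤ setSum s x := by
  have h := Finset.single_le_sum (f := s.indicator x)
    (fun e _ => Set.indicator_nonneg (fun e _ => hx e) e) (Finset.mem_univ e)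
  rwa [Set.indicator_of_mem he] at h

theorem setSum_singleton [Fintype E] (e : E) (x : E → ℝ) : setSum {e} x = x e := by
  classical
  simp [setSum, Set.indicator_apply]

theorem setSum_indicator_one [Fintype E] (s M : Set E) :
    setSum s (M.indicator fun _ => (1 : ℝ)) = ((s ∩ M).ncard : ℝ) := by
  classical
  rw [setSum, Set.indicator_indicator, Set.ncard_eq_toFinset_card', Set.toFinset_card,
    Fintype.card_subtype]
  simp [Set.indicator_apply]

/-- The doubly stochastic matrix on `n ⊕ n` which completes a substochastic matrix `A`. -/
def Matrix.substochasticCompletion {n : Type*} [Fintype n] [DecidableEq n] (A : Matrix n n ℝ) :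
    Matrix (n ⊕ n) (n ⊕ n) ℝ :=
  Matrix.fromBlocks A (Matrix.diagonal fun i => 1 - ∑ j, A i j)
    (Matrix.diagonal fun j => 1 - ∑ i, A i j) A.transpose

theorem Matrix.substochasticCompletion_mem {n : Type*} [Fintype n] [DecidableEq n]
    {A : Matrix n n ℝ} (h0 : ∀ i j, 0 ≤ A i j) (hr : ∀ i, ∑ j, A i j ≤ 1)
    (hc : ∀ j, ∑ i, A i j ≤ 1) : A.substochasticCompletion ∈ doublyStochastic ℝ (n ⊕ n) := by
  rw [mem_doublyStochastic_iff_sum]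
  refine ⟨?_, ?_, ?_⟩
  · rintro (i | i) (j | j)
    · exact h0 i j
    · by_cases h : i = j
      · subst h; simpa [substochasticCompletion] using hr i
      · simp [substochasticCompletion, h]
    · by_cases h : i = j
      · subst h; simpa [substochasticCompletion] using hc i
      · simp [substochasticCompletion, h]
    · exact h0 j i
  · rintro (i | i) <;> simp [substochasticCompletion, Matrix.diagonal_apply]
  · rintro (i | i) <;> simp [substochasticCompletion, Matrix.diagonal_apply]

/-- The entries at the positions `(t e, h e)` with `t e ∈ A` and `h e ∉ A` of the upper left block
of a matrix, as a vector indexed by `e`. -/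
noncomputable def crossingEntries (t h : E → V) (A : Set V) :
    Matrix (V ⊕ V) (V ⊕ V) ℝ →ₗ[ℝ] E → ℝ where
  toFun M := Set.indicator {e | t e ∈ A ∧ h e ∉ A} fun e => M (.inl (t e)) (.inl (h e))
  map_add' _ _ := Set.indicator_add _ _ _
  map_smul' c _ := Set.indicator_const_smul _ c _

theorem crossingEntries_apply_of_mem {t h : E → V} {A : Set V} (M : Matrix (V ⊕ V) (V ⊕ V) ℝ)
    {e : E} (he : t e ∈ A ∧ h e ∉ A) :
    crossingEntries t h A M e = M (.inl (t e)) (.inl (h e)) := by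
  change Set.indicator {e | t e ∈ A ∧ h e ∉ A} (fun e => M (.inl (t e)) (.inl (h e))) e = _
  simp [he]

theorem crossingEntries_apply_of_notMem {t h : E → V} {A : Set V}
    (M : Matrix (V ⊕ V) (V ⊕ V) ℝ) {e : E} (he : ¬(t e ∈ A ∧ h e ∉ A)) :
    crossingEntries t h A M e = 0 := by
  change Set.indicator {e | t e ∈ A ∧ h e ∉ A} (fun e => M (.inl (t e)) (.inl (h e))) e = _
  simp [he]

/-- A fractional matching supported on the edges from `A` to its complement is a convex combination
of matchings. -/
theorem mem_convexHull_matching_of_support [Fintype V] [Fintype E] {t h : E → V}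
    (hinj : ∀ e f, t e = t f → h e = h f → e = f) {x : E → ℝ} (hx : ∀ e, 0 ≤ x e)
    (hout : ∀ v, setSum {e | t e = v} x ≤ 1) (hin : ∀ v, setSum {e | h e = v} x ≤ 1)
    {A : Set V} (hA : ∀ e, x e ≠ 0 → t e ∈ A ∧ h e ∉ A) :
    x ∈ convexHull ℝ {y | ∃ M : Set E, (∀ e ∈ M, ∀ f ∈ M, e ≠ f →
      ∀ v : V, ¬ ((v = t e ∨ v = h e) ∧ (v = t f ∨ v = h f))) ∧
      y = fun e => M.indicator (fun _ => (1 : ℝ)) e} := by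
  classical
  let B : Matrix V V ℝ := fun a b => setSum {e | t e = a ∧ h e = b} x
  have hB : B.substochasticCompletion ∈ doublyStochastic ℝ (V ⊕ V) := by
    apply Matrix.substochasticCompletion_mem
    · exact fun i j => setSum_nonneg hx _
    · intro i
      refine le_of_eq_of_le ?_ (hout i)
      simp only [B, setSum]
      rw [Finset.sum_comm]
      refine Finset.sum_congr rfl fun e _ => ?_
      by_cases hi : t e = i <;> simp [Set.indicator_apply, hi]
    · intro j
      refine le_of_eq_of_le ?_ (hin j)
      simp only [B, setSum]
      rw [Finset.sum_comm]
      refine Finset.sum_congr rfl fun e _ => ?_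
      by_cases hj : h e = j <;> simp [Set.indicator_apply, hj]
  have hxB : crossingEntries t h A B.substochasticCompletion = x := by
    funext e
    by_cases he : t e ∈ A ∧ h e ∉ A
    · have hs : {f | t f = t e ∧ h f = h e} = {e} := by
        ext f
        exact ⟨fun hf => hinj f e hf.1 hf.2, by rintro rfl; exact ⟨rfl, rfl⟩⟩
      rw [crossingEntries_apply_of_mem _ he, Matrix.substochasticCompletion,
        Matrix.fromBlocks_apply₁₁]
      simp only [B, hs, setSum_singleton]
    · have : x e = 0 := by_contra fun h0 => he (hA e h0)
      rw [this, crossingEntries_apply_of_notMem _ he]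
  rw [← SetLike.mem_coe, doublyStochastic_eq_convexHull_permMatrix] at hB
  have himg := Set.mem_image_of_mem (crossingEntries t h A) hB
  rw [LinearMap.image_convexHull, hxB] at himg
  refine convexHull_mono ?_ himg
  rintro _ ⟨_, ⟨σ, rfl⟩, rfl⟩
  refine ⟨{e | (t e ∈ A ∧ h e ∉ A) ∧ σ (.inl (t e)) = .inl (h e)}, ?_, ?_⟩
  · rintro e ⟨⟨hte, hhe⟩, hσe⟩ f ⟨⟨htf, hhf⟩, hσf⟩ hef v ⟨rfl | rfl, hv | hv⟩
    · rw [hv, hσf] at hσe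
      exact hef (hinj e f hv (Sum.inl_injective hσe).symm)
    · exact hhf (hv ▸ hte)
    · exact hhe (hv ▸ htf)
    · rw [hv, ← hσf] at hσe
      exact hef (hinj e f (Sum.inl_injective (σ.injective hσe)) hv)
  · funext e
    by_cases he : t e ∈ A ∧ h e ∉ A
    · rw [crossingEntries_apply_of_mem _ he]
      simp [Set.indicator_apply, he, Equiv.Perm.permMatrix, PEquiv.toMatrix_apply,
        Equiv.toPEquiv_apply, eq_comm]
    · simp [crossingEntries_apply_of_notMem _ he, he]

end FractionalMatching

/-- Let `G = (V,E)` be an undirected graph with a fixed orientation of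
its edges (given by a head `o e ∈ e` for each edge; the edge leaves its other endpoint).
With `δ(v)` the edges incident to `v` and `δ⁺(v)` the edges leaving `v`, the matching
polytope `P` of `G` satisfies
`P = conv { x ∈ ℝ^E_{≥0} : x(δ(v)) ≤ 1 and x(δ⁺(v)) ∈ ℤ for every v ∈ V }`. -/
theorem matching_formula {V : Type*} [Fintype V] (G : SimpleGraph V) [Fintype G.edgeSet]
    (o : G.edgeSet → V) (ho : ∀ e : G.edgeSet, o e ∈ (e : Sym2 V)) :
    graphMatchingPolytope G =
      convexHull ℝ { x : G.edgeSet → ℝ |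
        (∀ e, 0 ≤ x e) ∧
        ∀ v : V,
          setSum {e : G.edgeSet | v ∈ (e : Sym2 V)} x ≤ 1 ∧
          ∃ z : ℤ, setSum {e : G.edgeSet | v ∈ (e : Sym2 V) ∧ o e ≠ v} x = (z : ℝ) } := by
  choose t ht using fun e => ho e
  replace ht : ∀ e : G.edgeSet, (e : Sym2 V) = s(t e, o e) := fun e => by
    rw [ht e, Sym2.eq_swap]
  have hmem : ∀ (e : G.edgeSet) (v : V), v ∈ (e : Sym2 V) ↔ v = t e ∨ v = o e := fun e v => by
    rw [ht e, Sym2.mem_iff]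
  have hne : ∀ e, t e ≠ o e := fun e => by
    have := e.2
    rw [ht e, SimpleGraph.mem_edgeSet] at this
    exact this.ne
  have hinj : ∀ e f, t e = t f → o e = o f → e = f := fun e f h₁ h₂ =>
    Subtype.ext (by rw [ht e, ht f, h₁, h₂])
  have hout : ∀ v, {e : G.edgeSet | v ∈ (e : Sym2 V) ∧ o e ≠ v} = {e | t e = v} := by
    intro v
    ext e
    have := hne e
    simp only [hmem, Set.mem_ofPred_eq]
    grind
  have hinc : ∀ v, {e : G.edgeSet | v ∈ (e : Sym2 V)} = {e | t e = v} ∪ {e | o e = v} := by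
    intro v
    ext e
    simp [hmem, eq_comm]
  have hdisj : ∀ v, Disjoint {e | t e = v} {e | o e = v} := fun v =>
    Set.disjoint_left.2 fun e h₁ h₂ => hne e (h₁.trans h₂.symm)
  apply Set.Subset.antisymm
  · refine convexHull_mono ?_
    rintro _ ⟨M, hM, rfl⟩
    refine ⟨fun e => Set.indicator_nonneg (fun _ _ => zero_le_one) e, fun v => ⟨?_, ?_⟩⟩
    · rw [setSum_indicator_one]
      norm_cast
      rw [Set.ncard_le_one]
      rintro e ⟨hve, he⟩ f ⟨hvf, hf⟩
      exact by_contra fun hef => hM e he f hf hef v ⟨hve, hvf⟩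
    · exact ⟨_, (setSum_indicator_one _ _).trans (Int.cast_natCast _).symm⟩
  · refine convexHull_min ?_ (convex_convexHull ℝ _)
    rintro x ⟨hx, hv⟩
    simp only [hout, hinc, setSum_union_of_disjoint x (hdisj _)] at hv
    have h₁ : ∀ v, 0 ≤ setSum {e | t e = v} x := fun v => setSum_nonneg hx _
    have h₂ : ∀ v, 0 ≤ setSum {e | o e = v} x := fun v => setSum_nonneg hx _
    have := mem_convexHull_matching_of_support hinj hx (fun v => by linarith [hv v, h₂ v])
      (fun v => by linarith [hv v, h₁ v]) (A := {v | 0 < setSum {e | t e = v} x}) fun e he => by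
        have hpos : 0 < x e := (hx e).lt_of_ne' he
        refine ⟨hpos.trans_le (le_setSum_of_mem hx rfl), fun hlt => ?_⟩
        have hin : x e ≤ setSum {f | o f = o e} x := le_setSum_of_mem hx rfl
        obtain ⟨hle, z, hz⟩ := hv (o e)
        rw [Set.mem_ofPred_eq, hz] at hlt
        rw [hz] at hle
        have : (1 : ℝ) ≤ z := by exact_mod_cast hlt
        linarith
    simpa only [graphMatchingPolytope, hmem] using this
end
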